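/- arXiv:2101.08249 — 2 statements merged into one kernel-verified Lean document; each statement's English description precedes it below -/
import Mathlib

section
/- Let 0 < p ≤ 1/2 be fixed, and for each n let A_n be the adjacency matrix of a uniformly random simple graph on n vertices with exactly m_n edges, where |m_n − p·binom(n,2)| = O(1). Let (t_n) be a sequence with n^{3/4}·t_n → ∞ and t_n → 0. Then Pr(τ(A_n) ≤ p^3 − t_n) is bounded above by exp(−(ln(p/(1−p))/(2(2p−1))) t_n^{2/3} n^2 + o(t_n^{2/3} n^2)) (with the coefficient interpreted as 1 when p = 1/2) and bounded below by exp(−(1/(2p(1−p))) t_n^{2/3} n^2 + o(t_n^{2/3} n^2)). In particular, Pr(τ(A_n) ≤ p^3 − t_n) = exp(−Θ(t_n^{2/3} n^2)). -/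
open Filter MeasureTheory ProbabilityTheory Matrix
open scoped Topology ENNReal BigOperators

noncomputable section

/-- Extended-real logarithm of a real number: `⊥` for nonpositive inputs. -/
def elogR (x : ℝ) : EReal := if x ≤ 0 then ⊥ else ((Real.log x : ℝ) : EReal)

/-- Legendre transform of `f : ℝ → ℝ`, valued in the extended reals. -/
def legendre (f : ℝ → ℝ) (y : ℝ) : EReal := ⨆ x : ℝ, ((x * y - f x : ℝ) : EReal)

/-- Frobenius inner product of two square matrices. -/
def finner {n : ℕ} (A B : Matrix (Fin n) (Fin n) ℝ) : ℝ := ∑ i, ∑ j, A i j * B i j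

/-- Frobenius norm. -/
def fnorm {n : ℕ} (M : Matrix (Fin n) (Fin n) ℝ) : ℝ := Real.sqrt (finner M M)

open Classical in
/-- `eigDesc A i` is the `(i+1)`-st largest eigenvalue of a symmetric real matrix `A`
(0-indexed, so `eigDesc A 0 = λ_1` is the largest and `eigDesc A (n-1) = λ_n` the smallest);
junk value `0` out of range or for non-symmetric `A`. -/
def eigDesc {n : ℕ} (A : Matrix (Fin n) (Fin n) ℝ) (i : ℕ) : ℝ :=
  if h : i < n then
    (if hA : A.IsHermitian then
      hA.eigenvalues ((Tuple.sort hA.eigenvalues) (Fin.rev ⟨i, h⟩)) else 0)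
  else 0

/-- `singDesc A i` is the `(i+1)`-st largest singular value of `A` (0-indexed). -/
def singDesc {n : ℕ} (A : Matrix (Fin n) (Fin n) ℝ) (i : ℕ) : ℝ :=
  Real.sqrt (eigDesc (Aᵀ * A) i)

/-- Index type for potential edges: ordered pairs `i < j`. -/
abbrev EdgeIdx (n : ℕ) := {p : Fin n × Fin n // p.1 < p.2}

/-- Number of edges of the graph encoded by `g`. -/
def edgeCount {n : ℕ} (g : EdgeIdx n → Bool) : ℕ :=
  (Finset.univ.filter fun p => g p = true).card

/-- Adjacency matrix of the graph encoded by `g`. -/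
def adjOf {n : ℕ} (g : EdgeIdx n → Bool) : Matrix (Fin n) (Fin n) ℝ :=
  Matrix.of fun i j =>
    if h : i < j then (if g ⟨(i, j), h⟩ then 1 else 0)
    else if h' : j < i then (if g ⟨(j, i), h'⟩ then 1 else 0) else 0

open Classical in
/-- Probability, under the uniform distribution `G(n,m)` over simple graphs on `n` labeled
vertices with exactly `m` edges, that the adjacency matrix satisfies `pred`. -/
def grProb (n m : ℕ) (pred : Matrix (Fin n) (Fin n) ℝ → Prop) : ℝ :=
  ((Finset.univ.filter fun g : EdgeIdx n → Bool =>
      edgeCount g = m ∧ pred (adjOf g)).card : ℝ) /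
  ((Finset.univ.filter fun g : EdgeIdx n → Bool => edgeCount g = m).card : ℝ)

open Classical in
/-- Conditional probability of `pred` given `cond` under `G(n,m)`. -/
def condGrProb (n m : ℕ) (pred cond : Matrix (Fin n) (Fin n) ℝ → Prop) : ℝ :=
  ((Finset.univ.filter fun g : EdgeIdx n → Bool =>
      edgeCount g = m ∧ cond (adjOf g) ∧ pred (adjOf g)).card : ℝ) /
  ((Finset.univ.filter fun g : EdgeIdx n → Bool =>
      edgeCount g = m ∧ cond (adjOf g)).card : ℝ)

/-- Triangle density `tr(A³)/(n(n-1)(n-2))`. -/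
def triDensity {n : ℕ} (A : Matrix (Fin n) (Fin n) ℝ) : ℝ :=
  (A * A * A).trace / ((n : ℝ) * ((n : ℝ) - 1) * ((n : ℝ) - 2))

namespace LowerTail

theorem antitoneOn_sinh_div_mul_cosh :
    AntitoneOn (fun y : ℝ => Real.sinh y / (y * Real.cosh y)) (Set.Ioi 0) := by
  have hd : ∀ y : ℝ, 0 < y → HasDerivAt (fun y : ℝ => Real.sinh y / (y * Real.cosh y))
      ((Real.cosh y * (y * Real.cosh y) - Real.sinh y * (1 * Real.cosh y + y * Real.sinh y)) /
        (y * Real.cosh y) ^ 2) y := by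
    intro y hy
    exact (Real.hasDerivAt_sinh y).div ((hasDerivAt_id y).mul (Real.hasDerivAt_cosh y))
      (mul_pos hy (Real.cosh_pos y)).ne'
  apply antitoneOn_of_deriv_nonpos (convex_Ioi 0)
  · intro y hy
    exact (hd y hy).continuousAt.continuousWithinAt
  · intro y hy
    rw [interior_Ioi] at hy
    exact (hd y hy).differentiableAt.differentiableWithinAt
  · intro y hy
    rw [interior_Ioi] at hy
    have hy : 0 < y := hy
    rw [(hd y hy).deriv]
    apply div_nonpos_of_nonpos_of_nonneg _ (sq_nonneg _)
    have h1 := Real.cosh_sq y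
    have h2 : y ≤ Real.sinh y := Real.self_le_sinh_iff.2 hy.le
    have h3 := Real.one_le_cosh y
    nlinarith

theorem cosh_le_cosh_mul_exp {a : ℝ} (ha : 0 < a) (y : ℝ) :
    Real.cosh y ≤ Real.cosh a *
      Real.exp (Real.sinh a / (2 * (a * Real.cosh a)) * (y ^ 2 - a ^ 2)) := by
  wlog hy : 0 ≤ y generalizing y
  · have := this (-y) (by linarith)
    simpa using this
  set c := Real.sinh a / (a * Real.cosh a) with hc
  have hc2 : Real.sinh a / (2 * (a * Real.cosh a)) = c / 2 := by rw [hc]; ring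
  rw [hc2]
  set h : ℝ → ℝ := fun y => Real.log (Real.cosh y) - c / 2 * y ^ 2 with hh
  have hd : ∀ y : ℝ, HasDerivAt h (Real.sinh y / Real.cosh y - c / 2 * (2 * y)) y := by
    intro y
    have h1 := (Real.hasDerivAt_cosh y).log (Real.cosh_pos y).ne'
    have h2 := ((hasDerivAt_pow 2 y).const_mul (c / 2))
    exact (h1.sub h2).congr_deriv (by norm_num)
  have hcont : Continuous h := continuous_iff_continuousAt.2 fun y => (hd y).continuousAt
  have key : ∀ y, 0 < y → Real.sinh y / Real.cosh y - c / 2 * (2 * y) =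
      y * (Real.sinh y / (y * Real.cosh y) - c) := by
    intro y hy
    have := (Real.cosh_pos y).ne'
    field_simp
  have hmain : h y ≤ h a := by
    rcases le_total y a with hya | hya
    · have : MonotoneOn h (Set.Icc 0 a) := by
        apply monotoneOn_of_deriv_nonneg (convex_Icc 0 a) hcont.continuousOn
          (fun y _ => (hd y).differentiableAt.differentiableWithinAt)
        intro y hy
        rw [interior_Icc] at hy
        rw [(hd y).deriv, key y hy.1]
        exact mul_nonneg hy.1.le (sub_nonneg.2
          (antitoneOn_sinh_div_mul_cosh hy.1 ha hy.2.le))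
      exact this ⟨hy, hya⟩ ⟨ha.le, le_rfl⟩ hya
    · have : AntitoneOn h (Set.Ici a) := by
        apply antitoneOn_of_deriv_nonpos (convex_Ici a) hcont.continuousOn
          (fun y _ => (hd y).differentiableAt.differentiableWithinAt)
        intro y hy
        rw [interior_Ici] at hy
        have hy : a < y := hy
        rw [(hd y).deriv, key y (ha.trans hy)]
        exact mul_nonpos_of_nonneg_of_nonpos (ha.trans hy).le (sub_nonpos.2
          (antitoneOn_sinh_div_mul_cosh ha (ha.trans hy) hy.le))
      exact this (Set.mem_Ici.2 le_rfl) hya hya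
  have hcy := Real.cosh_pos y
  have hca := Real.cosh_pos a
  rw [← Real.log_le_log_iff hcy (mul_pos hca (Real.exp_pos _)),
    Real.log_mul hca.ne' (Real.exp_pos _).ne', Real.log_exp]
  simp only [hh] at hmain
  linarith

/-- The optimal variance proxy of a centered Bernoulli variable. -/
def varProxy (p : ℝ) : ℝ := if p = 1 / 2 then 1 / 4 else (2 * p - 1) / (2 * Real.log (p / (1 - p)))

theorem log_div_one_sub_neg {p : ℝ} (hp₀ : 0 < p) (hp₁ : p < 1 / 2) :
    Real.log (p / (1 - p)) < 0 := by
  apply Real.log_neg (by apply div_pos <;> linarith)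
  rw [div_lt_one (by linarith)]
  linarith

theorem varProxy_pos {p : ℝ} (hp₀ : 0 < p) (hp₁ : p ≤ 1 / 2) : 0 < varProxy p := by
  unfold varProxy
  split_ifs with h
  · norm_num
  · have hp : p < 1 / 2 := lt_of_le_of_ne hp₁ h
    have := log_div_one_sub_neg hp₀ hp
    exact div_pos_of_neg_of_neg (by linarith) (by linarith)

theorem one_div_four_mul_varProxy {p : ℝ} (hp₀ : 0 < p) (hp₁ : p ≤ 1 / 2) :
    (if p = 1 / 2 then 1 else Real.log (p / (1 - p)) / (2 * (2 * p - 1))) =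
      1 / (4 * varProxy p) := by
  unfold varProxy
  split_ifs with h
  · norm_num
  · have hp : p < 1 / 2 := lt_of_le_of_ne hp₁ h
    have h1 := log_div_one_sub_neg hp₀ hp
    have h2 : 2 * p - 1 ≠ 0 := by linarith
    have h3 := h1.ne
    field_simp
    norm_num

/-- The Kearns–Saul inequality. -/
theorem bernoulli_mgf_le {p : ℝ} (hp₀ : 0 < p) (hp₁ : p ≤ 1 / 2) (x : ℝ) :
    p * Real.exp (x * (1 - p)) + (1 - p) * Real.exp (x * (0 - p)) ≤
      Real.exp (varProxy p * x ^ 2 / 2) := by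
  unfold varProxy
  split_ifs with h
  · have := Real.cosh_le_exp_half_sq (x / 2)
    rw [Real.cosh_eq] at this
    subst h
    have e1 : x * (1 - 1 / 2) = x / 2 := by ring
    have e2 : x * (0 - 1 / 2) = -(x / 2) := by ring
    have e3 : 1 / 4 * x ^ 2 / 2 = (x / 2) ^ 2 / 2 := by ring
    rw [e1, e2, e3]
    linarith
  · have hp : p < 1 / 2 := lt_of_le_of_ne hp₁ h
    have h1 := log_div_one_sub_neg hp₀ hp
    have hq : 0 < 1 - p := by linarith
    set l := Real.log (p / (1 - p)) with hl
    set a := -l / 2 with ha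
    have ha0 : 0 < a := by rw [ha]; linarith
    have hexp : Real.exp (2 * a) * p = 1 - p := by
      have : 2 * a = -l := by rw [ha]; ring
      rw [this, hl, ← Real.log_inv, Real.exp_log (inv_pos.2 (div_pos hp₀ hq))]
      field_simp
    set A := Real.exp a with hA
    have hA0 : 0 < A := Real.exp_pos a
    have hA2 : A ^ 2 * p = 1 - p := by
      rw [← hexp, hA, ← Real.exp_nat_mul]; norm_num
    have hcosh : Real.cosh a = 1 / (2 * p * A) := by
      rw [Real.cosh_eq, Real.exp_neg, ← hA]
      field_simp
      nlinarith
    have hsinh : Real.sinh a = (1 - 2 * p) / (2 * p * A) := by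
      rw [Real.sinh_eq, Real.exp_neg, ← hA]
      field_simp
      nlinarith
    have hk := cosh_le_cosh_mul_exp ha0 (x / 2 - a)
    have hc : Real.sinh a / (2 * (a * Real.cosh a)) = (1 - 2 * p) / (2 * a) := by
      rw [hcosh, hsinh]
      field_simp
    have hlhs : p * Real.exp (x * (1 - p)) + (1 - p) * Real.exp (x * (0 - p)) =
        Real.exp (x * (1 / 2 - p)) * (Real.cosh (x / 2 - a) / Real.cosh a) := by
      rw [Real.cosh_eq (x / 2 - a), hcosh, Real.exp_neg, Real.exp_sub, ← hA]
      have e1 : x * (1 - p) = x * (1 / 2 - p) + x / 2 := by ring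
      have e2 : x * (0 - p) = x * (1 / 2 - p) - x / 2 := by ring
      rw [e1, e2, Real.exp_add, Real.exp_sub, ← hA2]
      have := Real.exp_pos (x / 2)
      field_simp
    rw [hlhs]
    have hca := Real.cosh_pos a
    have : Real.cosh (x / 2 - a) / Real.cosh a ≤
        Real.exp ((1 - 2 * p) / (2 * a) * ((x / 2 - a) ^ 2 - a ^ 2)) := by
      rw [div_le_iff₀ hca, mul_comm, ← hc]
      exact hk
    calc _ ≤ Real.exp (x * (1 / 2 - p)) *
          Real.exp ((1 - 2 * p) / (2 * a) * ((x / 2 - a) ^ 2 - a ^ 2)) := by gcongr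
      _ = _ := by
        rw [← Real.exp_add]
        congr 1
        have : l = -(2 * a) := by rw [ha]; ring
        rw [this]
        field_simp
        ring

theorem choose_mode_le (N m k : ℕ) (hm : m ≤ N) (hk : k ≤ N) :
    (m : ℝ) ^ k * ((N : ℝ) - m) ^ (N - k) * N.choose k ≤
      (m : ℝ) ^ m * ((N : ℝ) - m) ^ (N - m) * N.choose m := by
  have hNm : (0 : ℝ) ≤ (N : ℝ) - m := sub_nonneg.2 (by exact_mod_cast hm)
  have hm0 : (0 : ℝ) ≤ m := Nat.cast_nonneg m
  have hrec : ∀ j, j < N → ((N.choose (j + 1) : ℕ) : ℝ) * (j + 1) = N.choose j * ((N : ℝ) - j) := by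
    intro j hj
    have := Nat.choose_succ_right_eq N j
    rw [← Nat.cast_sub hj.le]
    exact_mod_cast this
  set f : ℕ → ℝ := fun j => (m : ℝ) ^ j * ((N : ℝ) - m) ^ (N - j) * N.choose j with hf
  have hup : ∀ j, j < m → f j ≤ f (j + 1) := by
    intro j hj
    have hjN : j < N := lt_of_lt_of_le hj hm
    have e : N - j = (N - (j + 1)) + 1 := by omega
    have h1 := hrec j hjN
    simp only [hf]
    rw [e, pow_succ, pow_succ]
    have h2 : ((N : ℝ) - m) * N.choose j ≤ m * N.choose (j + 1) := by
      have hj1 : (0 : ℝ) < (j : ℝ) + 1 := by positivity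
      refine le_of_mul_le_mul_right ?_ hj1
      have : (j : ℝ) + 1 ≤ m := by exact_mod_cast hj
      have hc : (0 : ℝ) ≤ N.choose j := Nat.cast_nonneg _
      have h3 : ((N : ℝ) - m) * (j + 1) ≤ m * ((N : ℝ) - j) := by nlinarith
      calc ((N : ℝ) - m) * N.choose j * (j + 1) = N.choose j * (((N : ℝ) - m) * (j + 1)) := by ring
        _ ≤ N.choose j * (m * ((N : ℝ) - j)) := by gcongr
        _ = m * N.choose (j + 1) * (j + 1) := by linear_combination (-(m : ℝ)) * h1
    have hp : 0 ≤ (m : ℝ) ^ j * ((N : ℝ) - m) ^ (N - (j + 1)) := by positivity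
    nlinarith [mul_le_mul_of_nonneg_left h2 hp]
  have hdown : ∀ j, m ≤ j → j < N → f (j + 1) ≤ f j := by
    intro j hj hjN
    have e : N - j = (N - (j + 1)) + 1 := by omega
    have h1 := hrec j hjN
    simp only [hf]
    rw [e, pow_succ, pow_succ]
    have h2 : m * N.choose (j + 1) ≤ ((N : ℝ) - m) * N.choose j := by
      have hj1 : (0 : ℝ) < (j : ℝ) + 1 := by positivity
      refine le_of_mul_le_mul_right ?_ hj1
      have : (m : ℝ) ≤ j := by exact_mod_cast hj
      have hc : (0 : ℝ) ≤ N.choose j := Nat.cast_nonneg _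
      have hN0 : (0 : ℝ) ≤ N := Nat.cast_nonneg _
      have h3 : m * ((N : ℝ) - j) ≤ ((N : ℝ) - m) * (j + 1) := by nlinarith
      calc m * N.choose (j + 1) * (j + 1) = N.choose j * (m * ((N : ℝ) - j)) := by
            linear_combination (m : ℝ) * h1
        _ ≤ N.choose j * (((N : ℝ) - m) * (j + 1)) := by gcongr
        _ = ((N : ℝ) - m) * N.choose j * (j + 1) := by ring
    have hp : 0 ≤ (m : ℝ) ^ j * ((N : ℝ) - m) ^ (N - (j + 1)) := by positivity
    nlinarith [mul_le_mul_of_nonneg_left h2 hp]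
  change f k ≤ f m
  rcases le_total k m with hkm | hkm
  · have : ∀ d, d ≤ m → f (m - d) ≤ f m := by
      intro d
      induction d with
      | zero => intro; simp
      | succ d ih =>
        intro hd
        have := hup (m - (d + 1)) (by omega)
        rw [show m - (d + 1) + 1 = m - d by omega] at this
        exact this.trans (ih (by omega))
    have := this (m - k) (by omega)
    rwa [show m - (m - k) = k by omega] at this
  · have : ∀ d, m + d ≤ N → f (m + d) ≤ f m := by
      intro d
      induction d with
      | zero => intro; simp
      | succ d ih =>
        intro hd
        exact (hdown (m + d) (by omega) (by omega)).trans (ih (by omega))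
    have := this (k - m) (by omega)
    rwa [show m + (k - m) = k by omega] at this

theorem pow_le_choose_mul_pow (N m : ℕ) (hm : m ≤ N) :
    (N : ℝ) ^ N ≤ (N + 1) * ((m : ℝ) ^ m * ((N : ℝ) - m) ^ (N - m) * N.choose m) := by
  have h := add_pow (m : ℝ) ((N : ℝ) - m) N
  rw [add_sub_cancel] at h
  rw [h]
  calc _ ≤ ∑ k ∈ Finset.range (N + 1), (m : ℝ) ^ m * ((N : ℝ) - m) ^ (N - m) * N.choose m :=
        Finset.sum_le_sum fun k hk =>
          choose_mode_le N m k hm (Nat.lt_succ_iff.1 (Finset.mem_range.1 hk))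
    _ = _ := by simp

theorem pow_mul_exp_le {a b : ℝ} (ha : 0 < a) (k : ℕ) (hb : 0 ≤ b) (hkb : (k : ℝ) = b) (c : ℝ)
    (hc : 0 < c) :
    (b / c) ^ k * Real.exp (-(b * (b / (a * c) - 1))) ≤ a ^ k := by
  rcases hb.eq_or_lt with rfl | hb
  · have : k = 0 := by exact_mod_cast hkb
    subst this
    simp
  · have h1 : Real.exp (-(b * (b / (a * c) - 1))) = (Real.exp (-(b / (a * c) - 1))) ^ k := by
      rw [← Real.exp_nat_mul, hkb]; ring_nf
    rw [h1, ← mul_pow]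
    have h2 : b / (a * c) ≤ Real.exp (b / (a * c) - 1) := by
      linarith [Real.add_one_le_exp (b / (a * c) - 1)]
    have h3 : 0 < Real.exp (b / (a * c) - 1) := Real.exp_pos _
    have : b / c * Real.exp (-(b / (a * c) - 1)) ≤ a := by
      rw [Real.exp_neg, ← div_eq_mul_inv, div_le_iff₀ h3]
      calc b / c = a * (b / (a * c)) := by field_simp
        _ ≤ _ := by gcongr
    exact pow_le_pow_left₀ (by positivity) this k

/-- A local lower bound for binomial probabilities. -/
theorem binomial_mass_ge {p : ℝ} (hp₀ : 0 < p) (hp₁ : p < 1) {N m : ℕ} (hN : 0 < N) (hm : m ≤ N) :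
    Real.exp (-(((m : ℝ) - p * N) ^ 2 / (N * (p * (1 - p))))) ≤
      (N + 1) * (N.choose m * (p ^ m * (1 - p) ^ (N - m))) := by
  have hq : 0 < 1 - p := by linarith
  have hN0 : (0 : ℝ) < N := by exact_mod_cast hN
  have hNm : (0 : ℝ) ≤ (N : ℝ) - m := sub_nonneg.2 (by exact_mod_cast hm)
  have h1 := pow_mul_exp_le hp₀ m (Nat.cast_nonneg m) rfl N hN0
  have h2 := pow_mul_exp_le hq (N - m) hNm (Nat.cast_sub hm) N hN0
  have h3 := pow_le_choose_mul_pow N m hm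
  have h4 : (1 : ℝ) ≤ (N + 1) * (N.choose m * ((m / N : ℝ) ^ m * (((N : ℝ) - m) / N) ^ (N - m))) := by
    rw [div_pow, div_pow]
    have e : (N : ℝ) ^ N = (N : ℝ) ^ m * (N : ℝ) ^ (N - m) := by
      rw [← pow_add]; congr 1; omega
    rw [e] at h3
    have hpos : (0 : ℝ) < (N : ℝ) ^ m * (N : ℝ) ^ (N - m) := by positivity
    have := (one_le_div hpos).2 h3
    refine this.trans (le_of_eq ?_)
    field_simp
  have h5 : Real.exp (-(((m : ℝ) - p * N) ^ 2 / (N * (p * (1 - p))))) =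
      Real.exp (-(m * (m / (p * N) - 1))) *
        Real.exp (-(((N : ℝ) - m) * (((N : ℝ) - m) / ((1 - p) * N) - 1))) := by
    rw [← Real.exp_add]
    congr 1
    field_simp
    ring
  rw [h5]
  set X := Real.exp (-(m * (m / (p * N) - 1)))
  set Y := Real.exp (-(((N : ℝ) - m) * (((N : ℝ) - m) / ((1 - p) * N) - 1)))
  calc X * Y = 1 * (X * Y) := by ring
    _ ≤ (N + 1) * (N.choose m * ((m / N : ℝ) ^ m * (((N : ℝ) - m) / N) ^ (N - m))) * (X * Y) := by
        gcongr
    _ = (N + 1) * (N.choose m * (((m / N : ℝ) ^ m * X) * ((((N : ℝ) - m) / N) ^ (N - m) * Y))) := by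
        ring
    _ ≤ _ := by gcongr

section Weights

variable {ι : Type*} [Fintype ι]

/-- The product Bernoulli weight of a configuration. -/
def bernoulliWeight (p : ℝ) (g : ι → Bool) : ℝ := ∏ e, if g e = true then p else 1 - p

/-- The numerical value of a bit. -/
def bitVal (b : Bool) : ℝ := if b = true then 1 else 0

theorem bernoulliWeight_nonneg {p : ℝ} (hp₀ : 0 ≤ p) (hp₁ : p ≤ 1) (g : ι → Bool) :
    0 ≤ bernoulliWeight p g := by
  unfold bernoulliWeight
  refine Finset.prod_nonneg fun e _ => ?_
  split_ifs <;> linarith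

theorem bernoulliWeight_eq (p : ℝ) (g : ι → Bool) (m : ℕ)
    (hm : (Finset.univ.filter fun e => g e = true).card = m) :
    bernoulliWeight p g = p ^ m * (1 - p) ^ (Fintype.card ι - m) := by
  unfold bernoulliWeight
  rw [Finset.prod_ite, Finset.prod_const, Finset.prod_const, hm]
  congr 2
  have := Finset.card_filter_add_card_filter_not (s := (Finset.univ : Finset ι))
    (fun e => g e = true)
  rw [hm, Finset.card_univ] at this
  omega

variable [DecidableEq ι]

theorem bernoulliWeight_update (p : ℝ) (g : ι → Bool) (e : ι) (b : Bool) :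
    bernoulliWeight p (Function.update g e b) =
      (if b = true then p else 1 - p) *
        ∏ x ∈ Finset.univ.erase e, if g x = true then p else 1 - p := by
  unfold bernoulliWeight
  rw [← Finset.mul_prod_erase Finset.univ _ (Finset.mem_univ e)]
  congr 1
  · simp
  · refine Finset.prod_congr rfl fun x hx => ?_
    rw [Function.update_of_ne (Finset.ne_of_mem_erase hx)]

theorem sum_bernoulliWeight_resample (p : ℝ) (e : ι) (H : (ι → Bool) → ℝ) :
    ∑ g, bernoulliWeight p g * H g =
      ∑ g, bernoulliWeight p g *
        (p * H (Function.update g e true) + (1 - p) * H (Function.update g e false)) := by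
  set φ : (ι → Bool) → (ι → Bool) := fun g => Function.update g e (!g e) with hφ
  have hinv : Function.Involutive φ := by
    intro g
    simp [hφ]
  have h2 : ∀ F : (ι → Bool) → ℝ, ∑ g, F g = (∑ g, (F g + F (φ g))) / 2 := by
    intro F
    have : ∑ g, F (φ g) = ∑ g, F g := Equiv.sum_comp hinv.toPerm F
    rw [Finset.sum_add_distrib, this]
    ring
  rw [h2, h2 (fun g => bernoulliWeight p g * (p * H (Function.update g e true) +
    (1 - p) * H (Function.update g e false)))]
  congr 1
  refine Finset.sum_congr rfl fun g _ => ?_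
  have h3 := bernoulliWeight_update p g e (g e)
  have h4 := bernoulliWeight_update p g e (!g e)
  rw [Function.update_eq_self] at h3
  simp only [hφ, Function.update_idem]
  rw [h4, h3]
  have h5 : g = Function.update g e (g e) := (Function.update_eq_self e g).symm
  cases hb : g e
  · rw [hb] at h5
    simp only [Bool.not_false]
    nth_rewrite 3 [h5]
    simp
    ring
  · rw [hb] at h5
    simp only [Bool.not_true]
    nth_rewrite 3 [h5]
    simp
    ring

theorem sum_bernoulliWeight (p : ℝ) :
    ∑ g : ι → Bool, bernoulliWeight p g = 1 := by
  unfold bernoulliWeight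
  have := Finset.prod_univ_sum (κ := fun _ : ι => Bool) (fun _ => Finset.univ)
    (fun _ b => if b = true then p else 1 - p)
  rw [Fintype.piFinset_univ] at this
  rw [← this]
  simp

theorem sum_bernoulliWeight_mul_exp_le {p v : ℝ} (hp₀ : 0 ≤ p) (hp₁ : p ≤ 1)
    (hv : ∀ x : ℝ, p * Real.exp (x * (1 - p)) + (1 - p) * Real.exp (x * (0 - p)) ≤
      Real.exp (v * x ^ 2 / 2))
    (S : Finset ι) (a : (ι → Bool) → ι → ℝ)
    (ha : ∀ e ∈ S, ∀ g b, a (Function.update g e b) = a g) :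
    ∑ g, bernoulliWeight p g *
      Real.exp (∑ e ∈ S, (a g e * (bitVal (g e) - p) - v * a g e ^ 2 / 2)) ≤ 1 := by
  induction S using Finset.induction_on with
  | empty => simp [sum_bernoulliWeight]
  | insert e S he ih =>
    refine le_trans ?_ (ih fun e' he' => ha e' (Finset.mem_insert_of_mem he'))
    rw [sum_bernoulliWeight_resample p e]
    refine Finset.sum_le_sum fun g _ => ?_
    refine mul_le_mul_of_nonneg_left ?_ (bernoulliWeight_nonneg hp₀ hp₁ g)
    set Z := ∑ x ∈ S, (a g x * (bitVal (g x) - p) - v * a g x ^ 2 / 2)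
    have hupd : ∀ b, ∑ x ∈ insert e S, (a (Function.update g e b) x *
        (bitVal (Function.update g e b x) - p) - v * a (Function.update g e b) x ^ 2 / 2) =
        a g e * (bitVal b - p) + (Z - v * a g e ^ 2 / 2) := by
      intro b
      rw [Finset.sum_insert he, ha e (Finset.mem_insert_self e S)]
      have : ∑ x ∈ S, (a g x * (bitVal (Function.update g e b x) - p) - v * a g x ^ 2 / 2) = Z := by
        refine Finset.sum_congr rfl fun x hx => ?_
        rw [Function.update_of_ne (by rintro rfl; exact he hx)]
      rw [this, Function.update_self]
      ring
    rw [hupd, hupd, Real.exp_add, Real.exp_add]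
    have e1 : bitVal true = 1 := rfl
    have e2 : bitVal false = 0 := rfl
    rw [e1, e2]
    calc _ = (p * Real.exp (a g e * (1 - p)) + (1 - p) * Real.exp (a g e * (0 - p))) *
          Real.exp (Z - v * a g e ^ 2 / 2) := by ring
      _ ≤ Real.exp (v * a g e ^ 2 / 2) * Real.exp (Z - v * a g e ^ 2 / 2) := by
          gcongr
          exact hv _
      _ = Real.exp Z := by rw [← Real.exp_add]; ring_nf

theorem sum_bernoulliWeight_le_exp_neg {p v : ℝ} (hp₀ : 0 ≤ p) (hp₁ : p ≤ 1)
    (hv : ∀ x : ℝ, p * Real.exp (x * (1 - p)) + (1 - p) * Real.exp (x * (0 - p)) ≤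
      Real.exp (v * x ^ 2 / 2))
    (S : Finset ι) (a : (ι → Bool) → ι → ℝ)
    (ha : ∀ e ∈ S, ∀ g b, a (Function.update g e b) = a g)
    (bad : Finset (ι → Bool)) (x : ℝ)
    (hbad : ∀ g ∈ bad, x ≤ ∑ e ∈ S, (a g e * (bitVal (g e) - p) - v * a g e ^ 2 / 2)) :
    ∑ g ∈ bad, bernoulliWeight p g ≤ Real.exp (-x) := by
  have h := sum_bernoulliWeight_mul_exp_le hp₀ hp₁ hv S a ha
  have h1 : (∑ g ∈ bad, bernoulliWeight p g) * Real.exp x ≤ 1 := by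
    refine le_trans ?_ h
    rw [Finset.sum_mul]
    calc _ ≤ ∑ g ∈ bad, bernoulliWeight p g *
          Real.exp (∑ e ∈ S, (a g e * (bitVal (g e) - p) - v * a g e ^ 2 / 2)) := by
          refine Finset.sum_le_sum fun g hg => ?_
          refine mul_le_mul_of_nonneg_left ?_ (bernoulliWeight_nonneg hp₀ hp₁ g)
          exact Real.exp_le_exp.2 (hbad g hg)
      _ ≤ _ := Finset.sum_le_sum_of_subset_of_nonneg (Finset.subset_univ _) fun g _ _ =>
          mul_nonneg (bernoulliWeight_nonneg hp₀ hp₁ g) (Real.exp_pos _).le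
  rw [Real.exp_neg, ← one_div, le_div_iff₀ (Real.exp_pos _)]
  exact h1

end Weights

section Centered

variable {n : ℕ}

/-- The centered adjacency matrix, with zero diagonal. -/
def centeredAdj (p : ℝ) (g : EdgeIdx n → Bool) : Matrix (Fin n) (Fin n) ℝ :=
  Matrix.of fun i j => if i = j then 0 else adjOf g i j - p

theorem sum_sum_eq_sum_edge (f : Fin n → Fin n → ℝ) (hf : ∀ i, f i i = 0) :
    ∑ i, ∑ j, f i j = ∑ e : EdgeIdx n, (f e.1.1 e.1.2 + f e.1.2 e.1.1) := by
  rw [Finset.sum_add_distrib]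
  have h1 : ∀ F : Fin n → Fin n → ℝ, ∑ e : EdgeIdx n, F e.1.1 e.1.2 =
      ∑ i, ∑ j, if i < j then F i j else 0 := by
    intro F
    rw [← Fintype.sum_prod_type' (fun i j => if i < j then F i j else 0),
      ← Finset.sum_filter, Finset.sum_subtype (p := fun p : Fin n × Fin n => p.1 < p.2)
        (F := inferInstance)]
    simp
  rw [h1 f, h1 (fun i j => f j i)]
  rw [Finset.sum_comm (f := fun i j => if i < j then f j i else 0), ← Finset.sum_add_distrib]
  refine Finset.sum_congr rfl fun i _ => ?_
  rw [← Finset.sum_add_distrib]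
  refine Finset.sum_congr rfl fun j _ => ?_
  rcases lt_trichotomy i j with h | h | h
  · simp [h, h.not_gt]
  · subst h; simp [hf]
  · simp [h, h.not_gt]

theorem adjOf_apply_lt (g : EdgeIdx n → Bool) (e : EdgeIdx n) :
    adjOf g e.1.1 e.1.2 = bitVal (g e) := by
  have h : e.1.1 < e.1.2 := e.2
  simp [adjOf, bitVal, h]

theorem adjOf_symm (g : EdgeIdx n → Bool) (i j : Fin n) : adjOf g i j = adjOf g j i := by
  unfold adjOf
  rcases lt_trichotomy i j with h | h | h
  · simp [h, h.not_gt]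
  · subst h; simp
  · simp [h, h.not_gt]

theorem adjOf_diag (g : EdgeIdx n → Bool) (i : Fin n) : adjOf g i i = 0 := by
  simp [adjOf]

theorem centeredAdj_symm (p : ℝ) (g : EdgeIdx n → Bool) (i j : Fin n) :
    centeredAdj p g i j = centeredAdj p g j i := by
  simp only [centeredAdj, Matrix.of_apply, adjOf_symm g i j, eq_comm]

theorem centeredAdj_diag (p : ℝ) (g : EdgeIdx n → Bool) (i : Fin n) :
    centeredAdj p g i i = 0 := by
  simp [centeredAdj]

theorem centeredAdj_apply_lt (p : ℝ) (g : EdgeIdx n → Bool) (e : EdgeIdx n) :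
    centeredAdj p g e.1.1 e.1.2 = bitVal (g e) - p := by
  have h : e.1.1 ≠ e.1.2 := e.2.ne
  simp only [centeredAdj, Matrix.of_apply, h, if_false, adjOf_apply_lt]

theorem abs_centeredAdj_le {p : ℝ} (hp₀ : 0 ≤ p) (hp₁ : p ≤ 1) (g : EdgeIdx n → Bool)
    (i j : Fin n) : |centeredAdj p g i j| ≤ 1 := by
  have key : ∀ e : EdgeIdx n, |centeredAdj p g e.1.1 e.1.2| ≤ 1 := by
    intro e
    rw [centeredAdj_apply_lt, abs_le]
    unfold bitVal
    split_ifs <;> constructor <;> linarith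
  rcases lt_trichotomy i j with h | h | h
  · exact key ⟨(i, j), h⟩
  · subst h; simp [centeredAdj_diag]
  · rw [centeredAdj_symm]
    exact key ⟨(j, i), h⟩

/-- Exponential tail bound for a linear functional of the centered adjacency matrix whose
coefficients do not depend on the edges they multiply. -/
theorem sum_bernoulliWeight_le_of_linear {p v : ℝ} (hp₀ : 0 ≤ p) (hp₁ : p ≤ 1) (hv₀ : 0 ≤ v)
    (hv : ∀ x : ℝ, p * Real.exp (x * (1 - p)) + (1 - p) * Real.exp (x * (0 - p)) ≤
      Real.exp (v * x ^ 2 / 2))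
    (S : Finset (EdgeIdx n)) (N : (EdgeIdx n → Bool) → Matrix (Fin n) (Fin n) ℝ)
    (hN : ∀ e ∈ S, ∀ g b, N (Function.update g e b) = N g)
    (hS : ∀ g, ∀ e ∉ S, N g e.1.1 e.1.2 = 0 ∧ N g e.1.2 e.1.1 = 0)
    (bad : Finset (EdgeIdx n → Bool)) (x : ℝ)
    (hbad : ∀ g ∈ bad, x ≤ ∑ i, ∑ j, N g i j * centeredAdj p g i j - v * ∑ i, ∑ j, N g i j ^ 2) :
    ∑ g ∈ bad, bernoulliWeight p g ≤ Real.exp (-x) := by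
  refine sum_bernoulliWeight_le_exp_neg hp₀ hp₁ hv S
    (fun g e => N g e.1.1 e.1.2 + N g e.1.2 e.1.1) ?_ bad x ?_
  · intro e he g b
    simp only [hN e he g b]
  · intro g hg
    refine (hbad g hg).trans ?_
    have hext : ∀ F : EdgeIdx n → ℝ, (∀ e ∉ S, F e = 0) → ∑ e ∈ S, F e = ∑ e, F e := by
      intro F hF
      exact Finset.sum_subset (Finset.subset_univ S) fun e _ he => hF e he
    rw [hext _ (by
      intro e he
      simp [(hS g e he).1, (hS g e he).2])]
    rw [Finset.sum_sub_distrib]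
    have h1 : ∑ i, ∑ j, N g i j * centeredAdj p g i j =
        ∑ e : EdgeIdx n, (N g e.1.1 e.1.2 + N g e.1.2 e.1.1) * (bitVal (g e) - p) := by
      rw [sum_sum_eq_sum_edge _ (fun i => by rw [centeredAdj_diag, mul_zero])]
      refine Finset.sum_congr rfl fun e _ => ?_
      rw [centeredAdj_symm p g e.1.2 e.1.1, centeredAdj_apply_lt]
      ring
    have h2 : ∑ e : EdgeIdx n, v * (N g e.1.1 e.1.2 + N g e.1.2 e.1.1) ^ 2 / 2 ≤
        v * ∑ i, ∑ j, N g i j ^ 2 := by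
      have h3 : ∑ i, ∑ j, (if i = j then 0 else N g i j ^ 2) ≤ ∑ i, ∑ j, N g i j ^ 2 := by
        refine Finset.sum_le_sum fun i _ => Finset.sum_le_sum fun j _ => ?_
        split_ifs
        · positivity
        · exact le_rfl
      rw [sum_sum_eq_sum_edge _ (fun i => by simp)] at h3
      refine le_trans ?_ (mul_le_mul_of_nonneg_left h3 hv₀)
      rw [Finset.mul_sum]
      refine Finset.sum_le_sum fun e _ => ?_
      have hne : e.1.1 ≠ e.1.2 := e.2.ne
      rw [if_neg hne, if_neg hne.symm]
      have := sq_nonneg (N g e.1.1 e.1.2 - N g e.1.2 e.1.1)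
      nlinarith
    rw [h1]
    linarith

end Centered

section Net

theorem card_le_of_separated_of_norm_le_one {E : Type*} [NormedAddCommGroup E] [NormedSpace ℝ E]
    [FiniteDimensional ℝ E] {η : ℝ} (hη : 0 < η) (hη1 : η ≤ 1) (s : Finset E)
    (hs : ∀ c ∈ s, ‖c‖ ≤ 1) (h : ∀ c ∈ s, ∀ d ∈ s, c ≠ d → η ≤ ‖c - d‖) :
    (s.card : ℝ) ≤ (3 / η) ^ Module.finrank ℝ E := by
  borelize E
  let μ : Measure E := Measure.addHaar
  have hδ : 0 < η / 2 := by positivity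
  have hρ : (0 : ℝ) < 3 / 2 := by norm_num
  have D : Set.Pairwise (s : Set E) (Function.onFun Disjoint fun c => Metric.ball (c : E) (η / 2)) := by
    rintro c hc d hd hcd
    apply Metric.ball_disjoint_ball
    rw [dist_eq_norm]
    linarith [h c hc d hd hcd]
  have A_subset : (⋃ c ∈ s, Metric.ball (c : E) (η / 2)) ⊆ Metric.ball (0 : E) (3 / 2) := by
    refine Set.iUnion₂_subset fun x hx => ?_
    apply Metric.ball_subset_ball'
    rw [dist_zero_right]
    linarith [hs x hx]
  have I : (s.card : ℝ≥0∞) * ENNReal.ofReal ((η / 2) ^ Module.finrank ℝ E) * μ (Metric.ball 0 1) ≤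
      ENNReal.ofReal ((3 / 2) ^ Module.finrank ℝ E) * μ (Metric.ball 0 1) :=
    calc
      _ = μ (⋃ c ∈ s, Metric.ball (c : E) (η / 2)) := by
        rw [measure_biUnion_finset D fun c _ => measurableSet_ball]
        simp only [μ.addHaar_ball_of_pos _ hδ]
        simp only [Finset.sum_const, nsmul_eq_mul, mul_assoc]
      _ ≤ μ (Metric.ball (0 : E) (3 / 2)) := measure_mono A_subset
      _ = _ := by simp only [μ.addHaar_ball_of_pos _ hρ]
  have J := (ENNReal.mul_le_mul_iff_left (Metric.measure_ball_pos μ _ zero_lt_one).ne'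
    measure_ball_lt_top.ne).1 I
  have K := ENNReal.toReal_le_of_le_ofReal (pow_nonneg hρ.le _) J
  rw [ENNReal.toReal_mul, ENNReal.toReal_ofReal (by positivity)] at K
  simp only [ENNReal.toReal_natCast] at K
  have e : (3 / η : ℝ) ^ Module.finrank ℝ E =
      (3 / 2) ^ Module.finrank ℝ E / (η / 2) ^ Module.finrank ℝ E := by
    rw [← div_pow]; congr 1; field_simp
  rw [e, le_div_iff₀ (by positivity)]
  exact K

theorem exists_net (E : Type*) [NormedAddCommGroup E] [NormedSpace ℝ E]
    [FiniteDimensional ℝ E] {η : ℝ} (hη : 0 < η) (hη1 : η ≤ 1) :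
    ∃ s : Finset E, (∀ c ∈ s, ‖c‖ ≤ 1) ∧ (s.card : ℝ) ≤ (3 / η) ^ Module.finrank ℝ E ∧
      ∀ x : E, ‖x‖ ≤ 1 → ∃ y ∈ s, ‖x - y‖ ≤ η := by
  classical
  set P : ℕ → Prop := fun j => ∃ s : Finset E, s.card = j ∧ (∀ c ∈ s, ‖c‖ ≤ 1) ∧
    ∀ c ∈ s, ∀ d ∈ s, c ≠ d → η ≤ ‖c - d‖ with hP
  set B := ⌈(3 / η) ^ Module.finrank ℝ E⌉₊ with hB
  have hbd : ∀ j, P j → j ≤ B := by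
    rintro j ⟨s, rfl, h1, h2⟩
    have := card_le_of_separated_of_norm_le_one hη hη1 s h1 h2
    exact_mod_cast this.trans (Nat.le_ceil _)
  have h0 : P 0 := ⟨∅, by simp⟩
  obtain ⟨s, hcard, h1, h2⟩ := Nat.findGreatest_spec (P := P) (hbd 0 h0) h0
  refine ⟨s, h1, card_le_of_separated_of_norm_le_one hη hη1 s h1 h2, ?_⟩
  intro x hx
  by_contra! hcon
  have hxs : x ∉ s := by
    intro hxs
    have := hcon x hxs
    simp at this
    linarith
  have hnew : P (s.card + 1) := by
    refine ⟨insert x s, Finset.card_insert_of_notMem hxs, ?_, ?_⟩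
    · intro c hc
      rcases Finset.mem_insert.1 hc with rfl | hc
      · exact hx
      · exact h1 c hc
    · intro c hc d hd hcd
      rcases Finset.mem_insert.1 hc with hc' | hc' <;>
        rcases Finset.mem_insert.1 hd with hd' | hd'
      · exact absurd (hc'.trans hd'.symm) hcd
      · rw [hc']; exact (hcon d hd').le
      · rw [hd', norm_sub_rev]; exact (hcon c hc').le
      · exact h2 c hc' d hd' hcd
  have := Nat.le_findGreatest (hbd _ hnew) hnew
  omega

theorem opNorm_le_of_net {V W : Type*} [NormedAddCommGroup V] [NormedSpace ℝ V]
    [NormedAddCommGroup W] [NormedSpace ℝ W] (B : V →L[ℝ] W →L[ℝ] ℝ) {η r : ℝ} (hη : 0 ≤ η)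
    (s : Finset V) (t : Finset W) (hs1 : ∀ x ∈ s, ‖x‖ ≤ 1)
    (hs : ∀ x : V, ‖x‖ ≤ 1 → ∃ y ∈ s, ‖x - y‖ ≤ η)
    (ht : ∀ x : W, ‖x‖ ≤ 1 → ∃ y ∈ t, ‖x - y‖ ≤ η)
    (hr : ∀ x ∈ s, ∀ y ∈ t, B x y ≤ r) :
    (1 - 2 * η) * ‖B‖ ≤ r := by
  have hunit : ∀ x y, ‖x‖ ≤ 1 → ‖y‖ ≤ 1 → B x y ≤ r + 2 * η * ‖B‖ := by
    intro x y hx hy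
    obtain ⟨x', hx', hxx⟩ := hs x hx
    obtain ⟨y', hy', hyy⟩ := ht y hy
    have e : B x y = B x' y' + B (x - x') y + B x' (y - y') := by
      simp only [map_sub, _root_.sub_apply]
      ring
    have h1 : B (x - x') y ≤ η * ‖B‖ := by
      calc B (x - x') y ≤ ‖B (x - x') y‖ := le_abs_self _
        _ ≤ ‖B‖ * ‖x - x'‖ * ‖y‖ := B.le_opNorm₂ _ _
        _ ≤ ‖B‖ * η * 1 := by gcongr
        _ = _ := by ring
    have h2 : B x' (y - y') ≤ η * ‖B‖ := by
      calc B x' (y - y') ≤ ‖B x' (y - y')‖ := le_abs_self _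
        _ ≤ ‖B‖ * ‖x'‖ * ‖y - y'‖ := B.le_opNorm₂ _ _
        _ ≤ ‖B‖ * 1 * η := by
          gcongr
          exact hs1 x' hx'
        _ = _ := by ring
    linarith [hr x' hx' y' hy']
  have hC : 0 ≤ r + 2 * η * ‖B‖ := by simpa using hunit 0 0 (by simp) (by simp)
  have hpos : ∀ x y, B x y ≤ (r + 2 * η * ‖B‖) * ‖x‖ * ‖y‖ := by
    intro x y
    rcases eq_or_ne x 0 with rfl | hx
    · simp
    rcases eq_or_ne y 0 with rfl | hy
    · simp
    have hx' := norm_pos_iff.2 hx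
    have hy' := norm_pos_iff.2 hy
    have := hunit (‖x‖⁻¹ • x) (‖y‖⁻¹ • y) (by rw [norm_smul]; simp [hx])
      (by rw [norm_smul]; simp [hy])
    simp only [map_smul, _root_.smul_apply, smul_eq_mul] at this
    have h3 := mul_le_mul_of_nonneg_right this (mul_pos hx' hy').le
    calc B x y = ‖x‖⁻¹ * (‖y‖⁻¹ * B x y) * (‖x‖ * ‖y‖) := by field_simp
      _ ≤ (r + 2 * η * ‖B‖) * (‖x‖ * ‖y‖) := by
        refine le_trans (le_of_eq ?_) h3
        ring
      _ = _ := by ring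
  have : ‖B‖ ≤ r + 2 * η * ‖B‖ := by
    refine B.opNorm_le_bound₂ hC fun x y => ?_
    rw [Real.norm_eq_abs, abs_le]
    refine ⟨?_, hpos x y⟩
    have := hpos (-x) y
    simp only [map_neg, _root_.neg_apply, norm_neg] at this
    linarith
  linarith

/-- Linear maps `ℝᵏ → ℝⁿ`, with the operator norm. -/
abbrev LeftFactor (n k : ℕ) := EuclideanSpace ℝ (Fin k) →L[ℝ] EuclideanSpace ℝ (Fin n)

/-- Families of `n` vectors of `ℝᵏ`, with the `ℓ²` norm. -/
abbrev RightFactor (n k : ℕ) := PiLp 2 (fun _ : Fin n => EuclideanSpace ℝ (Fin k))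

variable {n k : ℕ}

theorem finrank_leftFactor : Module.finrank ℝ (LeftFactor n k) = n * k := by
  rw [← (LinearMap.toContinuousLinearMap (𝕜 := ℝ) (E := EuclideanSpace ℝ (Fin k))
    (F' := EuclideanSpace ℝ (Fin n))).finrank_eq, Module.finrank_linearMap]
  simp [mul_comm]

theorem finrank_rightFactor : Module.finrank ℝ (RightFactor n k) = n * k := by
  rw [(WithLp.linearEquiv 2 ℝ (Fin n → EuclideanSpace ℝ (Fin k))).finrank_eq,
    Module.finrank_pi_fintype]
  simp

/-- The matrix `X Yᵀ`. -/
def factorMatrix (X : LeftFactor n k) (Y : RightFactor n k) : Matrix (Fin n) (Fin n) ℝ :=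
  Matrix.of fun i j => X (Y j) i

theorem sum_factorMatrix_sq_le (X : LeftFactor n k) (Y : RightFactor n k) :
    ∑ i, ∑ j, factorMatrix X Y i j ^ 2 ≤ (‖X‖ * ‖Y‖) ^ 2 := by
  rw [Finset.sum_comm, mul_pow, PiLp.norm_sq_eq_of_L2, Finset.mul_sum]
  refine Finset.sum_le_sum fun j _ => ?_
  have h := X.le_opNorm (Y j)
  have h2 : ∑ i, factorMatrix X Y i j ^ 2 = ‖X (Y j)‖ ^ 2 := by
    rw [EuclideanSpace.norm_sq_eq]
    simp [factorMatrix]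
  rw [h2, ← mul_pow]
  exact pow_le_pow_left₀ (norm_nonneg _) h 2

theorem factorMatrix_sub_sub (X X' : LeftFactor n k) (Y Y' : RightFactor n k) :
    factorMatrix X Y - factorMatrix X' Y' = factorMatrix (X - X') Y + factorMatrix X' (Y - Y') := by
  ext i j
  simp [factorMatrix]

/-- The bilinear form `(X, Y) ↦ ⟨A, X Yᵀ⟩`. -/
def factorForm (A : Matrix (Fin n) (Fin n) ℝ) : LeftFactor n k →L[ℝ] RightFactor n k →L[ℝ] ℝ :=
  LinearMap.mkContinuous₂
    (LinearMap.mk₂ ℝ (fun X Y => ∑ i, ∑ j, A i j * factorMatrix X Y i j)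
      (by intro X X' Y; simp [factorMatrix, mul_add, Finset.sum_add_distrib])
      (by
        intro c X Y
        simp only [factorMatrix, Matrix.of_apply, smul_eq_mul, Finset.mul_sum,
          _root_.smul_apply, PiLp.smul_apply]
        exact Finset.sum_congr rfl fun i _ => Finset.sum_congr rfl fun j _ => by ring)
      (by intro X X' Y; simp [factorMatrix, mul_add, Finset.sum_add_distrib])
      (by
        intro c X Y
        simp only [factorMatrix, Matrix.of_apply, smul_eq_mul, Finset.mul_sum,
          map_smul, PiLp.smul_apply]
        exact Finset.sum_congr rfl fun i _ => Finset.sum_congr rfl fun j _ => by ring))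
    (Real.sqrt (∑ i, ∑ j, A i j ^ 2)) (by
      intro X Y
      change ‖∑ i, ∑ j, A i j * factorMatrix X Y i j‖ ≤ _
      rw [Real.norm_eq_abs, mul_assoc, ← Real.sqrt_sq (mul_nonneg (norm_nonneg X) (norm_nonneg Y)),
        ← Real.sqrt_mul (by positivity)]
      apply Real.abs_le_sqrt
      have h := Finset.sum_mul_sq_le_sq_mul_sq (Finset.univ : Finset (Fin n × Fin n))
        (fun x => A x.1 x.2) (fun x => factorMatrix X Y x.1 x.2)
      simp only [Fintype.sum_prod_type] at h
      refine h.trans ?_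
      gcongr
      exact sum_factorMatrix_sq_le X Y)

theorem factorForm_apply (A : Matrix (Fin n) (Fin n) ℝ) (X : LeftFactor n k)
    (Y : RightFactor n k) :
    factorForm A X Y = ∑ i, ∑ j, A i j * factorMatrix X Y i j := rfl

end Net

section Spectral

open scoped Matrix.Norms.Frobenius

variable {n : ℕ}

theorem frobenius_norm_sq (A : Matrix (Fin n) (Fin n) ℝ) : ‖A‖ ^ 2 = ∑ i, ∑ j, A i j ^ 2 := by
  rw [Matrix.frobenius_norm_def, ← Real.sqrt_eq_rpow, Real.sq_sqrt (by positivity)]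
  simp

theorem frobenius_norm_sq_eq_trace (A : Matrix (Fin n) (Fin n) ℝ) :
    ‖A‖ ^ 2 = (A * Aᵀ).trace := by
  rw [frobenius_norm_sq]
  simp [Matrix.trace, Matrix.mul_apply, pow_two]

theorem abs_sum_mul_le_frobenius (A B : Matrix (Fin n) (Fin n) ℝ) :
    |∑ i, ∑ j, A i j * B i j| ≤ ‖A‖ * ‖B‖ := by
  apply abs_le_of_sq_le_sq _ (by positivity)
  rw [mul_pow, frobenius_norm_sq, frobenius_norm_sq]
  have h := Finset.sum_mul_sq_le_sq_mul_sq (Finset.univ : Finset (Fin n × Fin n))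
    (fun x => A x.1 x.2) (fun x => B x.1 x.2)
  simpa only [Fintype.sum_prod_type] using h

theorem abs_trace_mul_le_frobenius (A B : Matrix (Fin n) (Fin n) ℝ) :
    |(A * B).trace| ≤ ‖A‖ * ‖B‖ := by
  have h := abs_sum_mul_le_frobenius A Bᵀ
  rw [Matrix.frobenius_norm_transpose] at h
  simpa [Matrix.trace, Matrix.mul_apply] using h

theorem frobenius_norm_orthogonal_mul {U : Matrix (Fin n) (Fin n) ℝ} (hU : Uᵀ * U = 1)
    (B : Matrix (Fin n) (Fin n) ℝ) : ‖U * B‖ = ‖B‖ := by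
  rw [← sq_eq_sq₀ (norm_nonneg _) (norm_nonneg _), frobenius_norm_sq_eq_trace,
    frobenius_norm_sq_eq_trace, Matrix.transpose_mul, Matrix.mul_assoc, Matrix.trace_mul_comm,
    Matrix.mul_assoc, Matrix.mul_assoc, hU, Matrix.mul_one]

theorem frobenius_norm_diagonal_mul_le {f : Fin n → ℝ} {κ : ℝ} (hf : ∀ i, |f i| ≤ κ) (hκ : 0 ≤ κ)
    (B : Matrix (Fin n) (Fin n) ℝ) : ‖Matrix.diagonal f * B‖ ≤ κ * ‖B‖ := by
  refine le_of_sq_le_sq ?_ (by positivity)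
  rw [mul_pow, frobenius_norm_sq, frobenius_norm_sq, Finset.mul_sum]
  refine Finset.sum_le_sum fun i _ => ?_
  rw [Finset.mul_sum]
  refine Finset.sum_le_sum fun j _ => ?_
  rw [Matrix.diagonal_mul, mul_pow]
  exact mul_le_mul_of_nonneg_right
    (sq_le_sq' (by linarith [(abs_le.1 (hf i)).1]) (abs_le.1 (hf i)).2) (sq_nonneg _)

/-- The symmetric matrix with eigenvector matrix `U` and eigenvalues `f`. -/
def conjDiag (U : Matrix (Fin n) (Fin n) ℝ) (f : Fin n → ℝ) : Matrix (Fin n) (Fin n) ℝ :=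
  U * Matrix.diagonal f * Uᵀ

variable {U : Matrix (Fin n) (Fin n) ℝ}

theorem conjDiag_transpose (f : Fin n → ℝ) : (conjDiag U f)ᵀ = conjDiag U f := by
  simp [conjDiag, Matrix.transpose_mul, Matrix.mul_assoc]

theorem conjDiag_mul (hU : Uᵀ * U = 1) (f g : Fin n → ℝ) :
    conjDiag U f * conjDiag U g = conjDiag U (fun i => f i * g i) := by
  unfold conjDiag
  calc _ = U * Matrix.diagonal f * (Uᵀ * U) * Matrix.diagonal g * Uᵀ := by
        simp only [Matrix.mul_assoc]
    _ = _ := by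
        rw [hU, Matrix.mul_one, Matrix.mul_assoc U, Matrix.diagonal_mul_diagonal]

theorem conjDiag_add (f g : Fin n → ℝ) :
    conjDiag U f + conjDiag U g = conjDiag U (fun i => f i + g i) := by
  unfold conjDiag
  rw [← Matrix.diagonal_add, Matrix.mul_add, Matrix.add_mul]

theorem trace_conjDiag (hU : Uᵀ * U = 1) (f : Fin n → ℝ) : (conjDiag U f).trace = ∑ i, f i := by
  unfold conjDiag
  rw [Matrix.trace_mul_comm, ← Matrix.mul_assoc, hU, Matrix.one_mul, Matrix.trace_diagonal]

theorem frobenius_norm_sq_conjDiag (hU : Uᵀ * U = 1) (f : Fin n → ℝ) :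
    ‖conjDiag U f‖ ^ 2 = ∑ i, f i ^ 2 := by
  rw [frobenius_norm_sq_eq_trace, conjDiag_transpose, conjDiag_mul hU, trace_conjDiag hU]
  simp [pow_two]

theorem frobenius_norm_conjDiag_mul_le (hU : Uᵀ * U = 1) (hU' : U * Uᵀ = 1) {f : Fin n → ℝ} {κ : ℝ}
    (hf : ∀ i, |f i| ≤ κ) (hκ : 0 ≤ κ) (B : Matrix (Fin n) (Fin n) ℝ) :
    ‖conjDiag U f * B‖ ≤ κ * ‖B‖ := by
  unfold conjDiag
  rw [Matrix.mul_assoc, Matrix.mul_assoc, frobenius_norm_orthogonal_mul hU]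
  refine (frobenius_norm_diagonal_mul_le hf hκ _).trans_eq ?_
  rw [frobenius_norm_orthogonal_mul (by rw [Matrix.transpose_transpose]; exact hU')]

theorem frobenius_norm_mul_conjDiag_le (hU : Uᵀ * U = 1) (hU' : U * Uᵀ = 1) {f : Fin n → ℝ} {κ : ℝ}
    (hf : ∀ i, |f i| ≤ κ) (hκ : 0 ≤ κ) (B : Matrix (Fin n) (Fin n) ℝ) :
    ‖B * conjDiag U f‖ ≤ κ * ‖B‖ := by
  rw [← Matrix.frobenius_norm_transpose, Matrix.transpose_mul, conjDiag_transpose,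
    ← Matrix.frobenius_norm_transpose B]
  exact frobenius_norm_conjDiag_mul_le hU hU' hf hκ _

theorem conjDiag_apply (f : Fin n → ℝ) (i j : Fin n) :
    conjDiag U f i j = ∑ l, f l * U i l * U j l := by
  unfold conjDiag
  rw [Matrix.mul_apply]
  refine Finset.sum_congr rfl fun l _ => ?_
  rw [Matrix.mul_diagonal, Matrix.transpose_apply]
  ring

theorem exists_conjDiag {E : Matrix (Fin n) (Fin n) ℝ} (hE : Eᵀ = E) :
    ∃ (U : Matrix (Fin n) (Fin n) ℝ) (f : Fin n → ℝ), Uᵀ * U = 1 ∧ U * Uᵀ = 1 ∧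
      E = conjDiag U f := by
  have hA : E.IsHermitian := by
    rw [Matrix.IsHermitian, Matrix.conjTranspose_eq_transpose_of_trivial, hE]
  have hU : (hA.eigenvectorUnitary : Matrix (Fin n) (Fin n) ℝ)ᵀ * hA.eigenvectorUnitary = 1 := by
    have := Unitary.coe_star_mul_self hA.eigenvectorUnitary
    rwa [Matrix.star_eq_conjTranspose, Matrix.conjTranspose_eq_transpose_of_trivial] at this
  refine ⟨hA.eigenvectorUnitary, hA.eigenvalues, hU, mul_eq_one_comm.1 hU, ?_⟩
  · have := hA.spectral_theorem
    rw [Unitary.conjStarAlgAut_apply, Matrix.star_eq_conjTranspose,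
      Matrix.conjTranspose_eq_transpose_of_trivial] at this
    exact this

/-- A symmetric matrix of rank `k` factors through `ℝᵏ` with an isometric left factor. -/
theorem exists_factorMatrix_eq {k : ℕ} (hU : Uᵀ * U = 1) (f : Fin n → ℝ) (S : Finset (Fin n))
    (hS : S.card = k) (hf : ∀ i ∉ S, f i = 0) {ρ : ℝ} (hρ : 0 < ρ) (hfρ : ‖conjDiag U f‖ ≤ ρ) :
    ∃ (X : LeftFactor n k) (Y : RightFactor n k), ‖X‖ ≤ 1 ∧ ‖Y‖ ≤ 1 ∧
      conjDiag U f = ρ • factorMatrix X Y := by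
  set σ := S.orderEmbOfFin hS with hσ
  have hsum : ∀ G : Fin n → ℝ, (∀ i ∉ S, G i = 0) → ∑ j, G (σ j) = ∑ i, G i := by
    intro G hG
    rw [← Finset.sum_subset (Finset.subset_univ S) fun i _ hi => hG i hi]
    conv_rhs => rw [← Finset.map_orderEmbOfFin_univ S hS, Finset.sum_map]
    rfl
  have horth : ∀ a b, ∑ i, U i a * U i b = if a = b then 1 else 0 := by
    intro a b
    have := congrFun (congrFun hU a) b
    simpa [Matrix.mul_apply, Matrix.one_apply] using this
  set X : LeftFactor n k := LinearMap.toContinuousLinearMap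
    (Matrix.toEuclideanLin (U.submatrix id σ)) with hX
  have hXapp : ∀ a i, X a i = ∑ j, U i (σ j) * a j := by
    intro a i
    simp [hX, Matrix.toLpLin_apply, Matrix.mulVec, dotProduct]
  refine ⟨X, WithLp.toLp 2 fun j => WithLp.toLp 2 fun l => ρ⁻¹ * (f (σ l) * U j (σ l)), ?_, ?_, ?_⟩
  · refine X.opNorm_le_bound zero_le_one fun a => ?_
    rw [one_mul]
    refine le_of_eq ?_
    rw [← sq_eq_sq₀ (norm_nonneg _) (norm_nonneg _), EuclideanSpace.norm_sq_eq,
      EuclideanSpace.norm_sq_eq]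
    simp only [Real.norm_eq_abs, sq_abs, hXapp]
    calc _ = ∑ i, ∑ j, ∑ l, (a j * a l) * (U i (σ j) * U i (σ l)) := by
          refine Finset.sum_congr rfl fun i _ => ?_
          rw [pow_two, Finset.sum_mul_sum]
          refine Finset.sum_congr rfl fun j _ => Finset.sum_congr rfl fun l _ => by ring
      _ = ∑ j, ∑ l, (a j * a l) * ∑ i, U i (σ j) * U i (σ l) := by
          rw [Finset.sum_comm]
          refine Finset.sum_congr rfl fun j _ => ?_
          rw [Finset.sum_comm]
          simp only [Finset.mul_sum]
      _ = _ := by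
          simp [horth, pow_two]
  · refine le_of_sq_le_sq ?_ zero_le_one
    rw [PiLp.norm_sq_eq_of_L2]
    simp only [EuclideanSpace.norm_sq_eq, Real.norm_eq_abs, sq_abs, mul_pow]
    rw [Finset.sum_comm]
    have : ∀ l : Fin k, ∑ j, ρ⁻¹ ^ 2 * (f (σ l) ^ 2 * U j (σ l) ^ 2) = ρ⁻¹ ^ 2 * f (σ l) ^ 2 := by
      intro l
      have := horth (σ l) (σ l)
      rw [if_pos rfl] at this
      calc _ = ρ⁻¹ ^ 2 * f (σ l) ^ 2 * ∑ j, U j (σ l) * U j (σ l) := by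
            rw [Finset.mul_sum]
            exact Finset.sum_congr rfl fun j _ => by ring
        _ = _ := by rw [this, mul_one]
    simp only [this]
    rw [← Finset.mul_sum, hsum (fun i => f i ^ 2) (fun i hi => by simp [hf i hi]),
      ← frobenius_norm_sq_conjDiag hU, ← mul_pow]
    apply pow_le_pow_left₀ (by positivity)
    rw [inv_mul_le_iff₀ hρ, mul_one]
    exact hfρ
  · ext i j
    rw [conjDiag_apply, Matrix.smul_apply, factorMatrix, Matrix.of_apply, hXapp, smul_eq_mul,
      Finset.mul_sum, ← hsum _ (fun l hl => by simp [hf l hl])]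
    refine Finset.sum_congr rfl fun l _ => ?_
    simp only
    field_simp

end Spectral

section Split

open scoped Matrix.Norms.Frobenius

variable {n : ℕ} {U : Matrix (Fin n) (Fin n) ℝ}

theorem trace_conjDiag_cube (hU : Uᵀ * U = 1) (f : Fin n → ℝ) :
    (conjDiag U f * conjDiag U f * conjDiag U f).trace = ∑ i, f i ^ 3 := by
  rw [conjDiag_mul hU, conjDiag_mul hU, trace_conjDiag hU]
  exact Finset.sum_congr rfl fun i _ => by ring

theorem sum_mul_conjDiag (hU : Uᵀ * U = 1) (f g : Fin n → ℝ) :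
    ∑ i, ∑ j, conjDiag U f i j * conjDiag U g i j = ∑ i, f i * g i := by
  have h : (conjDiag U f * (conjDiag U g)ᵀ).trace = ∑ i, f i * g i := by
    rw [conjDiag_transpose, conjDiag_mul hU, trace_conjDiag hU]
  rw [← h]
  simp [Matrix.trace, Matrix.mul_apply]

theorem abs_trace_cube_le (A : Matrix (Fin n) (Fin n) ℝ) : |(A * A * A).trace| ≤ ‖A‖ ^ 3 := by
  refine (abs_trace_mul_le_frobenius _ _).trans ?_
  rw [pow_succ, pow_two]
  gcongr
  exact Matrix.frobenius_norm_mul A A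

/-- The restriction of a symmetric matrix to a set of `k` eigenvectors has small norm if the
matrix correlates weakly with all rank-`k` matrices. -/
theorem frobenius_norm_conjDiag_le {k : ℕ} (hU : Uᵀ * U = 1) (f : Fin n → ℝ) {ρ : ℝ} (hρ : 0 ≤ ρ)
    (hfac : ∀ (X : LeftFactor n k) (Y : RightFactor n k), ‖X‖ ≤ 1 → ‖Y‖ ≤ 1 →
      factorForm (conjDiag U f) X Y ≤ ρ)
    (S : Finset (Fin n)) (hS : S.card = k) :
    ‖conjDiag U (fun i => if i ∈ S then f i else 0)‖ ≤ ρ := by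
  set L := conjDiag U (fun i => if i ∈ S then f i else 0) with hL
  rcases (norm_nonneg L).eq_or_lt with h0 | h0
  · rwa [← h0]
  obtain ⟨X, Y, hX, hY, hXY⟩ := exists_factorMatrix_eq hU (fun i => if i ∈ S then f i else 0) S hS
    (fun i hi => if_neg hi) h0 le_rfl
  have h1 := hfac X Y hX hY
  have h2 : ‖L‖ ^ 2 = ‖L‖ * factorForm (conjDiag U f) X Y := by
    rw [frobenius_norm_sq_conjDiag hU, factorForm_apply, Finset.mul_sum]
    calc _ = ∑ i, f i * (if i ∈ S then f i else 0) := by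
          refine Finset.sum_congr rfl fun i _ => ?_
          split_ifs <;> ring
      _ = _ := by
          rw [← sum_mul_conjDiag hU]
          refine Finset.sum_congr rfl fun i _ => ?_
          rw [Finset.mul_sum]
          refine Finset.sum_congr rfl fun j _ => ?_
          rw [hXY, Matrix.smul_apply, smul_eq_mul]
          ring
  rw [pow_two] at h2
  linarith [mul_left_cancel₀ h0.ne' h2]

/-- Splitting a symmetric matrix into a matrix of rank `k` and a remainder of small operator
norm. -/
theorem exists_spectral_split {E : Matrix (Fin n) (Fin n) ℝ} (hE : Eᵀ = E)
    (hdiag : ∀ i, E i i = 0) (habs : ∀ i j, |E i j| ≤ 1) {k : ℕ} (hkn : k ≤ n)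
    {ρ κ : ℝ} (hρ : 0 < ρ) (hκ : 0 ≤ κ) (hkκ : ρ ^ 2 < k * κ ^ 2)
    (hfac : ∀ (X : LeftFactor n k) (Y : RightFactor n k), ‖X‖ ≤ 1 → ‖Y‖ ≤ 1 →
      factorForm E X Y ≤ ρ) :
    ∃ (X : LeftFactor n k) (Y : RightFactor n k) (R : Matrix (Fin n) (Fin n) ℝ),
      ‖X‖ ≤ 1 ∧ ‖Y‖ ≤ 1 ∧ E = ρ • factorMatrix X Y + R ∧
      (∀ B, ‖R * B‖ ≤ κ * ‖B‖) ∧ (∀ B, ‖B * R‖ ≤ κ * ‖B‖) ∧ ‖R‖ ≤ n ∧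
      (R * R * R).trace ≤ (E * E * E).trace + ρ ^ 3 ∧
      (∀ i, ∑ j, R i j ^ 2 ≤ n) ∧ ∑ i, |R i i| ≤ √n * ρ ∧ Rᵀ = R := by
  classical
  obtain ⟨U, f, hU, hU', rfl⟩ := exists_conjDiag hE
  have hnorm := frobenius_norm_conjDiag_le hU f hρ.le hfac
  set T : Finset (Fin n) := Finset.univ.filter fun i => κ < |f i| with hT
  have hTk : T.card < k := by
    by_contra! h
    obtain ⟨S, hST, hS⟩ := Finset.exists_subset_card_eq h
    have h1 := hnorm S hS
    have h2 : (k : ℝ) * κ ^ 2 ≤ ‖conjDiag U (fun i => if i ∈ S then f i else 0)‖ ^ 2 := by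
      rw [frobenius_norm_sq_conjDiag hU, ← hS, ← nsmul_eq_mul]
      calc S.card • κ ^ 2 ≤ ∑ i ∈ S, f i ^ 2 := by
            refine Finset.card_nsmul_le_sum _ _ _ fun i hi => ?_
            rw [← sq_abs (f i)]
            exact pow_le_pow_left₀ hκ (Finset.mem_filter.1 (hST hi)).2.le 2
        _ = _ := by simp [ite_pow, Finset.sum_ite_mem]
    have h3 := pow_le_pow_left₀ (norm_nonneg _) h1 2
    linarith
  obtain ⟨S, hTS, -, hS⟩ := Finset.exists_subsuperset_card_eq (Finset.subset_univ T) hTk.le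
    (by simpa using hkn)
  have hL := hnorm S hS
  obtain ⟨X, Y, hX, hY, hXY⟩ := exists_factorMatrix_eq hU (fun i => if i ∈ S then f i else 0) S hS
    (fun i hi => if_neg hi) hρ hL
  set L := conjDiag U (fun i => if i ∈ S then f i else 0) with hLdef
  set g : Fin n → ℝ := fun i => if i ∈ S then 0 else f i with hg
  have hgκ : ∀ i, |g i| ≤ κ := by
    intro i
    by_cases hi : i ∈ S
    · simpa [hg, hi] using hκ
    · have : i ∉ T := fun h => hi (hTS h)
      simp only [hT, Finset.mem_filter, Finset.mem_univ, true_and, not_lt] at this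
      simpa [hg, hi] using this
  have hsplit : conjDiag U f = L + conjDiag U g := by
    rw [hLdef, conjDiag_add]
    congr 1
    ext i
    by_cases hi : i ∈ S <;> simp [hg, hi]
  have hrow : ∀ i, ∑ j, conjDiag U g i j ^ 2 ≤ n := by
    intro i
    have key : ∀ h : Fin n → ℝ, ∑ j, conjDiag U h i j ^ 2 = ∑ l, h l ^ 2 * U i l ^ 2 := by
      intro h
      have h1 : (conjDiag U h * conjDiag U h) i i = ∑ j, conjDiag U h i j ^ 2 := by
        conv_lhs => rw [← conjDiag_transpose (U := U) h, conjDiag_transpose (U := U) h]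
        rw [Matrix.mul_apply]
        refine Finset.sum_congr rfl fun j _ => ?_
        have := congrFun (congrFun (conjDiag_transpose (U := U) h) i) j
        rw [Matrix.transpose_apply] at this
        rw [this, pow_two]
      rw [← h1, conjDiag_mul hU, conjDiag_apply]
      exact Finset.sum_congr rfl fun l _ => by ring
    calc _ ≤ ∑ j, conjDiag U f i j ^ 2 := by
          rw [key, key]
          refine Finset.sum_le_sum fun l _ => ?_
          refine mul_le_mul_of_nonneg_right ?_ (sq_nonneg _)
          by_cases hl : l ∈ S <;> simp [hg, hl, sq_nonneg]
      _ ≤ ∑ _j : Fin n, (1 : ℝ) := by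
          refine Finset.sum_le_sum fun j _ => ?_
          rw [← sq_abs]
          exact pow_le_one₀ (abs_nonneg _) (habs i j)
      _ = n := by simp
  refine ⟨X, Y, conjDiag U g, hX, hY, hXY ▸ hsplit, frobenius_norm_conjDiag_mul_le hU hU' hgκ hκ,
    frobenius_norm_mul_conjDiag_le hU hU' hgκ hκ, ?_, ?_, hrow, ?_, conjDiag_transpose g⟩
  · refine le_of_sq_le_sq ?_ (by positivity)
    rw [frobenius_norm_sq]
    calc _ ≤ ∑ _i : Fin n, (n : ℝ) := Finset.sum_le_sum fun i _ => hrow i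
      _ = (n : ℝ) ^ 2 := by simp [pow_two]
  · have h1 := (abs_le.1 ((abs_trace_cube_le L).trans (pow_le_pow_left₀ (norm_nonneg _) hL 3))).1
    have h2 : (conjDiag U f * conjDiag U f * conjDiag U f).trace = (L * L * L).trace +
        (conjDiag U g * conjDiag U g * conjDiag U g).trace := by
      rw [hLdef, trace_conjDiag_cube hU, trace_conjDiag_cube hU, trace_conjDiag_cube hU,
        ← Finset.sum_add_distrib]
      refine Finset.sum_congr rfl fun i _ => ?_
      by_cases hi : i ∈ S <;> simp [hg, hi]
    linarith
  · have h1 : ∀ i, conjDiag U g i i = - L i i := by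
      intro i
      have := congrFun (congrFun hsplit i) i
      rw [hdiag, Matrix.add_apply] at this
      linarith
    simp only [h1, abs_neg]
    have h2 : ∑ i, |L i i| ≤ √(n * ∑ i, L i i ^ 2) := by
      refine Real.le_sqrt_of_sq_le ?_
      have := sq_sum_le_card_mul_sum_sq (s := (Finset.univ : Finset (Fin n)))
        (f := fun i => |L i i|)
      simpa using this
    have h3 : ∑ i, L i i ^ 2 ≤ ρ ^ 2 := by
      refine le_trans ?_ (pow_le_pow_left₀ (norm_nonneg _) hL 2)
      rw [frobenius_norm_sq]
      exact Finset.sum_le_sum fun i _ => Finset.single_le_sum (f := fun j => L i j ^ 2)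
        (fun j _ => sq_nonneg _) (Finset.mem_univ i)
    refine h2.trans ?_
    rw [Real.sqrt_mul (by positivity)]
    gcongr
    exact (Real.sqrt_le_left hρ.le).2 h3

end Split

section Coloring

open scoped Matrix.Norms.Frobenius

variable {n : ℕ}

/-- The coordinate projection onto the color class `a`. -/
def colorProj (c : Fin n → Fin 3) (a : Fin 3) : Matrix (Fin n) (Fin n) ℝ :=
  Matrix.diagonal fun i => if c i = a then 1 else 0

/-- The block of `A * B` of paths passing through the three color classes in order. -/
def colorMul (c : Fin n → Fin 3) (A B : Matrix (Fin n) (Fin n) ℝ) : Matrix (Fin n) (Fin n) ℝ :=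
  colorProj c 0 * A * colorProj c 1 * B * colorProj c 2

theorem colorMul_apply (c : Fin n → Fin 3) (A B : Matrix (Fin n) (Fin n) ℝ) (i j : Fin n) :
    colorMul c A B i j =
      ∑ l, if c i = 0 ∧ c l = 1 ∧ c j = 2 then A i l * B l j else 0 := by
  unfold colorMul colorProj
  rw [Matrix.mul_diagonal, Matrix.mul_apply, Finset.sum_mul]
  refine Finset.sum_congr rfl fun l _ => ?_
  rw [Matrix.mul_diagonal, Matrix.diagonal_mul]
  split_ifs <;> simp_all

theorem norm_colorProj_mul_le (c : Fin n → Fin 3) (a : Fin 3) (B : Matrix (Fin n) (Fin n) ℝ) :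
    ‖colorProj c a * B‖ ≤ ‖B‖ := by
  have := frobenius_norm_diagonal_mul_le (f := fun i => if c i = a then (1 : ℝ) else 0) (κ := 1)
    (fun i => by split_ifs <;> simp) zero_le_one B
  rwa [one_mul] at this

theorem norm_mul_colorProj_le (c : Fin n → Fin 3) (a : Fin 3) (B : Matrix (Fin n) (Fin n) ℝ) :
    ‖B * colorProj c a‖ ≤ ‖B‖ := by
  rw [← Matrix.frobenius_norm_transpose, Matrix.transpose_mul, ← Matrix.frobenius_norm_transpose B,
    colorProj, Matrix.diagonal_transpose]
  exact norm_colorProj_mul_le c a _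

theorem card_coloring (i j l : Fin n) (hij : i ≠ j) (hjl : j ≠ l) (hil : i ≠ l) :
    27 * (Finset.univ.filter fun c : Fin n → Fin 3 => c i = 0 ∧ c l = 1 ∧ c j = 2).card
      = 3 ^ n := by
  have h1 : (Finset.univ.filter fun c : Fin n → Fin 3 => c i = 0 ∧ c l = 1 ∧ c j = 2) =
      Fintype.piFinset fun a => if a = i then {0} else if a = l then {1} else
        if a = j then {2} else Finset.univ := by
    ext c
    simp only [Finset.mem_filter, Finset.mem_univ, true_and, Fintype.mem_piFinset]
    constructor
    · rintro ⟨h1, h2, h3⟩ a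
      split_ifs <;> simp_all
    · intro h
      refine ⟨?_, ?_, ?_⟩
      · simpa using h i
      · simpa [hil.symm] using h l
      · simpa [hij.symm, hjl] using h j
  have h2 : (27 : ℕ) = ∏ a : Fin n, if a ∈ ({i, l, j} : Finset (Fin n)) then 3 else 1 := by
    rw [Finset.prod_ite_mem, Finset.univ_inter, Finset.prod_const,
      Finset.card_eq_three.2 ⟨i, l, j, hil, hij, hjl.symm, rfl⟩]
    norm_num
  rw [h1, Fintype.card_piFinset, h2, ← Finset.prod_mul_distrib]
  calc _ = ∏ _a : Fin n, 3 := by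
        refine Finset.prod_congr rfl fun a _ => ?_
        by_cases hi : a = i <;> by_cases hl : a = l <;> by_cases hj : a = j <;> simp_all
    _ = 3 ^ n := by simp

/-- Some coloring makes the rainbow part of `tr R³` at most its average. -/
theorem exists_coloring (R : Matrix (Fin n) (Fin n) ℝ) (hR : Rᵀ = R) {r : ℝ}
    (hrow : ∀ i, ∑ j, R i j ^ 2 ≤ r) {d : ℝ} (hr : 0 ≤ r) (hd : ∑ i, |R i i| ≤ d) :
    ∃ c : Fin n → Fin 3, 27 * (colorMul c R R * R).trace ≤ (R * R * R).trace + 3 * (r * d) := by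
  have hs : ∀ i j, R i j = R j i := fun i j => by
    conv_lhs => rw [← hR, Matrix.transpose_apply]
  set D : ℝ := ∑ i, ∑ j, ∑ l,
    if i ≠ j ∧ j ≠ l ∧ i ≠ l then R i l * R l j * R j i else 0 with hD
  have htr : ∀ c : Fin n → Fin 3, (colorMul c R R * R).trace = ∑ i, ∑ j, ∑ l,
      if c i = 0 ∧ c l = 1 ∧ c j = 2 then R i l * R l j * R j i else 0 := by
    intro c
    rw [Matrix.trace]
    refine Finset.sum_congr rfl fun i _ => ?_
    rw [Matrix.diag_apply, Matrix.mul_apply]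
    refine Finset.sum_congr rfl fun j _ => ?_
    rw [colorMul_apply, Finset.sum_mul]
    refine Finset.sum_congr rfl fun l _ => ?_
    split_ifs <;> simp
  have htot : (R * R * R).trace = ∑ i, ∑ j, ∑ l, R i l * R l j * R j i := by
    rw [Matrix.trace]
    refine Finset.sum_congr rfl fun i _ => ?_
    rw [Matrix.diag_apply, Matrix.mul_apply]
    refine Finset.sum_congr rfl fun j _ => ?_
    rw [Matrix.mul_apply, Finset.sum_mul]
  have havg : ∑ c : Fin n → Fin 3, 27 * (colorMul c R R * R).trace = ∑ _c : Fin n → Fin 3, D := by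
    simp only [htr]
    rw [← Finset.mul_sum, Finset.sum_comm, Finset.mul_sum, Finset.sum_const, Finset.card_univ,
      Fintype.card_fun, Fintype.card_fin, Fintype.card_fin, nsmul_eq_mul, hD, Finset.mul_sum]
    refine Finset.sum_congr rfl fun i _ => ?_
    rw [Finset.sum_comm, Finset.mul_sum, Finset.mul_sum]
    refine Finset.sum_congr rfl fun j _ => ?_
    rw [Finset.sum_comm, Finset.mul_sum, Finset.mul_sum]
    refine Finset.sum_congr rfl fun l _ => ?_
    rw [← Finset.sum_filter, Finset.sum_const, nsmul_eq_mul]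
    split_ifs with h
    · rw [← mul_assoc]
      congr 1
      exact_mod_cast card_coloring i j l h.1 h.2.1 h.2.2
    · rw [Finset.card_eq_zero.2]
      · simp
      · rw [Finset.filter_eq_empty_iff]
        rintro c - ⟨h1, h2, h3⟩
        apply h
        refine ⟨?_, ?_, ?_⟩ <;> rintro rfl <;> simp_all
  obtain ⟨c, -, hc⟩ := Finset.exists_le_of_sum_le Finset.univ_nonempty havg.le
  refine ⟨c, hc.trans ?_⟩
  have hdiag : ∑ i, ∑ l, |R i i| * R i l ^ 2 ≤ r * d := by
    calc _ = ∑ i, |R i i| * ∑ l, R i l ^ 2 := by simp only [Finset.mul_sum]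
      _ ≤ ∑ i, |R i i| * r := Finset.sum_le_sum fun i _ =>
          mul_le_mul_of_nonneg_left (hrow i) (abs_nonneg _)
      _ = r * ∑ i, |R i i| := by rw [← Finset.sum_mul, mul_comm]
      _ ≤ r * d := mul_le_mul_of_nonneg_left hd hr
  have hterm : ∀ i j l, (if i ≠ j ∧ j ≠ l ∧ i ≠ l then R i l * R l j * R j i else 0) ≤
      R i l * R l j * R j i + ((if i = j then |R i i| * R i l ^ 2 else 0) +
        (if j = l then |R j j| * R j i ^ 2 else 0) + (if i = l then |R i i| * R i j ^ 2 else 0)) := by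
    intro i j l
    have h1 : 0 ≤ (if i = j then |R i i| * R i l ^ 2 else 0) := by positivity
    have h2 : 0 ≤ (if j = l then |R j j| * R j i ^ 2 else 0) := by positivity
    have h3 : 0 ≤ (if i = l then |R i i| * R i j ^ 2 else 0) := by positivity
    have h4 : ∀ a b : ℝ, 0 ≤ a * b ^ 2 + |a| * b ^ 2 := fun a b => by
      rw [← add_mul]
      exact mul_nonneg (by linarith [neg_abs_le a]) (sq_nonneg b)
    by_cases hdis : i ≠ j ∧ j ≠ l ∧ i ≠ l
    · rw [if_pos hdis]
      linarith
    rw [if_neg hdis]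
    by_cases e1 : i = j
    · subst e1
      have := h4 (R i i) (R i l)
      rw [hs l i, if_pos rfl]
      linarith
    by_cases e2 : j = l
    · subst e2
      have := h4 (R j j) (R j i)
      rw [hs i j, if_pos rfl, if_neg e1]
      linarith
    by_cases e3 : i = l
    · subst e3
      have := h4 (R i i) (R i j)
      rw [hs j i, if_pos rfl, if_neg e1, if_neg e2]
      linarith
    exact absurd ⟨e1, e2, e3⟩ hdis
  calc D ≤ ∑ i, ∑ j, ∑ l, (R i l * R l j * R j i + ((if i = j then |R i i| * R i l ^ 2 else 0) +
        (if j = l then |R j j| * R j i ^ 2 else 0) + (if i = l then |R i i| * R i j ^ 2 else 0))) :=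
        Finset.sum_le_sum fun i _ => Finset.sum_le_sum fun j _ => Finset.sum_le_sum fun l _ =>
          hterm i j l
    _ = (R * R * R).trace + (∑ i, ∑ l, |R i i| * R i l ^ 2 + ∑ i, ∑ l, |R i i| * R i l ^ 2 +
          ∑ i, ∑ l, |R i i| * R i l ^ 2) := by
        simp only [Finset.sum_add_distrib]
        rw [htot]
        congr 3
        · refine Finset.sum_congr rfl fun i _ => ?_
          rw [Finset.sum_comm]
          simp
        · rw [Finset.sum_comm]
          simp
        · simp
    _ ≤ _ := by linarith

theorem norm_colorMul_le (c : Fin n → Fin 3) (A B : Matrix (Fin n) (Fin n) ℝ) :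
    ‖colorMul c A B‖ ≤ ‖A * (colorProj c 1 * B)‖ := by
  unfold colorMul
  refine (norm_mul_colorProj_le c 2 _).trans ?_
  rw [Matrix.mul_assoc, Matrix.mul_assoc]
  exact norm_colorProj_mul_le c 0 _

theorem abs_trace_colorMul_mul_le (c : Fin n → Fin 3) (A B C : Matrix (Fin n) (Fin n) ℝ) :
    |(colorMul c A B * C).trace| ≤ ‖A‖ * ‖B * (colorProj c 2 * C)‖ := by
  have h : colorMul c A B * C = colorProj c 0 * A * colorProj c 1 * (B * (colorProj c 2 * C)) := by
    simp only [colorMul, Matrix.mul_assoc]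
  rw [h]
  refine (abs_trace_mul_le_frobenius _ _).trans ?_
  gcongr
  exact (norm_mul_colorProj_le c 1 _).trans (norm_colorProj_mul_le c 0 _)

theorem colorMul_add (c : Fin n → Fin 3) (R D : Matrix (Fin n) (Fin n) ℝ) :
    colorMul c (R + D) (R + D) =
      colorMul c R R + (colorMul c D R + colorMul c R D + colorMul c D D) := by
  simp only [colorMul, Matrix.mul_add, Matrix.add_mul]
  abel

theorem norm_colorMul_add_le (c : Fin n → Fin 3) {R D : Matrix (Fin n) (Fin n) ℝ} {κ r d : ℝ}
    (hκ : 0 ≤ κ) (hRl : ∀ B, ‖R * B‖ ≤ κ * ‖B‖) (hRr : ∀ B, ‖B * R‖ ≤ κ * ‖B‖)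
    (hR : ‖R‖ ≤ r) (hd : 0 ≤ d) (hD : ‖D‖ ≤ d) :
    ‖colorMul c (R + D) (R + D)‖ ≤ κ * r + 2 * κ * d + d ^ 2 := by
  have hl : ∀ A b, ‖A‖ ≤ b → ‖colorMul c R A‖ ≤ κ * b := fun A b hA =>
    (norm_colorMul_le c R A).trans ((hRl _).trans
      (mul_le_mul_of_nonneg_left ((norm_colorProj_mul_le c 1 A).trans hA) hκ))
  have h1 := hl R r hR
  have h2 := hl D d hD
  have h3 : ‖colorMul c D R‖ ≤ κ * d := by
    refine (norm_colorMul_le c D R).trans ?_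
    rw [← Matrix.mul_assoc]
    exact (hRr _).trans (mul_le_mul_of_nonneg_left ((norm_mul_colorProj_le c 1 D).trans hD) hκ)
  have h4 : ‖colorMul c D D‖ ≤ d * d := by
    refine (norm_colorMul_le c D D).trans ((Matrix.frobenius_norm_mul _ _).trans ?_)
    gcongr
    exact (norm_colorProj_mul_le c 1 D).trans hD
  rw [colorMul_add]
  have h5 := norm_add₃_le (a := colorMul c D R) (b := colorMul c R D) (c := colorMul c D D)
  have h6 := norm_add_le (colorMul c R R) (colorMul c D R + colorMul c R D + colorMul c D D)
  nlinarith

theorem trace_colorMul_add_le (c : Fin n → Fin 3) {R D : Matrix (Fin n) (Fin n) ℝ} {κ r d : ℝ}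
    (hκ : 0 ≤ κ) (hRl : ∀ B, ‖R * B‖ ≤ κ * ‖B‖) (hRr : ∀ B, ‖B * R‖ ≤ κ * ‖B‖)
    (hr : 0 ≤ r) (hR : ‖R‖ ≤ r) (hd : 0 ≤ d) (hD : ‖D‖ ≤ d) :
    (colorMul c (R + D) (R + D) * (R + D)).trace ≤ (colorMul c R R * R).trace +
      (3 * κ * r * d + 3 * κ * d ^ 2 + d ^ 3) := by
  have hP : ∀ (B : Matrix (Fin n) (Fin n) ℝ) b, ‖B‖ ≤ b → ‖colorProj c 2 * B‖ ≤ b :=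
    fun B b hB => (norm_colorProj_mul_le c 2 B).trans hB
  have hDP : ‖D * colorProj c 2‖ ≤ d := (norm_mul_colorProj_le c 2 D).trans hD
  have hDR : ‖D * (colorProj c 2 * R)‖ ≤ κ * d := by
    rw [← Matrix.mul_assoc]
    exact (hRr _).trans (mul_le_mul_of_nonneg_left hDP hκ)
  have hRR : ‖R * (colorProj c 2 * R)‖ ≤ κ * r :=
    (hRl _).trans (mul_le_mul_of_nonneg_left (hP R r hR) hκ)
  have hRD : ‖R * (colorProj c 2 * D)‖ ≤ κ * d :=
    (hRl _).trans (mul_le_mul_of_nonneg_left (hP D d hD) hκ)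
  have hDD : ‖D * (colorProj c 2 * D)‖ ≤ d * d := by
    refine (Matrix.frobenius_norm_mul _ _).trans ?_
    gcongr
    exact hP D d hD
  have key : ∀ (A B C : Matrix (Fin n) (Fin n) ℝ) a b, 0 ≤ a → ‖A‖ ≤ a →
      ‖B * (colorProj c 2 * C)‖ ≤ b → (colorMul c A B * C).trace ≤ a * b := by
    intro A B C a b ha hA hB
    exact (le_abs_self _).trans ((abs_trace_colorMul_mul_le c A B C).trans
      (mul_le_mul hA hB (norm_nonneg _) ha))
  have k1 := key D R R _ _ hd hD hRR
  have k2 := key R D R _ _ hr hR hDR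
  have k3 := key R R D _ _ hr hR hRD
  have k4 := key D D R _ _ hd hD hDR
  have k5 := key D R D _ _ hd hD hRD
  have k7 := key D D D _ _ hd hD hDD
  have k6 : (colorMul c R D * D).trace ≤ κ * d * d := by
    refine (le_abs_self _).trans ((abs_trace_mul_le_frobenius _ _).trans ?_)
    gcongr
    exact (norm_colorMul_le c R D).trans ((hRl _).trans
      (mul_le_mul_of_nonneg_left ((norm_colorProj_mul_le c 1 D).trans hD) hκ))
  rw [colorMul_add]
  simp only [Matrix.add_mul, Matrix.mul_add, Matrix.trace_add]
  nlinarith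

end Coloring

section UpperTail

open scoped Matrix.Norms.Frobenius

variable {n : ℕ}

theorem sum_le_card_mul_of_cover {α β : Type*} (w : α → ℝ) (hw : ∀ a, 0 ≤ w a) (bad : Finset α)
    (I : Finset β) (F : β → Finset α) (hcov : ∀ a ∈ bad, ∃ b ∈ I, a ∈ F b) {c : ℝ}
    (hF : ∀ b ∈ I, ∑ a ∈ F b, w a ≤ c) : ∑ a ∈ bad, w a ≤ I.card * c := by
  classical
  calc ∑ a ∈ bad, w a ≤ ∑ a ∈ bad, ∑ b ∈ I, if a ∈ F b then w a else 0 := by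
        refine Finset.sum_le_sum fun a ha => ?_
        obtain ⟨b, hb, hab⟩ := hcov a ha
        refine le_trans ?_ (Finset.single_le_sum (f := fun b => if a ∈ F b then w a else 0)
          (fun b _ => by split_ifs <;> simp [hw]) hb)
        simp [hab]
    _ = ∑ b ∈ I, ∑ a ∈ bad with a ∈ F b, w a := by
        rw [Finset.sum_comm]
        simp only [Finset.sum_filter]
    _ ≤ ∑ b ∈ I, ∑ a ∈ F b, w a := Finset.sum_le_sum fun b _ =>
        Finset.sum_le_sum_of_subset_of_nonneg (fun a ha => (Finset.mem_filter.1 ha).2)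
          fun a _ _ => hw a
    _ ≤ ∑ _b ∈ I, c := Finset.sum_le_sum hF
    _ = I.card * c := by rw [Finset.sum_const, nsmul_eq_mul]

theorem centeredAdj_update (p : ℝ) (g : EdgeIdx n → Bool) (e : EdgeIdx n) (b : Bool) (i j : Fin n)
    (h₁ : ¬ (e.1.1 = i ∧ e.1.2 = j)) (h₂ : ¬ (e.1.1 = j ∧ e.1.2 = i)) :
    centeredAdj p (Function.update g e b) i j = centeredAdj p g i j := by
  have key : ∀ e' : EdgeIdx n, e' ≠ e → centeredAdj p (Function.update g e b) e'.1.1 e'.1.2 =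
      centeredAdj p g e'.1.1 e'.1.2 := by
    intro e' he
    rw [centeredAdj_apply_lt, centeredAdj_apply_lt, Function.update_of_ne he]
  rcases lt_trichotomy i j with h | h | h
  · refine key ⟨(i, j), h⟩ ?_
    rintro rfl
    exact h₁ ⟨rfl, rfl⟩
  · subst h; simp [centeredAdj_diag]
  · rw [centeredAdj_symm, centeredAdj_symm p g]
    refine key ⟨(j, i), h⟩ ?_
    rintro rfl
    exact h₂ ⟨rfl, rfl⟩

/-- Conditionally on the other two color blocks, the rainbow triangle count is linear. -/
theorem sum_bernoulliWeight_le_of_colorMul {p v : ℝ} (hp₀ : 0 ≤ p) (hp₁ : p ≤ 1) (hv₀ : 0 ≤ v)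
    (hv : ∀ x : ℝ, p * Real.exp (x * (1 - p)) + (1 - p) * Real.exp (x * (0 - p)) ≤
      Real.exp (v * x ^ 2 / 2))
    (c : Fin n → Fin 3) (M : Matrix (Fin n) (Fin n) ℝ) (θ x : ℝ) (bad : Finset (EdgeIdx n → Bool))
    (hbad : ∀ g ∈ bad, x ≤ -θ * ∑ i, ∑ j,
      colorMul c (centeredAdj p g - M) (centeredAdj p g - M) i j * centeredAdj p g i j -
      v * θ ^ 2 * ‖colorMul c (centeredAdj p g - M) (centeredAdj p g - M)‖ ^ 2) :
    ∑ g ∈ bad, bernoulliWeight p g ≤ Real.exp (-x) := by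
  classical
  refine sum_bernoulliWeight_le_of_linear hp₀ hp₁ hv₀ hv
    (Finset.univ.filter fun e => (c e.1.1 = 0 ∧ c e.1.2 = 2) ∨ (c e.1.1 = 2 ∧ c e.1.2 = 0))
    (fun g => -θ • colorMul c (centeredAdj p g - M) (centeredAdj p g - M)) ?_ ?_ bad x ?_
  · intro e he g b
    simp only [Finset.mem_filter, Finset.mem_univ, true_and] at he
    refine congrArg (fun A => -θ • A) ?_
    ext i j
    rw [colorMul_apply, colorMul_apply]
    refine Finset.sum_congr rfl fun l _ => ?_
    by_cases h : c i = 0 ∧ c l = 1 ∧ c j = 2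
    · obtain ⟨h1, h2, h3⟩ := h
      have hl : ∀ a, e.1.1 = l ∨ e.1.2 = l →
          centeredAdj p (Function.update g e b) a l = centeredAdj p g a l := by
        rintro a (h | h) <;> rw [h, h2] at he <;> simp at he
      have hu : ∀ a, centeredAdj p (Function.update g e b) a l = centeredAdj p g a l := by
        intro a
        by_cases h : e.1.1 = l ∨ e.1.2 = l
        · exact hl a h
        · rw [not_or] at h
          exact centeredAdj_update p g e b a l (fun h' => h.2 h'.2) (fun h' => h.1 h'.1)
      simp only [Matrix.sub_apply]
      rw [hu, centeredAdj_symm p _ l j, hu, centeredAdj_symm p g l j]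
    · rw [if_neg h, if_neg h]
  · intro g e he
    simp only [Finset.mem_filter, Finset.mem_univ, true_and, not_or] at he
    simp only [Matrix.smul_apply, colorMul_apply]
    constructor
    · rw [Finset.sum_eq_zero, smul_zero]
      intro l _
      rw [if_neg]
      rintro ⟨h1, h2, h3⟩
      exact he.1 ⟨h1, h3⟩
    · rw [Finset.sum_eq_zero, smul_zero]
      intro l _
      rw [if_neg]
      rintro ⟨h1, h2, h3⟩
      exact he.2 ⟨h3, h1⟩
  · intro g hg
    refine (hbad g hg).trans_eq ?_
    rw [frobenius_norm_sq]
    simp only [Matrix.smul_apply, smul_eq_mul, mul_pow, Finset.mul_sum]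
    congr 1
    · refine Finset.sum_congr rfl fun i _ => Finset.sum_congr rfl fun j _ => by ring
    · refine Finset.sum_congr rfl fun i _ => Finset.sum_congr rfl fun j _ => by ring

theorem norm_factorMatrix_le {k : ℕ} (X : LeftFactor n k) (Y : RightFactor n k) :
    ‖factorMatrix X Y‖ ≤ ‖X‖ * ‖Y‖ := by
  refine le_of_sq_le_sq ?_ (by positivity)
  rw [frobenius_norm_sq]
  exact sum_factorMatrix_sq_le X Y

theorem sum_bernoulliWeight_le_of_factorForm {p v : ℝ} (hp₀ : 0 ≤ p) (hp₁ : p ≤ 1) (hv₀ : 0 < v)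
    (hv : ∀ x : ℝ, p * Real.exp (x * (1 - p)) + (1 - p) * Real.exp (x * (0 - p)) ≤
      Real.exp (v * x ^ 2 / 2)) {k : ℕ}
    (X : LeftFactor n k) (Y : RightFactor n k) (hX : ‖X‖ ≤ 1) (hY : ‖Y‖ ≤ 1) {a : ℝ} (ha : 0 ≤ a)
    (bad : Finset (EdgeIdx n → Bool)) (hbad : ∀ g ∈ bad, a ≤ factorForm (centeredAdj p g) X Y) :
    ∑ g ∈ bad, bernoulliWeight p g ≤ Real.exp (-(a ^ 2 / (4 * v))) := by
  refine sum_bernoulliWeight_le_of_linear hp₀ hp₁ hv₀.le hv Finset.univ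
    (fun _ => (a / (2 * v)) • factorMatrix X Y) (fun _ _ _ _ => rfl) (by simp) bad _ ?_
  intro g hg
  have h1 := hbad g hg
  have h2 : ∑ i, ∑ j, factorMatrix X Y i j ^ 2 ≤ 1 := by
    refine (sum_factorMatrix_sq_le X Y).trans ?_
    exact pow_le_one₀ (by positivity) (mul_le_one₀ hX (norm_nonneg _) hY)
  have h3 : ∑ i, ∑ j, ((a / (2 * v)) • factorMatrix X Y) i j * centeredAdj p g i j =
      a / (2 * v) * factorForm (centeredAdj p g) X Y := by
    rw [factorForm_apply]
    simp only [Matrix.smul_apply, smul_eq_mul, Finset.mul_sum]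
    exact Finset.sum_congr rfl fun i _ => Finset.sum_congr rfl fun j _ => by ring
  have h4 : ∑ i, ∑ j, ((a / (2 * v)) • factorMatrix X Y) i j ^ 2 =
      (a / (2 * v)) ^ 2 * ∑ i, ∑ j, factorMatrix X Y i j ^ 2 := by
    simp only [Matrix.smul_apply, smul_eq_mul, Finset.mul_sum, mul_pow]
  rw [h3, h4]
  calc a ^ 2 / (4 * v) = a / (2 * v) * a - v * ((a / (2 * v)) ^ 2 * 1) := by
        field_simp
        ring
    _ ≤ _ := by gcongr

end UpperTail

section UpperTailCombined

open scoped Matrix.Norms.Frobenius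

variable {n : ℕ}

/-- A matrix with very negative `tr E³` but no correlation with rank-`k` matrices has, for a
suitable coloring and approximate low-rank part, a very negative rainbow triangle count. -/
theorem exists_colorMul_le {E : Matrix (Fin n) (Fin n) ℝ} (hE : Eᵀ = E)
    (hdiag : ∀ i, E i i = 0) (habs : ∀ i j, |E i j| ≤ 1) {k : ℕ} (hkn : k ≤ n)
    {ε h s κ : ℝ} (hε : 0 < ε) (hε1 : ε ≤ 1 / 2) (hh : 0 < h) (hhε : 1296 * h ≤ ε) (hs : 0 < s)
    (hκ : 0 ≤ κ) (hkκ : s ^ 2 ≤ k * κ ^ 2) (hκn : κ * n ≤ h * s ^ 2) (hκs : κ ≤ h * s)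
    (hns : n * √n ≤ h * s ^ 2)
    (hfac : ∀ (X : LeftFactor n k) (Y : RightFactor n k), ‖X‖ ≤ 1 → ‖Y‖ ≤ 1 →
      factorForm E X Y ≤ (1 - ε) * s)
    (htr : (E * E * E).trace ≤ -((1 - ε) * s ^ 3))
    (s₁ : Finset (LeftFactor n k)) (s₂ : Finset (RightFactor n k)) (hs₁ : ∀ X ∈ s₁, ‖X‖ ≤ 1)
    (hs₂ : ∀ Y ∈ s₂, ‖Y‖ ≤ 1)
    (hnet₁ : ∀ X : LeftFactor n k, ‖X‖ ≤ 1 → ∃ X' ∈ s₁, ‖X - X'‖ ≤ h / 2)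
    (hnet₂ : ∀ Y : RightFactor n k, ‖Y‖ ≤ 1 → ∃ Y' ∈ s₂, ‖Y - Y'‖ ≤ h / 2) :
    ∃ (c : Fin n → Fin 3), ∃ X ∈ s₁, ∃ Y ∈ s₂,
      ‖colorMul c (E - ((1 - ε) * s) • factorMatrix X Y) (E - ((1 - ε) * s) • factorMatrix X Y)‖ ≤
        4 * h * s ^ 2 ∧
      ∑ i, ∑ j, colorMul c (E - ((1 - ε) * s) • factorMatrix X Y)
        (E - ((1 - ε) * s) • factorMatrix X Y) i j * E i j ≤ -(ε / 108 * s ^ 3) := by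
  have hε3 : (1 - ε) ^ 3 - (1 - ε) ≤ -(ε / 2) := by
    linarith [mul_nonneg hε.le (sub_nonneg.2 hε1), pow_pos hε 3]
  have hh1 : h ≤ 1 := by linarith
  have hh2 : h ^ 2 ≤ h := pow_le_of_le_one hh.le hh1 two_ne_zero
  have hh3 : h ^ 3 ≤ h := pow_le_of_le_one hh.le hh1 three_ne_zero
  set ρ := (1 - ε) * s with hρdef
  have hρ : 0 < ρ := by
    rw [hρdef]
    exact mul_pos (by linarith) hs
  have hρs : ρ < s := by
    rw [hρdef]
    linarith [mul_pos hε hs]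
  have hkκ' : ρ ^ 2 < k * κ ^ 2 := lt_of_lt_of_le (pow_lt_pow_left₀ hρs hρ.le two_ne_zero) hkκ
  obtain ⟨X, Y, R, hX, hY, hER, hRl, hRr, hRn, hRtr, hrow, hRd, hRT⟩ :=
    exists_spectral_split hE hdiag habs hkn hρ hκ hkκ' hfac
  obtain ⟨X', hX's, hXX'⟩ := hnet₁ X hX
  obtain ⟨Y', hY's, hYY'⟩ := hnet₂ Y hY
  obtain ⟨c, hc⟩ := exists_coloring R hRT hrow (Nat.cast_nonneg n) hRd
  refine ⟨c, X', hX's, Y', hY's, ?_⟩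
  have hX' := hs₁ X' hX's
  have hY' := hs₂ Y' hY's
  set D : Matrix (Fin n) (Fin n) ℝ := ρ • (factorMatrix X Y - factorMatrix X' Y') with hD
  have hDd : ‖D‖ ≤ h * s := by
    rw [hD, norm_smul, Real.norm_of_nonneg hρ.le, factorMatrix_sub_sub]
    have h1 : ‖factorMatrix (X - X') Y + factorMatrix X' (Y - Y')‖ ≤ h := by
      refine (norm_add_le _ _).trans ?_
      have h2 := norm_factorMatrix_le (X - X') Y
      have h3 := norm_factorMatrix_le X' (Y - Y')
      have h4 : ‖X - X'‖ * ‖Y‖ ≤ h / 2 * 1 := mul_le_mul hXX' hY (norm_nonneg _) (by positivity)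
      have h5 : ‖X'‖ * ‖Y - Y'‖ ≤ 1 * (h / 2) := mul_le_mul hX' hYY' (norm_nonneg _) zero_le_one
      linarith
    rw [mul_comm h]
    exact mul_le_mul hρs.le h1 (norm_nonneg _) hs.le
  have hEM : E - ρ • factorMatrix X' Y' = R + D := by
    rw [hER, hD, smul_sub]
    abel
  have hd : 0 ≤ h * s := by positivity
  have hC := norm_colorMul_add_le c hκ hRl hRr hRn hd hDd
  have hT := trace_colorMul_add_le c hκ hRl hRr (Nat.cast_nonneg n) hRn hd hDd
  rw [hEM]
  set C := colorMul c (R + D) (R + D) with hCdef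
  have e1 : κ * (h * s) ≤ h ^ 2 * s ^ 2 := by
    linarith [mul_le_mul_of_nonneg_right hκs hd]
  have e2 : h ^ 2 * s ^ 2 ≤ h * s ^ 2 := mul_le_mul_of_nonneg_right hh2 (sq_nonneg s)
  have hC4 : ‖C‖ ≤ 4 * h * s ^ 2 := by linarith
  refine ⟨hC4, ?_⟩
  have hsum : ∑ i, ∑ j, C i j * E i j = (C * (R + D)).trace + (C * ρ • factorMatrix X' Y').trace := by
    rw [← Matrix.trace_add, ← Matrix.mul_add, ← hEM, sub_add_cancel]
    conv_rhs => rw [← hE]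
    simp [Matrix.trace, Matrix.mul_apply]
  have hM : (C * ρ • factorMatrix X' Y').trace ≤ 4 * h * s ^ 2 * s := by
    refine (le_abs_self _).trans ((abs_trace_mul_le_frobenius _ _).trans ?_)
    refine mul_le_mul hC4 ?_ (norm_nonneg _) (by positivity)
    rw [norm_smul, Real.norm_of_nonneg hρ.le]
    have h1 := norm_factorMatrix_le X' Y'
    have h2 : ‖X'‖ * ‖Y'‖ ≤ 1 := mul_le_one₀ hX' (norm_nonneg _) hY'
    calc ρ * ‖factorMatrix X' Y'‖ ≤ s * 1 :=
          mul_le_mul hρs.le (h1.trans h2) (norm_nonneg _) hs.le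
      _ = s := mul_one s
  have hRtr' : (R * R * R).trace ≤ -(ε / 2 * s ^ 3) := by
    refine hRtr.trans ?_
    calc (E * E * E).trace + ρ ^ 3 ≤ -((1 - ε) * s ^ 3) + ρ ^ 3 := by linarith
      _ = ((1 - ε) ^ 3 - (1 - ε)) * s ^ 3 := by rw [hρdef]; ring
      _ ≤ -(ε / 2) * s ^ 3 := mul_le_mul_of_nonneg_right hε3 (by positivity)
      _ = _ := by ring
  have hs3 : 0 < s ^ 3 := by positivity
  have f1 : (n : ℝ) * (√n * ρ) ≤ h * s ^ 3 := by
    calc (n : ℝ) * (√n * ρ) = n * √n * ρ := by ring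
      _ ≤ h * s ^ 2 * s := mul_le_mul hns hρs.le hρ.le (by positivity)
      _ = _ := by ring
  have f2 : 3 * κ * n * (h * s) ≤ 3 * h * s ^ 3 := by
    calc 3 * κ * n * (h * s) = 3 * (κ * n) * (h * s) := by ring
      _ ≤ 3 * (h * s ^ 2) * (1 * s) := by gcongr
      _ = _ := by ring
  have f3 : 3 * κ * (h * s) ^ 2 ≤ 3 * h * s ^ 3 := by
    calc 3 * κ * (h * s) ^ 2 ≤ 3 * (h * s) * (1 * s) ^ 2 := by gcongr
      _ = _ := by ring
  have f4 : (h * s) ^ 3 ≤ h * s ^ 3 := by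
    calc (h * s) ^ 3 = h ^ 3 * s ^ 3 := by ring
      _ ≤ _ := mul_le_mul_of_nonneg_right hh3 hs3.le
  have f5 : 1296 * h * s ^ 3 ≤ ε * s ^ 3 := mul_le_mul_of_nonneg_right hhε hs3.le
  have f6 : 0 < h * s ^ 3 := by positivity
  rw [hsum]
  linarith

/-- Tail bound for `tr E³`, where `E` is the centered adjacency matrix of a binomial random
graph. -/
theorem sum_bernoulliWeight_trace_cube_le {p v : ℝ} (hp₀ : 0 ≤ p) (hp₁ : p ≤ 1) (hv₀ : 0 < v)
    (hv : ∀ x : ℝ, p * Real.exp (x * (1 - p)) + (1 - p) * Real.exp (x * (0 - p)) ≤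
      Real.exp (v * x ^ 2 / 2)) {k : ℕ} (hkn : k ≤ n)
    {ε h s κ B : ℝ} (hε : 0 < ε) (hε1 : ε ≤ 1 / 2) (hh : 0 < h) (hhε : 1296 * h ≤ ε) (hs : 0 < s)
    (hB : 0 ≤ B) (hhB : 16 * v * (108 * (B + 1) / ε) ^ 2 * h ^ 2 ≤ 1)
    (hκ : 0 ≤ κ) (hkκ : s ^ 2 ≤ k * κ ^ 2) (hκn : κ * n ≤ h * s ^ 2) (hκs : κ ≤ h * s)
    (hns : n * √n ≤ h * s ^ 2) (bad : Finset (EdgeIdx n → Bool))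
    (hbad : ∀ g ∈ bad, (centeredAdj p g * centeredAdj p g * centeredAdj p g).trace ≤
      -((1 - ε) * s ^ 3)) :
    ∑ g ∈ bad, bernoulliWeight p g ≤
      (6 / h) ^ (2 * n * k) * Real.exp (-(((1 - h) * ((1 - ε) * s)) ^ 2 / (4 * v))) +
      3 ^ n * (6 / h) ^ (2 * n * k) * Real.exp (-(B * s ^ 2)) := by
  classical
  have hh1 : h ≤ 1 / 2 := by linarith
  obtain ⟨s₁, hs₁, hc₁, hnet₁⟩ := exists_net (LeftFactor n k) (η := h / 2) (by positivity)
    (by linarith)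
  obtain ⟨s₂, hs₂, hc₂, hnet₂⟩ := exists_net (RightFactor n k) (η := h / 2) (by positivity)
    (by linarith)
  rw [finrank_leftFactor] at hc₁
  rw [finrank_rightFactor] at hc₂
  have hcard : ((s₁ ×ˢ s₂).card : ℝ) ≤ (6 / h) ^ (2 * n * k) := by
    rw [Finset.card_product, Nat.cast_mul]
    calc (s₁.card : ℝ) * s₂.card ≤ (3 / (h / 2)) ^ (n * k) * (3 / (h / 2)) ^ (n * k) := by gcongr
      _ = (6 / h) ^ (2 * n * k) := by
        rw [← pow_add]
        congr 1
        · field_simp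
          norm_num
        · ring
  have hw := bernoulliWeight_nonneg (ι := EdgeIdx n) hp₀ hp₁
  set a := (1 - h) * ((1 - ε) * s) with ha
  have ha0 : 0 ≤ a := by
    have : 0 ≤ 1 - ε := by linarith
    have : 0 ≤ 1 - h := by linarith
    positivity
  set P : (EdgeIdx n → Bool) → Prop := fun g =>
    ∃ z ∈ s₁ ×ˢ s₂, a ≤ factorForm (centeredAdj p g) z.1 z.2 with hP
  rw [← Finset.sum_filter_add_sum_filter_not bad P]
  refine add_le_add ?_ ?_
  · refine (sum_le_card_mul_of_cover _ hw (bad.filter P) (s₁ ×ˢ s₂)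
      (fun z => Finset.univ.filter fun g => a ≤ factorForm (centeredAdj p g) z.1 z.2) ?_
      (c := Real.exp (-(a ^ 2 / (4 * v)))) ?_).trans ?_
    · intro g hg
      obtain ⟨z, hz, hz'⟩ := (Finset.mem_filter.1 hg).2
      exact ⟨z, hz, by simpa using hz'⟩
    · intro z hz
      rw [Finset.mem_product] at hz
      exact sum_bernoulliWeight_le_of_factorForm hp₀ hp₁ hv₀ hv z.1 z.2 (hs₁ _ hz.1) (hs₂ _ hz.2)
        ha0 _ fun g hg => (Finset.mem_filter.1 hg).2
    · gcongr
  · set Q : (Fin n → Fin 3) → LeftFactor n k → RightFactor n k → (EdgeIdx n → Bool) → Prop :=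
      fun c X Y g =>
        ‖colorMul c (centeredAdj p g - ((1 - ε) * s) • factorMatrix X Y)
          (centeredAdj p g - ((1 - ε) * s) • factorMatrix X Y)‖ ≤ 4 * h * s ^ 2 ∧
        ∑ i, ∑ j, colorMul c (centeredAdj p g - ((1 - ε) * s) • factorMatrix X Y)
          (centeredAdj p g - ((1 - ε) * s) • factorMatrix X Y) i j * centeredAdj p g i j ≤
            -(ε / 108 * s ^ 3) with hQ
    refine (sum_le_card_mul_of_cover _ hw (bad.filter fun g => ¬ P g)
      ((Finset.univ : Finset (Fin n → Fin 3)) ×ˢ (s₁ ×ˢ s₂))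
      (fun z => Finset.univ.filter fun g => Q z.1 z.2.1 z.2.2 g) ?_
      (c := Real.exp (-(B * s ^ 2))) ?_).trans ?_
    · intro g hg
      obtain ⟨hg, hPg⟩ := Finset.mem_filter.1 hg
      have hfac : ∀ (X : LeftFactor n k) (Y : RightFactor n k), ‖X‖ ≤ 1 → ‖Y‖ ≤ 1 →
          factorForm (centeredAdj p g) X Y ≤ (1 - ε) * s := by
        have h1 := opNorm_le_of_net (factorForm (centeredAdj p g)) (η := h / 2) (r := a)
          (by positivity) s₁ s₂ hs₁ hnet₁ hnet₂ (fun X hX Y hY => by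
            by_contra! h
            exact hPg ⟨(X, Y), Finset.mem_product.2 ⟨hX, hY⟩, h.le⟩)
        have h2 : ‖factorForm (k := k) (centeredAdj p g)‖ ≤ (1 - ε) * s := by
          rw [ha] at h1
          have : 0 < 1 - h := by linarith
          refine le_of_mul_le_mul_left ?_ this
          calc _ = (1 - 2 * (h / 2)) * ‖factorForm (k := k) (centeredAdj p g)‖ := by ring
            _ ≤ _ := h1
        intro X Y hX hY
        refine (Real.le_norm_self _).trans
          (((factorForm (centeredAdj p g)).le_opNorm₂ X Y).trans ?_)
        calc _ ≤ ‖factorForm (k := k) (centeredAdj p g)‖ * 1 * 1 := by gcongr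
          _ ≤ _ := by rw [mul_one, mul_one]; exact h2
      obtain ⟨c, X, hX, Y, hY, hXY⟩ := exists_colorMul_le
        (by ext i j; rw [Matrix.transpose_apply, centeredAdj_symm]) (centeredAdj_diag p g)
        (abs_centeredAdj_le hp₀ hp₁ g) hkn hε hε1 hh hhε hs hκ hkκ hκn hκs hns hfac (hbad g hg)
        s₁ s₂ hs₁ hs₂ hnet₁ hnet₂
      exact ⟨(c, X, Y), by simp [hX, hY], by simpa [hQ] using hXY⟩
    · rintro ⟨c, X, Y⟩ -
      refine sum_bernoulliWeight_le_of_colorMul hp₀ hp₁ hv₀.le hv c (((1 - ε) * s) • factorMatrix X Y)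
        (108 * (B + 1) / ε / s) _ _ ?_
      intro g hg
      obtain ⟨h1, h2⟩ := (Finset.mem_filter.1 hg).2
      simp only at h1 h2
      set C := colorMul c (centeredAdj p g - ((1 - ε) * s) • factorMatrix X Y)
          (centeredAdj p g - ((1 - ε) * s) • factorMatrix X Y)
      set A := 108 * (B + 1) / ε with hA
      have hA0 : 0 ≤ A := by positivity
      have h3 : A / s * (ε / 108 * s ^ 3) = (B + 1) * s ^ 2 := by
        rw [hA]
        field_simp
      have h4 : v * (A / s) ^ 2 * ‖C‖ ^ 2 ≤ s ^ 2 := by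
        calc v * (A / s) ^ 2 * ‖C‖ ^ 2 ≤ v * (A / s) ^ 2 * (4 * h * s ^ 2) ^ 2 := by gcongr
          _ = (16 * v * A ^ 2 * h ^ 2) * s ^ 2 := by
            field_simp
            ring
          _ ≤ 1 * s ^ 2 := mul_le_mul_of_nonneg_right hhB (sq_nonneg s)
          _ = s ^ 2 := one_mul _
      have h5 := mul_le_mul_of_nonneg_left h2 (by positivity : 0 ≤ A / s)
      linarith
    · rw [Finset.card_product, Finset.card_univ, Fintype.card_fun, Fintype.card_fin,
        Fintype.card_fin, Nat.cast_mul, Nat.cast_pow, Nat.cast_ofNat]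
      gcongr

end UpperTailCombined

section Reduction

variable {n : ℕ}

theorem card_bitString (ι : Type*) [Fintype ι] [DecidableEq ι] (m : ℕ) :
    (Finset.univ.filter fun g : ι → Bool =>
      (Finset.univ.filter fun e => g e = true).card = m).card = (Fintype.card ι).choose m := by
  rw [← Finset.card_univ (α := ι), ← Finset.card_powersetCard]
  refine Finset.card_bij (fun g _ => Finset.univ.filter fun e => g e = true) ?_ ?_ ?_
  · intro g hg
    exact Finset.mem_powersetCard.2 ⟨Finset.subset_univ _, (Finset.mem_filter.1 hg).2⟩
  · intro g _ g' _ h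
    ext e
    have h' : e ∈ (Finset.univ.filter fun e => g e = true) ↔
        e ∈ (Finset.univ.filter fun e => g' e = true) := by rw [h]
    simp only [Finset.mem_filter, Finset.mem_univ, true_and] at h'
    exact Bool.eq_iff_iff.2 h'
  · intro s hs
    refine ⟨fun e => decide (e ∈ s), ?_, by simp⟩
    simpa using (Finset.mem_powersetCard.1 hs).2

theorem card_edgeIdx (n : ℕ) : Fintype.card (EdgeIdx n) = n.choose 2 := by
  have h := sum_sum_eq_sum_edge (n := n) (fun i j => if i = j then 0 else 1) (by simp)
  have h1 : ∀ e : EdgeIdx n, ((if e.1.1 = e.1.2 then (0 : ℝ) else 1) +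
      if e.1.2 = e.1.1 then 0 else 1) = 2 := fun e => by
    rw [if_neg e.2.ne, if_neg e.2.ne']
    norm_num
  have h2 : ∀ i : Fin n, ∑ j, (if i = j then (0 : ℝ) else 1) = n - 1 := fun i => by
    have : ∀ j, (if i = j then (0 : ℝ) else 1) = 1 - if i = j then 1 else 0 := fun j => by
      split_ifs <;> simp
    simp [this]
  simp only [h1, h2, Finset.sum_const, Finset.card_univ, Fintype.card_fin, nsmul_eq_mul] at h
  have h3 : (Fintype.card (EdgeIdx n) : ℝ) = (n.choose 2 : ℕ) := by
    rw [Nat.cast_choose_two]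
    linarith
  exact_mod_cast h3

theorem card_edgeCount_eq (n m : ℕ) :
    (Finset.univ.filter fun g : EdgeIdx n → Bool => edgeCount g = m).card =
      (n.choose 2).choose m := by
  rw [← card_edgeIdx]
  exact card_bitString (EdgeIdx n) m

theorem sum_adjOf (g : EdgeIdx n → Bool) : ∑ i, ∑ j, adjOf g i j = 2 * edgeCount g := by
  rw [sum_sum_eq_sum_edge _ (adjOf_diag g)]
  have : ∀ e : EdgeIdx n, adjOf g e.1.1 e.1.2 + adjOf g e.1.2 e.1.1 = 2 * bitVal (g e) := fun e => by
    rw [adjOf_symm g e.1.2, adjOf_apply_lt]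
    ring
  simp only [this, ← Finset.mul_sum]
  simp [bitVal, edgeCount]

theorem trace_add_smul_cube (X : Matrix (Fin n) (Fin n) ℝ) (hX : Xᵀ = X) (p : ℝ) :
    let J : Matrix (Fin n) (Fin n) ℝ := Matrix.of fun _ _ => 1
    ((X + p • J) * (X + p • J) * (X + p • J)).trace = (X * X * X).trace +
      3 * p * ∑ i, (∑ j, X i j) ^ 2 + 3 * p ^ 2 * n * ∑ i, ∑ j, X i j + p ^ 3 * n ^ 3 := by
  intro J
  have hs : ∀ i j, X i j = X j i := fun i j => by
    conv_lhs => rw [← hX, Matrix.transpose_apply]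
  have hJJ : J * J = (n : ℝ) • J := by
    ext i j
    simp [J, Matrix.mul_apply]
  have h1 : ∀ Y : Matrix (Fin n) (Fin n) ℝ, (Y * J).trace = ∑ i, ∑ j, Y i j := fun Y => by
    simp [J, Matrix.trace, Matrix.mul_apply]
  have h2 : ∑ i, ∑ j, (X * X) i j = ∑ i, (∑ j, X i j) ^ 2 := by
    simp only [Matrix.mul_apply]
    calc ∑ i, ∑ j, ∑ l, X i l * X l j = ∑ i, ∑ l, ∑ j, X i l * X l j :=
          Finset.sum_congr rfl fun i _ => Finset.sum_comm
      _ = ∑ l, ∑ i, ∑ j, X i l * X l j := Finset.sum_comm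
      _ = _ := by
          refine Finset.sum_congr rfl fun l _ => ?_
          rw [pow_two, Finset.sum_mul_sum]
          simp only [hs _ l]
  have h3 : (J).trace = n := by simp [J, Matrix.trace]
  have e1 : (X * J * X).trace = ∑ i, (∑ j, X i j) ^ 2 := by
    rw [Matrix.trace_mul_comm, ← Matrix.mul_assoc, h1, h2]
  have e2 : (J * X * X).trace = ∑ i, (∑ j, X i j) ^ 2 := by
    rw [Matrix.mul_assoc, Matrix.trace_mul_comm, h1, h2]
  have e3 : (X * X * J).trace = ∑ i, (∑ j, X i j) ^ 2 := by rw [h1, h2]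
  have e4 : (X * J * J).trace = n * ∑ i, ∑ j, X i j := by
    rw [Matrix.mul_assoc, hJJ, Matrix.mul_smul, Matrix.trace_smul, h1, smul_eq_mul]
  have e5 : (J * X * J).trace = n * ∑ i, ∑ j, X i j := by
    rw [Matrix.trace_mul_comm, ← Matrix.mul_assoc, Matrix.trace_mul_comm, hJJ, Matrix.mul_smul,
      Matrix.trace_smul, h1, smul_eq_mul]
  have e6 : (J * J * X).trace = n * ∑ i, ∑ j, X i j := by
    rw [Matrix.trace_mul_comm, hJJ, Matrix.mul_smul, Matrix.trace_smul, h1, smul_eq_mul]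
  have e7 : (J * J * J).trace = n ^ 3 := by
    rw [hJJ, Matrix.smul_mul, hJJ, Matrix.trace_smul, Matrix.trace_smul, h3]
    simp only [smul_eq_mul]
    ring
  simp only [Matrix.add_mul, Matrix.mul_add, Matrix.trace_add, Matrix.smul_mul, Matrix.mul_smul,
    Matrix.trace_smul, smul_eq_mul, e1, e2, e3, e4, e5, e6, e7]
  ring

theorem trace_centeredAdj_cube_le {p C : ℝ} (hp₀ : 0 ≤ p) (hp₁ : p ≤ 1) (hn : 1 ≤ n)
    (g : EdgeIdx n → Bool) (hC : |(edgeCount g : ℝ) - p * (n.choose 2 : ℝ)| ≤ C) :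
    (centeredAdj p g * centeredAdj p g * centeredAdj p g).trace ≤
      (adjOf g * adjOf g * adjOf g).trace - p ^ 3 * n ^ 3 + (7 + 6 * C) * n ^ 2 := by
  set E := centeredAdj p g with hE
  have hn1 : (1 : ℝ) ≤ n := by exact_mod_cast hn
  have hET : Eᵀ = E := by ext i j; rw [Matrix.transpose_apply, hE, centeredAdj_symm]
  set X : Matrix (Fin n) (Fin n) ℝ := E - p • (1 : Matrix (Fin n) (Fin n) ℝ) with hX
  have hA : adjOf g = X + p • (Matrix.of fun _ _ => 1 : Matrix (Fin n) (Fin n) ℝ) := by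
    ext i j
    by_cases h : i = j
    · subst h
      simp [hX, hE, centeredAdj, adjOf_diag]
    · simp [hX, hE, centeredAdj, h]
  have hXT : Xᵀ = X := by simp [hX, hET]
  have h1 := trace_add_smul_cube X hXT p
  simp only [← hA] at h1
  have hsum : ∑ i, ∑ j, X i j = 2 * edgeCount g - p * n ^ 2 := by
    rw [← sum_adjOf, hA]
    simp only [Matrix.add_apply, Matrix.smul_apply, Matrix.of_apply, Finset.sum_add_distrib]
    simp
    ring
  have htrE : E.trace = 0 := by simp [Matrix.trace, hE, centeredAdj_diag]
  have hX3 : (X * X * X).trace = (E * E * E).trace - 3 * p * (E * E).trace - p ^ 3 * n := by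
    simp only [hX, Matrix.sub_mul, Matrix.mul_sub, Matrix.smul_mul, Matrix.mul_smul, Matrix.mul_one,
      Matrix.one_mul, Matrix.trace_sub, Matrix.trace_smul, htrE, Matrix.trace_one, smul_eq_mul,
      Fintype.card_fin]
    ring
  have hE2 : (E * E).trace ≤ n ^ 2 := by
    have : ∀ i j, E i j * E j i ≤ 1 := fun i j => by
      rw [hE, centeredAdj_symm p g j i, ← pow_two, ← sq_abs]
      exact pow_le_one₀ (abs_nonneg _) (abs_centeredAdj_le hp₀ hp₁ g i j)
    calc (E * E).trace = ∑ i, ∑ j, E i j * E j i := by simp [Matrix.trace, Matrix.mul_apply]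
      _ ≤ ∑ _i : Fin n, ∑ _j : Fin n, (1 : ℝ) :=
          Finset.sum_le_sum fun i _ => Finset.sum_le_sum fun j _ => this i j
      _ = n ^ 2 := by simp [pow_two]
  have hsq : 0 ≤ ∑ i, (∑ j, X i j) ^ 2 := Finset.sum_nonneg fun i _ => sq_nonneg _
  have hm : -(n + 2 * C) ≤ 2 * (edgeCount g : ℝ) - p * n ^ 2 := by
    have := (abs_le.1 hC).1
    rw [Nat.cast_choose_two] at this
    nlinarith
  have hC0 : 0 ≤ C := (abs_nonneg _).trans hC
  rw [hsum, hX3] at h1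
  have hp3 : p ^ 3 ≤ 1 := pow_le_one₀ hp₀ hp₁
  have hp2 : p ^ 2 ≤ 1 := pow_le_one₀ hp₀ hp₁
  have f1 : p * (E * E).trace ≤ n ^ 2 := by nlinarith [sq_nonneg (n : ℝ)]
  have f2 : p ^ 3 * n ≤ n ^ 2 := by nlinarith
  have f3 : 3 * p ^ 2 * n * (-(n + 2 * C)) ≤ 3 * p ^ 2 * n * (2 * edgeCount g - p * n ^ 2) :=
    mul_le_mul_of_nonneg_left hm (by positivity)
  have f4 : p ^ 2 * (n * (n + 2 * C)) ≤ 1 * ((1 + 2 * C) * n ^ 2) := by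
    refine mul_le_mul hp2 ?_ (by positivity) zero_le_one
    nlinarith [mul_nonneg hC0 (sub_nonneg.2 hn1)]
  have f5 : 0 ≤ 3 * p * ∑ i, (∑ j, X i j) ^ 2 := by positivity
  linarith

theorem grProb_le {p C : ℝ} (hp₀ : 0 < p) (hp₁ : p < 1) {m : ℕ} (hN : 0 < n.choose 2)
    (hm : m ≤ n.choose 2) (hC : |(m : ℝ) - p * (n.choose 2 : ℝ)| ≤ C)
    (pred : Matrix (Fin n) (Fin n) ℝ → Prop) (bad : Finset (EdgeIdx n → Bool))
    (hbad : ∀ g, g ∈ bad ↔ edgeCount g = m ∧ pred (adjOf g)) :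
    grProb n m pred ≤ (n.choose 2 + 1) * Real.exp (C ^ 2 / (n.choose 2 * (p * (1 - p)))) *
      ∑ g ∈ bad, bernoulliWeight p g := by
  classical
  have hq : 0 < 1 - p := by linarith
  have hN0 : (0 : ℝ) < n.choose 2 := by exact_mod_cast hN
  have hcount : ∑ g ∈ bad, bernoulliWeight p g =
      bad.card * (p ^ m * (1 - p) ^ (n.choose 2 - m)) := by
    rw [← nsmul_eq_mul]
    refine Finset.sum_eq_card_nsmul fun g hg => ?_
    rw [bernoulliWeight_eq p g m ((hbad g).1 hg).1, card_edgeIdx]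
  have hmass := binomial_mass_ge hp₀ hp₁ hN hm
  have hch : (0 : ℝ) < (n.choose 2).choose m := by exact_mod_cast Nat.choose_pos hm
  have hexp : Real.exp (-(C ^ 2 / (n.choose 2 * (p * (1 - p))))) ≤
      (n.choose 2 + 1) * ((n.choose 2).choose m * (p ^ m * (1 - p) ^ (n.choose 2 - m))) := by
    refine le_trans ?_ hmass
    rw [Real.exp_le_exp, neg_le_neg_iff]
    refine div_le_div_of_nonneg_right ?_ (by positivity)
    rw [← sq_abs]
    exact pow_le_pow_left₀ (abs_nonneg _) hC 2
  have hgr : grProb n m pred = bad.card / (n.choose 2).choose m := by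
    unfold grProb
    rw [card_edgeCount_eq]
    congr 3
    ext g
    rw [hbad]
    simp
  rw [hgr, hcount, div_le_iff₀ hch]
  have h1 : 1 ≤ Real.exp (C ^ 2 / (n.choose 2 * (p * (1 - p)))) * ((n.choose 2 + 1) *
      ((n.choose 2).choose m * (p ^ m * (1 - p) ^ (n.choose 2 - m)))) := by
    calc (1 : ℝ) = Real.exp (C ^ 2 / (n.choose 2 * (p * (1 - p)))) *
          Real.exp (-(C ^ 2 / (n.choose 2 * (p * (1 - p))))) := by
          rw [← Real.exp_add, add_neg_cancel, Real.exp_zero]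
      _ ≤ _ := by gcongr
  calc (bad.card : ℝ) = bad.card * 1 := (mul_one _).symm
    _ ≤ bad.card * (Real.exp (C ^ 2 / (n.choose 2 * (p * (1 - p)))) * ((n.choose 2 + 1) *
      ((n.choose 2).choose m * (p ^ m * (1 - p) ^ (n.choose 2 - m))))) := by gcongr
    _ = _ := by ring

end Reduction

section UpperBound

variable {n : ℕ}

theorem trace_centeredAdj_cube_le_of_triDensity_le {p C t : ℝ} (hp₀ : 0 ≤ p) (hp₁ : p ≤ 1)
    (hn : 3 ≤ n) (ht₀ : 0 ≤ t) (ht₁ : t ≤ 1) (g : EdgeIdx n → Bool)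
    (hC : |(edgeCount g : ℝ) - p * (n.choose 2 : ℝ)| ≤ C)
    (hg : triDensity (adjOf g) ≤ p ^ 3 - t) :
    (centeredAdj p g * centeredAdj p g * centeredAdj p g).trace ≤
      -(t * n ^ 3) + (10 + 6 * C) * n ^ 2 := by
  have h1 := trace_centeredAdj_cube_le hp₀ hp₁ (by omega) g hC
  have hn3 : (3 : ℝ) ≤ n := by exact_mod_cast hn
  have hden : (0 : ℝ) < n * (n - 1) * (n - 2) :=
    mul_pos (mul_pos (by linarith) (by linarith)) (by linarith)
  rw [triDensity, div_le_iff₀ hden] at hg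
  have h2 : (n : ℝ) * (n - 1) * (n - 2) ≤ n ^ 3 := by nlinarith
  have h3 : p ^ 3 * ((n : ℝ) * (n - 1) * (n - 2)) ≤ p ^ 3 * n ^ 3 :=
    mul_le_mul_of_nonneg_left h2 (by positivity)
  have h4 : t * (n ^ 3 - 3 * n ^ 2) ≤ t * ((n : ℝ) * (n - 1) * (n - 2)) := by
    refine mul_le_mul_of_nonneg_left ?_ ht₀
    nlinarith
  have h5 : t * (n : ℝ) ^ 2 ≤ 1 * n ^ 2 := mul_le_mul_of_nonneg_right ht₁ (sq_nonneg _)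
  linarith

theorem grProb_triDensity_le {p v C t : ℝ} (hp₀ : 0 < p) (hp₁ : p < 1) (hv₀ : 0 < v)
    (hv : ∀ x : ℝ, p * Real.exp (x * (1 - p)) + (1 - p) * Real.exp (x * (0 - p)) ≤
      Real.exp (v * x ^ 2 / 2))
    {m : ℕ} (hn : 3 ≤ n) (hm : m ≤ n.choose 2)
    (hC : |(m : ℝ) - p * (n.choose 2 : ℝ)| ≤ C) (hCn : C ^ 2 / (n.choose 2 * (p * (1 - p))) ≤ n)
    (ht₁ : t ≤ 1)
    {ε h s b B L : ℝ} (hε : 0 < ε) (hε1 : ε ≤ 1 / 2) (hh : 0 < h) (hhε : 1296 * h ≤ ε) (hs : 0 < s)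
    (hst : s ^ 3 = t * n ^ 3) (hsn : s ≤ n)
    (hbB : b ≤ B) (hB : 0 ≤ B) (hb : b ≤ ((1 - h) * (1 - ε)) ^ 2 / (4 * v))
    (hhB : 16 * v * (108 * (B + 1) / ε) ^ 2 * h ^ 2 ≤ 1)
    (hL : 6 / h ≤ Real.exp L) (hL₀ : 0 ≤ L)
    (hns : n * √n ≤ h * s ^ 2) (hkn : (n : ℝ) ^ 2 / (h ^ 2 * s ^ 2) + 1 ≤ n)
    (hεs : (10 + 6 * C) * n ^ 2 ≤ ε * s ^ 3) :
    grProb n m (fun A => triDensity A ≤ p ^ 3 - t) ≤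
      Real.exp (6 * n + 2 * L * (n * (n ^ 2 / (h ^ 2 * s ^ 2) + 1)) - b * s ^ 2) := by
  classical
  have hn3 : (3 : ℝ) ≤ n := by exact_mod_cast hn
  have hnpos : (0 : ℝ) < n := by linarith
  have ht₀ : 0 ≤ t := by
    have : 0 < t * (n : ℝ) ^ 3 := hst ▸ (by positivity)
    exact (pos_of_mul_pos_left this (by positivity)).le
  have hh1 : h ≤ 1 := by linarith
  set k := ⌈(n : ℝ) ^ 2 / (h ^ 2 * s ^ 2)⌉₊ with hk
  have hk1 : (n : ℝ) ^ 2 / (h ^ 2 * s ^ 2) ≤ k := Nat.le_ceil _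
  have hk2 : (k : ℝ) ≤ (n : ℝ) ^ 2 / (h ^ 2 * s ^ 2) + 1 := (Nat.ceil_lt_add_one (by positivity)).le
  have hk0 : (0 : ℝ) < k := lt_of_lt_of_le (by positivity) hk1
  have hkn' : k ≤ n := by exact_mod_cast hk2.trans hkn
  set κ := s / √k with hκ
  have hsk : n / (h * s) ≤ √k := by
    refine Real.le_sqrt_of_sq_le ?_
    rwa [div_pow, mul_pow]
  have hκn : κ * n ≤ h * s ^ 2 := by
    rw [hκ, div_mul_eq_mul_div, div_le_iff₀ (Real.sqrt_pos.2 hk0)]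
    calc s * n = h * s ^ 2 * (n / (h * s)) := by field_simp
      _ ≤ _ := by gcongr
  have hκs : κ ≤ h * s := by
    refine le_of_mul_le_mul_right ?_ hnpos
    calc κ * n ≤ h * s ^ 2 := hκn
      _ = h * s * s := by ring
      _ ≤ h * s * n := by gcongr
  have hkκ : s ^ 2 ≤ k * κ ^ 2 := by
    rw [hκ, div_pow, Real.sq_sqrt hk0.le]
    exact le_of_eq (by field_simp)
  set bad : Finset (EdgeIdx n → Bool) := Finset.univ.filter fun g =>
    edgeCount g = m ∧ triDensity (adjOf g) ≤ p ^ 3 - t with hbad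
  have hN : 0 < n.choose 2 := Nat.choose_pos (by omega)
  have h1 := grProb_le hp₀ hp₁ hN hm hC (fun A => triDensity A ≤ p ^ 3 - t) bad
    (fun g => by simp [hbad])
  have h2 := sum_bernoulliWeight_trace_cube_le hp₀.le hp₁.le hv₀ hv hkn' hε hε1 hh hhε hs hB hhB
    (by positivity) hkκ hκn hκs hns bad (by
      intro g hg
      obtain ⟨hg1, hg2⟩ := (Finset.mem_filter.1 hg).2
      refine (trace_centeredAdj_cube_le_of_triDensity_le hp₀.le hp₁.le hn ht₀ ht₁ g (hg1 ▸ hC)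
        hg2).trans ?_
      rw [← hst]
      linarith)
  have hN2 : ((n.choose 2 : ℕ) : ℝ) + 1 ≤ Real.exp (2 * n) := by
    rw [Nat.cast_choose_two, two_mul, Real.exp_add]
    have := Real.add_one_le_exp (n : ℝ)
    nlinarith
  have hb1 : Real.exp (-(((1 - h) * ((1 - ε) * s)) ^ 2 / (4 * v))) ≤ Real.exp (-(b * s ^ 2)) := by
    rw [Real.exp_le_exp, neg_le_neg_iff]
    calc b * s ^ 2 ≤ ((1 - h) * (1 - ε)) ^ 2 / (4 * v) * s ^ 2 := by gcongr
      _ = _ := by ring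
  have hb2 : Real.exp (-(B * s ^ 2)) ≤ Real.exp (-(b * s ^ 2)) := by
    rw [Real.exp_le_exp, neg_le_neg_iff]
    gcongr
  have hpow : (6 / h) ^ (2 * n * k) ≤
      Real.exp (2 * L * (n * (n ^ 2 / (h ^ 2 * s ^ 2) + 1))) := by
    calc (6 / h) ^ (2 * n * k) ≤ Real.exp L ^ (2 * n * k) := by gcongr
      _ = Real.exp (2 * L * (n * k)) := by
        rw [← Real.exp_nat_mul]
        congr 1
        push_cast
        ring
      _ ≤ _ := by gcongr
  have h3 : (1 : ℝ) + 3 ^ n ≤ Real.exp (3 * n) := by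
    have e1 : (4 : ℝ) ≤ Real.exp 3 := by linarith [Real.add_one_le_exp (3 : ℝ)]
    calc (1 : ℝ) + 3 ^ n ≤ 4 ^ n := by
          have := pow_add_pow_le (show (0 : ℝ) ≤ 1 by norm_num) (show (0 : ℝ) ≤ 3 by norm_num)
            (show n ≠ 0 by omega)
          norm_num at this
          linarith
      _ ≤ Real.exp 3 ^ n := by gcongr
      _ = Real.exp (3 * n) := by rw [← Real.exp_nat_mul, mul_comm]
  calc _ ≤ _ := h1
    _ ≤ Real.exp (2 * n) * Real.exp n * ((6 / h) ^ (2 * n * k) * Real.exp (-(b * s ^ 2)) +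
          3 ^ n * (6 / h) ^ (2 * n * k) * Real.exp (-(b * s ^ 2))) := by
        refine mul_le_mul (mul_le_mul hN2 (Real.exp_le_exp.2 hCn) (by positivity) (by positivity))
          (h2.trans (by gcongr)) ?_ (by positivity)
        exact Finset.sum_nonneg fun g _ => bernoulliWeight_nonneg hp₀.le hp₁.le g
    _ = Real.exp (2 * n) * Real.exp n * ((1 + 3 ^ n) * ((6 / h) ^ (2 * n * k) *
          Real.exp (-(b * s ^ 2)))) := by ring
    _ ≤ Real.exp (2 * n) * Real.exp n * (Real.exp (3 * n) *
          (Real.exp (2 * L * (n * (n ^ 2 / (h ^ 2 * s ^ 2) + 1))) * Real.exp (-(b * s ^ 2)))) := by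
        gcongr
    _ = _ := by
        simp only [← Real.exp_add]
        congr 1
        ring

end UpperBound

section UpperAsymptotics

theorem eventually_scale {t : ℕ → ℝ}
    (ht₁ : Tendsto (fun n : ℕ => (n : ℝ) ^ ((3 : ℝ) / 4) * t n) atTop atTop) (K : ℝ) :
    ∀ᶠ n : ℕ in atTop, 0 < t n ∧ K ≤ n ∧ K ≤ t n * n ∧ K ≤ √n * t n ^ ((2 : ℝ) / 3) := by
  have h1 := ht₁.eventually_gt_atTop 0
  have h2 := ht₁.eventually_ge_atTop K
  have h3 := ((tendsto_rpow_atTop (show (0 : ℝ) < 2 / 3 by norm_num)).comp ht₁).eventually_ge_atTop K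
  have h4 := tendsto_natCast_atTop_atTop (R := ℝ) |>.eventually_ge_atTop K
  filter_upwards [h1, h2, h3, h4, eventually_ge_atTop 1] with n h1 h2 h3 h4 h5
  have hn : (1 : ℝ) ≤ n := by exact_mod_cast h5
  have ht : 0 < t n := by
    by_contra h
    exact absurd h1 (not_lt.2 (mul_nonpos_of_nonneg_of_nonpos (by positivity) (not_lt.1 h)))
  refine ⟨ht, h4, h2.trans ?_, h3.trans (le_of_eq ?_)⟩
  · rw [mul_comm]
    refine mul_le_mul_of_nonneg_left ?_ ht.le
    exact Real.rpow_le_self_of_one_le hn (by norm_num)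
  · simp only [Function.comp]
    rw [Real.mul_rpow (by positivity) ht.le, ← Real.rpow_mul (by positivity), Real.sqrt_eq_rpow]
    norm_num

theorem rpow_third_mul_pow {t x : ℝ} (ht : 0 ≤ t) :
    (t ^ ((1 : ℝ) / 3) * x) ^ 3 = t * x ^ 3 ∧
      (t ^ ((1 : ℝ) / 3) * x) ^ 2 = t ^ ((2 : ℝ) / 3) * x ^ 2 := by
  constructor
  · rw [mul_pow, ← Real.rpow_natCast, ← Real.rpow_mul ht]
    norm_num
  · rw [mul_pow, ← Real.rpow_natCast (t ^ ((1 : ℝ) / 3)) 2, ← Real.rpow_mul ht]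
    norm_num

theorem eventually_edges_le {p C : ℝ} (hp₁ : p < 1) {m : ℕ → ℕ}
    (hm : ∀ n : ℕ, |(m n : ℝ) - p * (n.choose 2 : ℝ)| ≤ C) :
    ∀ᶠ n : ℕ in atTop, m n ≤ n.choose 2 := by
  have h4 := tendsto_natCast_atTop_atTop (R := ℝ) |>.eventually_ge_atTop (2 * C / (1 - p) + 2)
  have hq : 0 < 1 - p := by linarith
  filter_upwards [h4] with n hn
  have h1 := (abs_le.1 (hm n)).2
  have hC0 : 0 ≤ C := (abs_nonneg _).trans (hm n)
  have h2 : C ≤ (1 - p) * (n.choose 2 : ℝ) := by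
    have h3 : 0 ≤ 2 * C / (1 - p) := by positivity
    have h5 : C / (1 - p) ≤ (n.choose 2 : ℝ) := by
      rw [Nat.cast_choose_two]
      have : 2 * C / (1 - p) = 2 * (C / (1 - p)) := by ring
      nlinarith
    rw [div_le_iff₀ hq] at h5
    linarith
  have : (m n : ℝ) ≤ (n.choose 2 : ℕ) := by linarith
  exact_mod_cast this

set_option maxHeartbeats 400000 in
theorem eventually_grProb_le {p v C δ : ℝ} (hp₀ : 0 < p) (hp₁ : p < 1) (hv₀ : 0 < v)
    (hv : ∀ x : ℝ, p * Real.exp (x * (1 - p)) + (1 - p) * Real.exp (x * (0 - p)) ≤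
      Real.exp (v * x ^ 2 / 2))
    {m : ℕ → ℕ} (hm : ∀ n : ℕ, |(m n : ℝ) - p * (n.choose 2 : ℝ)| ≤ C) {t : ℕ → ℝ}
    (ht₁ : Tendsto (fun n : ℕ => (n : ℝ) ^ ((3 : ℝ) / 4) * t n) atTop atTop)
    (ht₂ : Tendsto t atTop (nhds 0)) (hδ : 0 < δ) :
    ∀ᶠ n : ℕ in atTop, grProb n (m n) (fun A => triDensity A ≤ p ^ 3 - t n) ≤
      Real.exp ((-(1 / (4 * v)) + δ) * (t n ^ ((2 : ℝ) / 3) * (n : ℝ) ^ 2)) := by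
  have hC0 : 0 ≤ C := (abs_nonneg _).trans (hm 0)
  have hq : 0 < 1 - p := by linarith
  set B := 1 / (4 * v) with hBdef
  have hB : 0 < B := by positivity
  obtain ⟨ε, hε, hε1, hεδ⟩ : ∃ ε : ℝ, 0 < ε ∧ ε ≤ 1 / 2 ∧ 4 * ε * B ≤ δ / 2 := by
    refine ⟨min (1 / 2) (δ / (8 * B)), by positivity, min_le_left _ _, ?_⟩
    have : min (1 / 2) (δ / (8 * B)) ≤ δ / (8 * B) := min_le_right _ _
    rw [le_div_iff₀ (by positivity)] at this
    linarith
  set A := 108 * (B + 1) / ε with hA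
  have hA0 : 0 < A := by positivity
  obtain ⟨h, hh, hhε, hhA⟩ : ∃ h : ℝ, 0 < h ∧ 1296 * h ≤ ε ∧ h * (4 * (1 + v) * A) ≤ 1 := by
    refine ⟨min (ε / 1296) (1 / (4 * (1 + v) * A)), by positivity, ?_, ?_⟩
    · have : min (ε / 1296) (1 / (4 * (1 + v) * A)) ≤ ε / 1296 := min_le_left _ _
      linarith
    · have : min (ε / 1296) (1 / (4 * (1 + v) * A)) ≤ 1 / (4 * (1 + v) * A) := min_le_right _ _
      rwa [le_div_iff₀ (by positivity)] at this
  have hhB : 16 * v * (108 * (B + 1) / ε) ^ 2 * h ^ 2 ≤ 1 := by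
    have h1 : (h * (4 * (1 + v) * A)) ^ 2 ≤ 1 := pow_le_one₀ (by positivity) hhA
    have h2 : v ≤ (1 + v) ^ 2 := by nlinarith
    have h3 : 16 * v * A ^ 2 * h ^ 2 ≤ (h * (4 * (1 + v) * A)) ^ 2 := by
      calc 16 * v * A ^ 2 * h ^ 2 = v * (16 * A ^ 2 * h ^ 2) := by ring
        _ ≤ (1 + v) ^ 2 * (16 * A ^ 2 * h ^ 2) := mul_le_mul_of_nonneg_right h2 (by positivity)
        _ = _ := by ring
    exact h3.trans h1
  have hh1 : h ≤ 1 := by linarith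
  set L := Real.log (6 / h) with hL
  have hL0 : 0 ≤ L := Real.log_nonneg (by rw [le_div_iff₀ hh]; linarith)
  have hLexp : 6 / h ≤ Real.exp L := (Real.exp_log (by positivity)).ge
  set b := B - δ / 2 with hb
  have hbB : b ≤ ((1 - h) * (1 - ε)) ^ 2 / (4 * v) := by
    have h1 : (1 - 4 * ε) ≤ ((1 - h) * (1 - ε)) ^ 2 := by
      have : 1 - 2 * ε ≤ (1 - h) * (1 - ε) := by nlinarith
      nlinarith
    have h2 : ((1 - h) * (1 - ε)) ^ 2 / (4 * v) = ((1 - h) * (1 - ε)) ^ 2 * B := by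
      rw [hBdef]; ring
    rw [h2, hb]
    nlinarith
  set K := 4 + 1 / h ^ 2 + 2 * (6 + 4 * L) / δ + (10 + 6 * C) / ε + C ^ 2 / (p * (1 - p)) with hK
  have k1 : 0 ≤ 1 / h ^ 2 := by positivity
  have k2 : 0 ≤ 2 * (6 + 4 * L) / δ := by positivity
  have k3 : 0 ≤ (10 + 6 * C) / ε := by positivity
  have k4 : 0 ≤ C ^ 2 / (p * (1 - p)) := by positivity
  filter_upwards [eventually_scale ht₁ K, eventually_edges_le hp₁ hm,
    ht₂.eventually_le_const (show (0 : ℝ) < 1 by norm_num)] with n hn hmn ht1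
  obtain ⟨ht0, hnK, htn, hw⟩ := hn
  have hn4 : (4 : ℝ) ≤ n := by linarith
  have hn0 : (0 : ℝ) < n := by linarith
  have hn3 : 3 ≤ n := by
    have : (3 : ℝ) ≤ n := by linarith
    exact_mod_cast this
  set s := t n ^ ((1 : ℝ) / 3) * n with hs
  obtain ⟨hs3, hs2⟩ := rpow_third_mul_pow (x := n) ht0.le
  rw [← hs] at hs3 hs2
  have hs0 : 0 < s := by positivity
  set w := √n * t n ^ ((2 : ℝ) / 3) with hwdef
  set r := √(n : ℝ) with hr
  have hrn : r * r = n := Real.mul_self_sqrt hn0.le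
  have hr0 : 0 < r := Real.sqrt_pos.2 hn0
  have hr2 : 2 ≤ r := Real.le_sqrt_of_sq_le (by linarith)
  have hsw : s ^ 2 = n * r * w := by
    rw [hs2, hwdef]
    linear_combination (-(n : ℝ) * t n ^ ((2 : ℝ) / 3)) * hrn
  have hw1 : 1 ≤ h ^ 2 * w := by
    have : 1 / h ^ 2 ≤ w := by linarith
    rwa [div_le_iff₀ (by positivity), mul_comm] at this
  have hw0 : 0 < w := by linarith
  have hns : n * r ≤ h * s ^ 2 := by
    have : 1 ≤ h * w := hw1.trans (mul_le_mul_of_nonneg_right (pow_le_of_le_one hh.le hh1 two_ne_zero) hw0.le)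
    rw [hsw]
    calc (n : ℝ) * r = n * r * 1 := (mul_one _).symm
      _ ≤ n * r * (h * w) := mul_le_mul_of_nonneg_left this (by positivity)
      _ = _ := by ring
  have hq1 : (n : ℝ) ^ 2 / (h ^ 2 * s ^ 2) ≤ r := by
    rw [div_le_iff₀ (by positivity), hsw]
    calc (n : ℝ) ^ 2 = n * (r * r) * 1 := by rw [hrn]; ring
      _ ≤ n * (r * r) * (h ^ 2 * w) := mul_le_mul_of_nonneg_left hw1 (by positivity)
      _ = _ := by ring
  have hkn : (n : ℝ) ^ 2 / (h ^ 2 * s ^ 2) + 1 ≤ n := by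
    have : 2 * r ≤ r * r := mul_le_mul_of_nonneg_right hr2 hr0.le
    linarith
  have hsn : s ≤ n := by
    have : t n ^ ((1 : ℝ) / 3) ≤ 1 := Real.rpow_le_one ht0.le ht1 (by norm_num)
    exact mul_le_of_le_one_left hn0.le this
  have hεs : (10 + 6 * C) * (n : ℝ) ^ 2 ≤ ε * s ^ 3 := by
    have : (10 + 6 * C) / ε ≤ t n * n := by linarith
    rw [div_le_iff₀ hε] at this
    rw [hs3]
    calc (10 + 6 * C) * (n : ℝ) ^ 2 ≤ t n * n * ε * (n : ℝ) ^ 2 :=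
          mul_le_mul_of_nonneg_right this (sq_nonneg _)
      _ = _ := by ring
  have hN1 : (1 : ℝ) ≤ (n.choose 2 : ℝ) := by
    rw [Nat.cast_choose_two, le_div_iff₀ (by norm_num)]
    nlinarith only [hn4]
  have hCn : C ^ 2 / (n.choose 2 * (p * (1 - p))) ≤ n := by
    have h1 : C ^ 2 / (n.choose 2 * (p * (1 - p))) ≤ C ^ 2 / (p * (1 - p)) := by
      refine div_le_div_of_nonneg_left (by positivity) (by positivity) ?_
      exact le_mul_of_one_le_left (by positivity) hN1
    linarith
  refine (grProb_triDensity_le hp₀ hp₁ hv₀ hv hn3 hmn (hm n) hCn ht1 hε hε1 hh hhε hs0 hs3 hsn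
    (b := b) (B := B) (by rw [hb]; linarith) hB.le hbB hhB hLexp hL0 hns hkn hεs).trans ?_
  refine Real.exp_le_exp.2 ?_
  rw [← hs2]
  have hn_nr : (n : ℝ) ≤ n * r := le_mul_of_one_le_right hn0.le (by linarith)
  have h1 : L * (n * ((n : ℝ) ^ 2 / (h ^ 2 * s ^ 2) + 1)) ≤ L * (2 * (n * r)) :=
    by
    refine mul_le_mul_of_nonneg_left ?_ hL0
    calc (n : ℝ) * ((n : ℝ) ^ 2 / (h ^ 2 * s ^ 2) + 1) ≤ n * (2 * r) :=
          mul_le_mul_of_nonneg_left (by linarith) hn0.le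
      _ = _ := by ring
  have h2 : (6 + 4 * L) * (n * r) ≤ δ / 2 * s ^ 2 := by
    have : 2 * (6 + 4 * L) / δ ≤ w := by linarith
    rw [div_le_iff₀ hδ] at this
    rw [hsw]
    calc (6 + 4 * L) * (n * r) = 2 * (6 + 4 * L) * (n * r / 2) := by ring
      _ ≤ w * δ * (n * r / 2) := mul_le_mul_of_nonneg_right this (by positivity)
      _ = _ := by ring
  rw [hb]
  linarith

end UpperAsymptotics

section FixedSizeSubsets

theorem descFactorial_mul_pow_le {N m : ℕ} (h : m ≤ N) (j : ℕ) :
    m.descFactorial j * N ^ j ≤ N.descFactorial j * m ^ j := by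
  induction j with
  | zero => simp
  | succ j ih =>
    rw [Nat.descFactorial_succ, Nat.descFactorial_succ, pow_succ, pow_succ]
    have h1 : (m - j) * N ≤ (N - j) * m := by
      rw [Nat.sub_mul, Nat.sub_mul, Nat.mul_comm N m]
      exact Nat.sub_le_sub_left (Nat.mul_le_mul_left _ h) _
    calc (m - j) * m.descFactorial j * (N ^ j * N)
        = ((m - j) * N) * (m.descFactorial j * N ^ j) := by ring
      _ ≤ ((N - j) * m) * (N.descFactorial j * m ^ j) := Nat.mul_le_mul h1 ih
      _ = _ := by ring

theorem choose_sub_mul_pow_le {N m j : ℕ} (h : m ≤ N) (hj : j ≤ m) :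
    (N - j).choose (m - j) * N ^ j ≤ N.choose m * m ^ j := by
  have h1 := Nat.choose_mul (n := N) hj
  have h2 := descFactorial_mul_pow_le h j
  rw [Nat.descFactorial_eq_factorial_mul_choose, Nat.descFactorial_eq_factorial_mul_choose,
    Nat.mul_assoc, Nat.mul_assoc] at h2
  have h3 := Nat.le_of_mul_le_mul_left h2 (Nat.factorial_pos j)
  have hpos : 0 < N.choose j := Nat.choose_pos (hj.trans h)
  refine Nat.le_of_mul_le_mul_left ?_ hpos
  calc N.choose j * ((N - j).choose (m - j) * N ^ j)
      = N.choose m * (m.choose j * N ^ j) := by rw [← Nat.mul_assoc, ← h1, Nat.mul_assoc]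
    _ ≤ N.choose m * (N.choose j * m ^ j) := Nat.mul_le_mul_left _ h3
    _ = _ := by ring

variable {ι : Type*} [DecidableEq ι]

theorem card_powersetCard_filter_superset_le {U T : Finset ι} (hT : T ⊆ U) {m : ℕ}
    (hm : m ≤ U.card) :
    ((U.powersetCard m).filter fun S => T ⊆ S).card * (U.card : ℝ) ^ T.card ≤
      (U.card.choose m : ℝ) * (m : ℝ) ^ T.card := by
  by_cases hTm : T.card ≤ m
  · have h1 : ((U.powersetCard m).filter fun S => T ⊆ S).card ≤
        (U.card - T.card).choose (m - T.card) := by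
      rw [← Finset.card_sdiff_of_subset hT, ← Finset.card_powersetCard]
      refine Finset.card_le_card_of_injOn (fun S => S \ T) ?_ ?_
      · intro S hS
        obtain ⟨hS, hTS⟩ := Finset.mem_filter.1 hS
        obtain ⟨hSU, hSm⟩ := Finset.mem_powersetCard.1 hS
        refine Finset.mem_powersetCard.2 ⟨Finset.sdiff_subset_sdiff hSU subset_rfl, ?_⟩
        rw [Finset.card_sdiff_of_subset hTS, hSm]
      · intro S hS S' hS' h
        have h1 := (Finset.mem_filter.1 hS).2
        have h2 := (Finset.mem_filter.1 hS').2
        simp only at h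
        rw [← Finset.sdiff_union_of_subset h1, h, Finset.sdiff_union_of_subset h2]
    have h2 := (Nat.mul_le_mul_right (U.card ^ T.card) h1).trans (choose_sub_mul_pow_le hm hTm)
    exact_mod_cast h2
  · have : ((U.powersetCard m).filter fun S => T ⊆ S) = ∅ := by
      refine Finset.filter_eq_empty_iff.2 fun S hS hTS => hTm ?_
      rw [← (Finset.mem_powersetCard.1 hS).2]
      exact Finset.card_le_card hTS
    rw [this]
    simp only [Finset.card_empty, Nat.cast_zero, zero_mul]
    positivity

theorem card_powersetCard_filter_superset_le_density {U T : Finset ι} (hT : T ⊆ U) {m : ℕ}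
    (hm : m ≤ U.card) :
    (((U.powersetCard m).filter fun S => T ⊆ S).card : ℝ) ≤
      (U.card.choose m : ℝ) * ((m : ℝ) / U.card) ^ T.card := by
  rcases T.eq_empty_or_nonempty with rfl | hne
  · simp
  · have : (0 : ℝ) < U.card := by exact_mod_cast (hne.mono hT).card_pos
    rw [div_pow, ← mul_div_assoc, le_div_iff₀ (by positivity)]
    exact card_powersetCard_filter_superset_le hT hm

/-- Pairs consisting of an `m₁`-subset of `I` and an `m₂`-subset of its complement. -/
def blockSets [Fintype ι] (I : Finset ι) (m₁ m₂ : ℕ) : Finset (Finset ι × Finset ι) :=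
  I.powersetCard m₁ ×ˢ Iᶜ.powersetCard m₂

theorem card_blockSets [Fintype ι] (I : Finset ι) (m₁ m₂ : ℕ) :
    (blockSets I m₁ m₂).card = I.card.choose m₁ * Iᶜ.card.choose m₂ := by
  rw [blockSets, Finset.card_product, Finset.card_powersetCard, Finset.card_powersetCard]

theorem card_blockSets_filter_superset_le [Fintype ι] (I : Finset ι) {m₁ m₂ : ℕ}
    (h₁ : m₁ ≤ I.card) (h₂ : m₂ ≤ Iᶜ.card) (T : Finset ι) :
    (((blockSets I m₁ m₂).filter fun S => T ⊆ S.1 ∪ S.2).card : ℝ) ≤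
      (blockSets I m₁ m₂).card *
        ∏ e ∈ T, if e ∈ I then (m₁ : ℝ) / I.card else (m₂ : ℝ) / Iᶜ.card := by
  have hsub : (blockSets I m₁ m₂).filter (fun S => T ⊆ S.1 ∪ S.2) ⊆
      ((I.powersetCard m₁).filter fun S => T ∩ I ⊆ S) ×ˢ
        ((Iᶜ.powersetCard m₂).filter fun S => T ∩ Iᶜ ⊆ S) := by
    intro S hS
    simp only [blockSets, Finset.mem_filter, Finset.mem_product, Finset.mem_powersetCard] at hS ⊢
    obtain ⟨⟨⟨a1, a2⟩, a3, a4⟩, a5⟩ := hS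
    refine ⟨⟨⟨a1, a2⟩, fun e he => ?_⟩, ⟨a3, a4⟩, fun e he => ?_⟩
    · obtain ⟨heT, heI⟩ := Finset.mem_inter.1 he
      rcases Finset.mem_union.1 (a5 heT) with h | h
      · exact h
      · exact absurd heI (Finset.mem_compl.1 (a3 h))
    · obtain ⟨heT, heI⟩ := Finset.mem_inter.1 he
      rcases Finset.mem_union.1 (a5 heT) with h | h
      · exact absurd (a1 h) (Finset.mem_compl.1 heI)
      · exact h
  have h3 : ∏ e ∈ T, (if e ∈ I then (m₁ : ℝ) / I.card else (m₂ : ℝ) / Iᶜ.card) =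
      ((m₁ : ℝ) / I.card) ^ (T ∩ I).card * ((m₂ : ℝ) / Iᶜ.card) ^ (T ∩ Iᶜ).card := by
    rw [Finset.prod_ite, Finset.prod_const, Finset.prod_const, Finset.filter_mem_eq_inter]
    congr 3
    ext e
    simp
  have h4 := Finset.card_le_card hsub
  rw [Finset.card_product] at h4
  calc (((blockSets I m₁ m₂).filter fun S => T ⊆ S.1 ∪ S.2).card : ℝ)
      ≤ (((I.powersetCard m₁).filter fun S => T ∩ I ⊆ S).card : ℝ) *
        ((Iᶜ.powersetCard m₂).filter fun S => T ∩ Iᶜ ⊆ S).card := by exact_mod_cast h4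
    _ ≤ ((I.card.choose m₁ : ℝ) * ((m₁ : ℝ) / I.card) ^ (T ∩ I).card) *
        ((Iᶜ.card.choose m₂ : ℝ) * ((m₂ : ℝ) / Iᶜ.card) ^ (T ∩ Iᶜ).card) :=
        mul_le_mul
          (card_powersetCard_filter_superset_le_density Finset.inter_subset_right h₁)
          (card_powersetCard_filter_superset_le_density Finset.inter_subset_right h₂)
          (by positivity) (by positivity)
    _ = _ := by
        rw [h3, card_blockSets]
        push_cast
        ring

end FixedSizeSubsets

section Planted

variable {n : ℕ}

/-- The indicator bit string of the union of a pair of edge sets. -/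
def pairGraph (S : Finset (EdgeIdx n) × Finset (EdgeIdx n)) : EdgeIdx n → Bool :=
  fun e => decide (e ∈ S.1 ∪ S.2)

/-- The edge joining two distinct vertices. -/
def edgeOf (i j : Fin n) (h : i ≠ j) : EdgeIdx n :=
  if hij : i < j then ⟨(i, j), hij⟩ else ⟨(j, i), lt_of_le_of_ne (not_lt.1 hij) h.symm⟩

theorem edgeOf_eq_iff {i j k l : Fin n} (h : i ≠ j) (h' : k ≠ l) (he : edgeOf i j h = edgeOf k l h') :
    (i = k ∧ j = l) ∨ (i = l ∧ j = k) := by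
  unfold edgeOf at he
  split_ifs at he <;> simp only [Subtype.mk.injEq, Prod.mk.injEq] at he <;> tauto

theorem adjOf_eq_bitVal (g : EdgeIdx n → Bool) {i j : Fin n} (h : i ≠ j) :
    adjOf g i j = bitVal (g (edgeOf i j h)) := by
  unfold edgeOf
  split_ifs with hij
  · exact adjOf_apply_lt g ⟨(i, j), hij⟩
  · rw [adjOf_symm]
    exact adjOf_apply_lt g ⟨(j, i), _⟩

theorem sum_blockSets_trace_le (I : Finset (EdgeIdx n)) {m₁ m₂ : ℕ}
    (h₁ : m₁ ≤ I.card) (h₂ : m₂ ≤ Iᶜ.card) (P : Matrix (Fin n) (Fin n) ℝ)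
    (hP0 : ∀ i j, 0 ≤ P i j)
    (hP : ∀ i j (h : i ≠ j), (if edgeOf i j h ∈ I then (m₁ : ℝ) / I.card
      else (m₂ : ℝ) / Iᶜ.card) = P i j) :
    ∑ S ∈ blockSets I m₁ m₂,
      (adjOf (pairGraph S) * adjOf (pairGraph S) * adjOf (pairGraph S)).trace ≤
      (blockSets I m₁ m₂).card * ∑ i, ∑ j, ∑ k, P i j * P j k * P k i := by
  have htr : ∀ A : Matrix (Fin n) (Fin n) ℝ,
      (A * A * A).trace = ∑ i, ∑ j, ∑ k, A i j * A j k * A k i := fun A => by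
    simp only [Matrix.trace, Matrix.diag, Matrix.mul_apply, Finset.sum_mul]
    refine Finset.sum_congr rfl fun i _ => Finset.sum_comm
  simp only [htr, Finset.mul_sum]
  rw [Finset.sum_comm]
  refine Finset.sum_le_sum fun i _ => ?_
  rw [Finset.sum_comm]
  refine Finset.sum_le_sum fun j _ => ?_
  rw [Finset.sum_comm]
  refine Finset.sum_le_sum fun k _ => ?_
  have hR : 0 ≤ ((blockSets I m₁ m₂).card : ℝ) * (P i j * P j k * P k i) :=
    mul_nonneg (Nat.cast_nonneg _) (mul_nonneg (mul_nonneg (hP0 _ _) (hP0 _ _)) (hP0 _ _))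
  by_cases hij : i = j
  · subst hij
    simpa [adjOf_diag] using hR
  by_cases hjk : j = k
  · subst hjk
    simpa [adjOf_diag] using hR
  by_cases hki : k = i
  · subst hki
    simpa [adjOf_diag] using hR
  set a := edgeOf i j hij with ha
  set b := edgeOf j k hjk with hb
  set c := edgeOf k i hki with hc
  have hab : a ≠ b := fun h => by
    rcases edgeOf_eq_iff _ _ h with h | h <;> grind
  have hac : a ≠ c := fun h => by
    rcases edgeOf_eq_iff _ _ h with h | h <;> grind
  have hbc : b ≠ c := fun h => by
    rcases edgeOf_eq_iff _ _ h with h | h <;> grind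
  have hT := card_blockSets_filter_superset_le I h₁ h₂ {a, b, c}
  rw [Finset.prod_insert (by simp [hab, hac]), Finset.prod_insert (by simp [hbc]),
    Finset.prod_singleton, ha, hb, hc, hP, hP, hP, ← ha, ← hb, ← hc, ← mul_assoc (P i j)] at hT
  refine le_trans (le_of_eq ?_) hT
  rw [Finset.card_filter, Nat.cast_sum]
  refine Finset.sum_congr rfl fun S _ => ?_
  rw [adjOf_eq_bitVal _ hij, adjOf_eq_bitVal _ hjk, adjOf_eq_bitVal _ hki, ← ha, ← hb, ← hc]
  by_cases f1 : a ∈ S.1 ∪ S.2 <;> by_cases f2 : b ∈ S.1 ∪ S.2 <;> by_cases f3 : c ∈ S.1 ∪ S.2 <;>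
    simp only [pairGraph, bitVal, f1, f2, f3, Finset.insert_subset_iff,
      Finset.singleton_subset_iff] <;> simp

end Planted

section PlantedBound

variable {n : ℕ}

/-- The sign `+1` or `-1` of a vertex according to its parity. -/
def vertexSign (i : Fin n) : ℝ := (-1) ^ (i : ℕ)

/-- The edges joining vertices of equal parity. -/
def inBlock (n : ℕ) : Finset (EdgeIdx n) :=
  Finset.univ.filter fun e => vertexSign e.1.1 * vertexSign e.1.2 = 1

theorem vertexSign_eq (i : Fin n) : vertexSign i = 1 ∨ vertexSign i = -1 :=
  neg_one_pow_eq_or ℝ _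

theorem vertexSign_mul_self (i : Fin n) : vertexSign i * vertexSign i = 1 := by
  rcases vertexSign_eq i with h | h <;> rw [h] <;> norm_num

theorem vertexSign_mul_eq (i j : Fin n) :
    vertexSign i * vertexSign j = 1 ∨ vertexSign i * vertexSign j = -1 := by
  rcases vertexSign_eq i with h | h <;> rcases vertexSign_eq j with h' | h' <;> rw [h, h'] <;>
    norm_num

theorem sum_vertexSign (n : ℕ) :
    ∑ i : Fin n, vertexSign i = if Even n then 0 else 1 := by
  unfold vertexSign
  rw [Fin.sum_univ_eq_sum_range (fun i => (-1 : ℝ) ^ i), neg_one_geom_sum]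

theorem edgeOf_mem_inBlock (i j : Fin n) (h : i ≠ j) :
    edgeOf i j h ∈ inBlock n ↔ vertexSign i * vertexSign j = 1 := by
  unfold edgeOf inBlock
  split_ifs with hij
  · simp
  · simp [mul_comm]

theorem exists_card_inBlock (n : ℕ) : ∃ r : ℝ, 0 ≤ r ∧ r ≤ 1 ∧
    ((inBlock n).card : ℝ) = ((n : ℝ) ^ 2 - 2 * n + r) / 4 ∧
    ((inBlock n)ᶜ.card : ℝ) = ((n : ℝ) ^ 2 - r) / 4 := by
  set d : ℝ := if Even n then 0 else 1 with hd
  have hdd : d ^ 2 = d := by rw [hd]; split_ifs <;> norm_num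
  refine ⟨d, by rw [hd]; split_ifs <;> norm_num, by rw [hd]; split_ifs <;> norm_num, ?_⟩
  have h1 : ((inBlock n).card : ℝ) + (inBlock n)ᶜ.card = n * ((n : ℝ) - 1) / 2 := by
    rw [← Nat.cast_choose_two, ← card_edgeIdx]
    exact_mod_cast Finset.card_add_card_compl (inBlock n)
  have h2 : ((inBlock n).card : ℝ) - (inBlock n)ᶜ.card = (d - n) / 2 := by
    have h := sum_sum_eq_sum_edge (n := n)
      (fun i j => if i = j then 0 else vertexSign i * vertexSign j) (by simp)
    have hl : ∑ i : Fin n, ∑ j : Fin n, (if i = j then 0 else vertexSign i * vertexSign j) =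
        d - n := by
      have : ∀ i j : Fin n, (if i = j then 0 else vertexSign i * vertexSign j) =
          vertexSign i * vertexSign j - if i = j then 1 else 0 := fun i j => by
        split_ifs with hij
        · rw [hij, vertexSign_mul_self, sub_self]
        · rw [sub_zero]
      simp only [this, Finset.sum_sub_distrib, ← Finset.mul_sum, ← Finset.sum_mul, sum_vertexSign]
      rw [← hd, ← pow_two, hdd]
      simp
    have hr : ∀ e : EdgeIdx n, ((if e.1.1 = e.1.2 then 0 else vertexSign e.1.1 * vertexSign e.1.2) +
        if e.1.2 = e.1.1 then 0 else vertexSign e.1.2 * vertexSign e.1.1) =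
        2 * ((if e ∈ inBlock n then 1 else 0) - if e ∈ (inBlock n)ᶜ then 1 else 0) := fun e => by
      rw [if_neg e.2.ne, if_neg e.2.ne', mul_comm (vertexSign e.1.2)]
      simp only [inBlock, Finset.mem_compl, Finset.mem_filter, Finset.mem_univ, true_and]
      rcases vertexSign_mul_eq e.1.1 e.1.2 with h | h <;> rw [h] <;> norm_num
    simp only [hl, hr, ← Finset.mul_sum, Finset.sum_sub_distrib] at h
    simp only [Finset.sum_ite_mem, Finset.univ_inter, Finset.sum_const, nsmul_eq_mul, mul_one] at h
    linarith
  constructor <;> linarith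

theorem sum_planted_le {u v : ℝ} (hv : 0 ≤ v) (huv : v ≤ u) :
    ∑ i : Fin n, ∑ j : Fin n, ∑ k : Fin n, (u - v * (vertexSign i * vertexSign j)) *
      (u - v * (vertexSign j * vertexSign k)) * (u - v * (vertexSign k * vertexSign i)) ≤
      (u ^ 3 - v ^ 3) * n ^ 3 := by
  set d : ℝ := ∑ i : Fin n, vertexSign i with hd
  have h : ∀ i j k : Fin n, (u - v * (vertexSign i * vertexSign j)) *
      (u - v * (vertexSign j * vertexSign k)) * (u - v * (vertexSign k * vertexSign i)) =
      (u ^ 3 - v ^ 3) + u * v * (v - u) * (vertexSign i * vertexSign j +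
        vertexSign j * vertexSign k + vertexSign k * vertexSign i) := fun i j k => by
    rcases vertexSign_eq i with hi | hi <;> rcases vertexSign_eq j with hj | hj <;>
      rcases vertexSign_eq k with hk | hk <;> rw [hi, hj, hk] <;> ring
  have e1 : ∑ i : Fin n, ∑ j : Fin n, ∑ k : Fin n, (vertexSign i * vertexSign j +
        vertexSign j * vertexSign k + vertexSign k * vertexSign i) = 3 * n * d ^ 2 := by
    simp only [Finset.sum_add_distrib, ← Finset.mul_sum, ← Finset.sum_mul, Finset.sum_const,
      Finset.card_univ, Fintype.card_fin, nsmul_eq_mul, ← hd]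
    ring
  simp only [h, Finset.sum_add_distrib, ← Finset.mul_sum] at e1 ⊢
  rw [e1]
  simp only [Finset.sum_const, Finset.card_univ, Fintype.card_fin, nsmul_eq_mul]
  have : 0 ≤ u * v * (u - v) * (3 * n * d ^ 2) :=
    mul_nonneg (mul_nonneg (mul_nonneg (hv.trans huv) hv) (sub_nonneg.2 huv)) (by positivity)
  linarith

theorem edgeCount_pairGraph {I : Finset (EdgeIdx n)} {m₁ m₂ : ℕ}
    {S : Finset (EdgeIdx n) × Finset (EdgeIdx n)} (hS : S ∈ blockSets I m₁ m₂) :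
    edgeCount (pairGraph S) = m₁ + m₂ := by
  simp only [blockSets, Finset.mem_product, Finset.mem_powersetCard] at hS
  obtain ⟨⟨a1, a2⟩, a3, a4⟩ := hS
  have : Disjoint S.1 S.2 :=
    Finset.disjoint_of_subset_left a1 (Finset.disjoint_of_subset_right a3 disjoint_compl_right)
  rw [← a2, ← a4, ← Finset.card_union_of_disjoint this, edgeCount]
  congr 1
  ext e
  simp [pairGraph]

theorem pairGraph_injOn (I : Finset (EdgeIdx n)) (m₁ m₂ : ℕ) :
    Set.InjOn pairGraph (blockSets I m₁ m₂ : Set (Finset (EdgeIdx n) × Finset (EdgeIdx n))) := by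
  intro S hS S' hS' h
  simp only [blockSets, Finset.coe_product, Set.mem_prod, Finset.mem_coe,
    Finset.mem_powersetCard] at hS hS'
  have hmem : ∀ e, (e ∈ S.1 ∨ e ∈ S.2) ↔ (e ∈ S'.1 ∨ e ∈ S'.2) := fun e => by
    have := congrFun h e
    simpa only [pairGraph, decide_eq_decide, Finset.mem_union] using this
  have q1 := fun e (he : e ∈ S.1) => hS.1.1 he
  have q2 := fun e (he : e ∈ S.2) => Finset.mem_compl.1 (hS.2.1 he)
  have q3 := fun e (he : e ∈ S'.1) => hS'.1.1 he
  have q4 := fun e (he : e ∈ S'.2) => Finset.mem_compl.1 (hS'.2.1 he)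
  refine Prod.ext ?_ ?_ <;> ext e <;> have := hmem e <;> have := q1 e <;> have := q2 e <;>
    have := q3 e <;> have := q4 e <;> tauto

theorem adjOf_nonneg (g : EdgeIdx n → Bool) (i j : Fin n) : 0 ≤ adjOf g i j := by
  unfold adjOf
  simp only [Matrix.of_apply]
  split_ifs <;> norm_num

theorem trace_adjOf_cube_nonneg (g : EdgeIdx n → Bool) :
    0 ≤ (adjOf g * adjOf g * adjOf g).trace := by
  simp only [Matrix.trace, Matrix.diag, Matrix.mul_apply]
  exact Finset.sum_nonneg fun i _ => Finset.sum_nonneg fun k _ => mul_nonneg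
    (Finset.sum_nonneg fun j _ => mul_nonneg (adjOf_nonneg _ _ _) (adjOf_nonneg _ _ _))
    (adjOf_nonneg _ _ _)

theorem choose_mul_pow_le_one {p : ℝ} (hp₀ : 0 ≤ p) (hp₁ : p ≤ 1) {N m : ℕ} (hm : m ≤ N) :
    (N.choose m : ℝ) * (p ^ m * (1 - p) ^ (N - m)) ≤ 1 := by
  have hq : 0 ≤ 1 - p := by linarith
  have h := add_pow p (1 - p) N
  rw [add_sub_cancel, one_pow] at h
  have := Finset.single_le_sum (f := fun k => p ^ k * (1 - p) ^ (N - k) * (N.choose k : ℝ))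
    (fun k _ => by positivity) (Finset.mem_range.2 (Nat.lt_succ_of_le hm))
  linarith

theorem card_blockSets_le_grProb (hn : 3 ≤ n) {m₁ m₂ : ℕ} (h₁ : m₁ ≤ (inBlock n).card)
    (h₂ : m₂ ≤ (inBlock n)ᶜ.card) {u v y κ : ℝ} (hu : (m₁ : ℝ) / (inBlock n).card = u - v)
    (hv : (m₂ : ℝ) / (inBlock n)ᶜ.card = u + v) (hv₀ : 0 ≤ v) (hy₁ : y ≤ 1)
    (hκ : (u ^ 3 - v ^ 3) * n ^ 3 ≤ (y - κ) * (n * ((n : ℝ) - 1) * ((n : ℝ) - 2))) :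
    κ * (blockSets (inBlock n) m₁ m₂).card ≤
      grProb n (m₁ + m₂) (fun A => triDensity A ≤ y) * (n.choose 2).choose (m₁ + m₂) := by
  classical
  have hn3 : (3 : ℝ) ≤ n := by exact_mod_cast hn
  set D : ℝ := n * ((n : ℝ) - 1) * ((n : ℝ) - 2) with hD
  have hD0 : 0 < D := mul_pos (mul_pos (by linarith) (by linarith)) (by linarith)
  set Q := blockSets (inBlock n) m₁ m₂ with hQ
  set tr := fun S : Finset (EdgeIdx n) × Finset (EdgeIdx n) =>
    (adjOf (pairGraph S) * adjOf (pairGraph S) * adjOf (pairGraph S)).trace with htr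
  set good := Q.filter fun S => triDensity (adjOf (pairGraph S)) ≤ y with hgood
  have huv : v ≤ u := by
    have : 0 ≤ (m₁ : ℝ) / (inBlock n).card := by positivity
    linarith
  have hsum : ∑ S ∈ Q, tr S ≤ Q.card * ((u ^ 3 - v ^ 3) * n ^ 3) := by
    refine (sum_blockSets_trace_le (inBlock n) h₁ h₂
      (Matrix.of fun i j => u - v * (vertexSign i * vertexSign j)) ?_ ?_).trans
      (mul_le_mul_of_nonneg_left (sum_planted_le hv₀ huv) (Nat.cast_nonneg _))
    · intro i j
      rw [Matrix.of_apply]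
      rcases vertexSign_mul_eq i j with h | h <;> rw [h] <;> linarith
    · intro i j h
      rw [Matrix.of_apply, hu, hv]
      simp only [edgeOf_mem_inBlock]
      rcases vertexSign_mul_eq i j with h | h <;> rw [h] <;> norm_num
  have hlow : ((Q.card : ℝ) - good.card) * (y * D) ≤ ∑ S ∈ Q, tr S := by
    rw [← Finset.sum_filter_add_sum_filter_not Q fun S => triDensity (adjOf (pairGraph S)) ≤ y]
    have hc := Finset.card_filter_add_card_filter_not (s := Q)
      (fun S => triDensity (adjOf (pairGraph S)) ≤ y)
    have hc' : (Q.card : ℝ) - good.card =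
        (Q.filter fun S => ¬ triDensity (adjOf (pairGraph S)) ≤ y).card := by
      rw [← hc]
      push_cast
      ring
    have h1 : 0 ≤ ∑ S ∈ Q.filter fun S => triDensity (adjOf (pairGraph S)) ≤ y, tr S :=
      Finset.sum_nonneg fun S _ => trace_adjOf_cube_nonneg _
    have h2 : (Q.filter fun S => ¬ triDensity (adjOf (pairGraph S)) ≤ y).card • (y * D) ≤
        ∑ S ∈ Q.filter fun S => ¬ triDensity (adjOf (pairGraph S)) ≤ y, tr S := by
      refine Finset.card_nsmul_le_sum _ _ _ fun S hS => ?_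
      have := (Finset.mem_filter.1 hS).2
      rw [triDensity, not_le, lt_div_iff₀ hD0] at this
      exact this.le
    rw [hc', ← nsmul_eq_mul]
    linarith
  have hkey : κ * Q.card ≤ good.card := by
    have h1 : ((Q.card : ℝ) - good.card) * (y * D) ≤ Q.card * ((y - κ) * D) :=
      hlow.trans (hsum.trans (mul_le_mul_of_nonneg_left hκ (Nat.cast_nonneg _)))
    have h2 : κ * Q.card * D ≤ good.card * y * D := by linarith
    have h3 := le_of_mul_le_mul_right h2 hD0
    have h4 : (good.card : ℝ) * y ≤ good.card :=
      mul_le_of_le_one_right (Nat.cast_nonneg _) hy₁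
    linarith
  have hcard : good.card ≤ (Finset.univ.filter fun g : EdgeIdx n → Bool =>
      edgeCount g = m₁ + m₂ ∧ triDensity (adjOf g) ≤ y).card := by
    refine Finset.card_le_card_of_injOn pairGraph ?_
      ((pairGraph_injOn (inBlock n) m₁ m₂).mono fun S hS => (Finset.mem_filter.1 hS).1)
    intro S hS
    obtain ⟨hS, hS'⟩ := Finset.mem_filter.1 hS
    exact Finset.mem_filter.2 ⟨Finset.mem_univ _, edgeCount_pairGraph hS, hS'⟩
  have hcc : (inBlock n).card + (inBlock n)ᶜ.card = n.choose 2 := by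
    rw [← card_edgeIdx]
    exact Finset.card_add_card_compl (inBlock n)
  have hpos : (0 : ℝ) < (n.choose 2).choose (m₁ + m₂) := by
    exact_mod_cast Nat.choose_pos (by omega)
  refine hkey.trans ?_
  unfold grProb
  rw [card_edgeCount_eq, div_mul_cancel₀ _ hpos.ne']
  have : (good.card : ℝ) ≤ _ := Nat.cast_le.2 hcard
  convert this

theorem mul_exp_le_grProb {p : ℝ} (hp₀ : 0 < p) (hp₁ : p < 1) (hn : 3 ≤ n) {m₁ m₂ : ℕ}
    (h₁ : m₁ ≤ (inBlock n).card)
    (h₂ : m₂ ≤ (inBlock n)ᶜ.card) {u v y κ : ℝ} (hu : (m₁ : ℝ) / (inBlock n).card = u - v)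
    (hv : (m₂ : ℝ) / (inBlock n)ᶜ.card = u + v) (hv₀ : 0 ≤ v) (hy₁ : y ≤ 1)
    (hκ₀ : 0 ≤ κ)
    (hκ : (u ^ 3 - v ^ 3) * n ^ 3 ≤ (y - κ) * (n * ((n : ℝ) - 1) * ((n : ℝ) - 2)))
    (hI₁ : 0 < (inBlock n).card) (hI₂ : 0 < (inBlock n)ᶜ.card) :
    κ * Real.exp (-(((m₁ : ℝ) - p * (inBlock n).card) ^ 2 / ((inBlock n).card * (p * (1 - p))) +
      ((m₂ : ℝ) - p * (inBlock n)ᶜ.card) ^ 2 / ((inBlock n)ᶜ.card * (p * (1 - p))))) ≤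
      (((inBlock n).card : ℝ) + 1) * (((inBlock n)ᶜ.card : ℝ) + 1) *
        grProb n (m₁ + m₂) (fun A => triDensity A ≤ y) := by
  have hq : 0 < 1 - p := by linarith
  have hcc : (inBlock n).card + (inBlock n)ᶜ.card = n.choose 2 := by
    rw [← card_edgeIdx]
    exact Finset.card_add_card_compl (inBlock n)
  have hG := card_blockSets_le_grProb hn h₁ h₂ hu hv hv₀ hy₁ hκ
  have hb₁ := binomial_mass_ge hp₀ hp₁ hI₁ h₁
  have hb₂ := binomial_mass_ge hp₀ hp₁ hI₂ h₂
  have hb := choose_mul_pow_le_one hp₀.le hp₁.le (show m₁ + m₂ ≤ n.choose 2 by omega)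
  rw [card_blockSets] at hG
  set N₁ := (inBlock n).card
  set N₂ := (inBlock n)ᶜ.card
  set G := grProb n (m₁ + m₂) (fun A => triDensity A ≤ y)
  have hG0 : 0 ≤ G := div_nonneg (Nat.cast_nonneg _) (Nat.cast_nonneg _)
  set w₁ := p ^ m₁ * (1 - p) ^ (N₁ - m₁)
  set w₂ := p ^ m₂ * (1 - p) ^ (N₂ - m₂)
  have hw : p ^ (m₁ + m₂) * (1 - p) ^ (n.choose 2 - (m₁ + m₂)) = w₁ * w₂ := by
    rw [show n.choose 2 - (m₁ + m₂) = (N₁ - m₁) + (N₂ - m₂) by omega, pow_add, pow_add]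
    ring
  rw [hw] at hb
  have hw₁ : 0 ≤ w₁ := by positivity
  have hw₂ : 0 ≤ w₂ := by positivity
  push_cast at hG
  rw [neg_add, Real.exp_add]
  calc κ * _ ≤ κ * (((N₁ + 1) * (N₁.choose m₁ * w₁)) * ((N₂ + 1) * (N₂.choose m₂ * w₂))) :=
        mul_le_mul_of_nonneg_left
          (mul_le_mul hb₁ hb₂ (Real.exp_pos _).le (by positivity)) hκ₀
    _ = ((N₁ + 1) * (N₂ + 1) * (w₁ * w₂)) * (κ * (N₁.choose m₁ * N₂.choose m₂)) := by ring
    _ ≤ ((N₁ + 1) * (N₂ + 1) * (w₁ * w₂)) * (G * (n.choose 2).choose (m₁ + m₂)) :=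
        mul_le_mul_of_nonneg_left hG (by positivity)
    _ = (N₁ + 1) * (N₂ + 1) * G * ((n.choose 2).choose (m₁ + m₂) * (w₁ * w₂)) := by ring
    _ ≤ (N₁ + 1) * (N₂ + 1) * G * 1 := mul_le_mul_of_nonneg_left hb (by positivity)
    _ = _ := mul_one _

end PlantedBound

section LowerAsymptotics

theorem sq_div_add_sq_div_le {N₁ N₂ a₁ a₂ b x c k n : ℝ} (hN₁ : 1 ≤ N₁) (hN : N₁ ≤ N₂)
    (hNn : N₁ ≤ n ^ 2 / 4) (hk : 0 < k) (hx₁ : x ≤ 1) (hc : 0 ≤ c)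
    (hb : b = N₁ * x + c) (h₁ : |a₁| ≤ b) (h₂ : |a₂| ≤ b) :
    a₁ ^ 2 / (N₁ * k) + a₂ ^ 2 / (N₂ * k) ≤ (n ^ 2 * x ^ 2 / 2 + (4 * c + 2 * c ^ 2)) / k := by
  have hb₀ : 0 ≤ b := (abs_nonneg _).trans h₁
  have s₁ : a₁ ^ 2 ≤ b ^ 2 := sq_le_sq.2 (h₁.trans (le_abs_self b))
  have s₂ : a₂ ^ 2 ≤ b ^ 2 := sq_le_sq.2 (h₂.trans (le_abs_self b))
  have hN₀ : 0 < N₁ := by linarith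
  have e₁ : a₁ ^ 2 / (N₁ * k) ≤ b ^ 2 / (N₁ * k) := by gcongr
  have e₂ : a₂ ^ 2 / (N₂ * k) ≤ b ^ 2 / (N₁ * k) := by gcongr
  have e₃ : b ^ 2 / (N₁ * k) ≤ (n ^ 2 * x ^ 2 / 4 + (2 * c + c ^ 2)) / k := by
    rw [div_le_div_iff₀ (by positivity) hk]
    have f₁ : b ^ 2 ≤ (n ^ 2 * x ^ 2 / 4 + (2 * c + c ^ 2)) * N₁ := by
      have g₁ : N₁ * (N₁ * x ^ 2) ≤ n ^ 2 / 4 * (N₁ * x ^ 2) :=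
        mul_le_mul_of_nonneg_right hNn (by positivity)
      have g₂ : 2 * c * N₁ * x ≤ 2 * c * N₁ * 1 := mul_le_mul_of_nonneg_left hx₁ (by positivity)
      have g₃ : c ^ 2 * 1 ≤ c ^ 2 * N₁ := mul_le_mul_of_nonneg_left hN₁ (by positivity)
      rw [hb]
      linarith
    calc b ^ 2 * k ≤ ((n ^ 2 * x ^ 2 / 4 + (2 * c + c ^ 2)) * N₁) * k :=
          mul_le_mul_of_nonneg_right f₁ hk.le
      _ = _ := by ring
  have e₄ : (n ^ 2 * x ^ 2 / 2 + (4 * c + 2 * c ^ 2)) / k =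
      2 * ((n ^ 2 * x ^ 2 / 4 + (2 * c + c ^ 2)) / k) := by ring
  linarith

theorem cube_sub_cube_le {u v p x C n : ℝ} (hn : 1 ≤ n) (hC : 0 ≤ C) (hp₀ : 0 ≤ p) (hp₁ : p ≤ 1)
    (hx₁ : x ≤ 1) (hxn : 1 + C ≤ x * n) (hu₀ : 0 ≤ u) (hu : u ≤ p + C / n)
    (hv : x - (1 + C) / n ≤ v) :
    u ^ 3 - v ^ 3 ≤ p ^ 3 - x ^ 3 + (3 * C + 3 * C ^ 2 + C ^ 3 + 3 * (1 + C)) / n := by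
  have hn₀ : 0 < n := by linarith
  have hax : (1 + C) / n ≤ x := by rwa [div_le_iff₀ hn₀]
  set a := (1 + C) / n with ha
  have ha₀ : 0 ≤ a := by positivity
  set c := C / n with hc
  have hc₀ : 0 ≤ c := by positivity
  have hx₀ : 0 ≤ x := ha₀.trans hax
  have h₁ : (x - a) ^ 3 ≤ v ^ 3 := pow_le_pow_left₀ (by linarith) hv 3
  have h₂ : u ^ 3 ≤ (p + c) ^ 3 := pow_le_pow_left₀ hu₀ hu 3
  have h₃ : x ^ 3 - 3 * a ≤ (x - a) ^ 3 := by
    have g₁ : a * x ^ 2 ≤ a * 1 := mul_le_mul_of_nonneg_left (pow_le_one₀ hx₀ hx₁) ha₀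
    have g₂ : 0 ≤ a ^ 2 * (3 * x - a) := mul_nonneg (sq_nonneg _) (by linarith)
    linarith
  have hcC : c ≤ C := div_le_self hC hn
  have h₄ : (p + c) ^ 3 ≤ p ^ 3 + (3 + 3 * C + C ^ 2) * c := by
    have g₁ : c * p ^ 2 ≤ c * 1 := mul_le_mul_of_nonneg_left (pow_le_one₀ hp₀ hp₁) hc₀
    have g₂ : c * (p * c) ≤ c * (1 * C) :=
      mul_le_mul_of_nonneg_left (mul_le_mul hp₁ hcC hc₀ zero_le_one) hc₀
    have g₃ : c * c ^ 2 ≤ c * C ^ 2 :=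
      mul_le_mul_of_nonneg_left (pow_le_pow_left₀ hc₀ hcC 2) hc₀
    linarith
  have h₅ : (3 * C + 3 * C ^ 2 + C ^ 3 + 3 * (1 + C)) / n = (3 + 3 * C + C ^ 2) * c + 3 * a := by
    rw [hc, ha]
    ring
  linarith

theorem exists_planted_parameters {n m : ℕ} {p x C : ℝ} (hn : 4 ≤ n) (hp₀ : 0 < p) (hp₁ : p < 1)
    (hx₀ : 0 ≤ x) (hxp : x ≤ p) (hC : |(m : ℝ) - p * (n.choose 2 : ℝ)| ≤ C)
    (hxn : 1 + C ≤ x * n) (hCp : 2 * C ≤ p * n) (hCq : 2 * (C + 1) ≤ (1 - p - x) * n) :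
    ∃ (m₁ m₂ : ℕ) (u v : ℝ), m₁ + m₂ = m ∧ m₁ ≤ (inBlock n).card ∧ m₂ ≤ (inBlock n)ᶜ.card ∧
      (m₁ : ℝ) / (inBlock n).card = u - v ∧ (m₂ : ℝ) / (inBlock n)ᶜ.card = u + v ∧ 0 ≤ v ∧
      u ^ 3 - v ^ 3 ≤ p ^ 3 - x ^ 3 + (3 * C + 3 * C ^ 2 + C ^ 3 + 3 * (1 + C)) / n ∧
      ((m₁ : ℝ) - p * (inBlock n).card) ^ 2 / ((inBlock n).card * (p * (1 - p))) +
        ((m₂ : ℝ) - p * (inBlock n)ᶜ.card) ^ 2 / ((inBlock n)ᶜ.card * (p * (1 - p))) ≤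
        ((n : ℝ) ^ 2 * x ^ 2 / 2 + (4 * (1 + C) + 2 * (1 + C) ^ 2)) / (p * (1 - p)) := by
  have hC₀ : 0 ≤ C := (abs_nonneg _).trans hC
  obtain ⟨r, hr₀, hr₁, hN₁, hN₂⟩ := exists_card_inBlock n
  set M₁ := (inBlock n).card
  set M₂ := (inBlock n)ᶜ.card
  set N₁ : ℝ := (M₁ : ℝ) with hN₁d
  set N₂ : ℝ := (M₂ : ℝ) with hN₂d
  have hn4 : (4 : ℝ) ≤ n := by exact_mod_cast hn
  have hN : (n.choose 2 : ℝ) = N₁ + N₂ := by rw [Nat.cast_choose_two, hN₁, hN₂]; ring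
  have hN₁1 : 1 ≤ N₁ := by rw [hN₁]; nlinarith only [hn4, hr₀]
  have hN₁n : N₁ ≤ (n : ℝ) ^ 2 / 4 := by rw [hN₁]; linarith
  have hN₁₂ : N₁ ≤ N₂ := by rw [hN₁, hN₂]; linarith
  have hN₂n : (n : ℝ) ≤ 2 * N₂ := by rw [hN₂]; nlinarith only [hn4, hr₁]
  have hratio : ((n : ℝ) - 2) * N₂ ≤ n * N₁ := by rw [hN₁, hN₂]; nlinarith only [hn4, hr₀]
  have hN₁0 : 0 < N₁ := by linarith
  have hN₂0 : 0 < N₂ := by linarith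
  have hn0 : (0 : ℝ) < n := by linarith
  rw [hN, abs_le] at hC
  obtain ⟨hCl, hCu⟩ := hC
  have hxN₀ : 0 ≤ N₁ * (p - x) := mul_nonneg hN₁0.le (by linarith)
  set m₁ := ⌊N₁ * (p - x)⌋₊ with hm₁
  have hfl : (m₁ : ℝ) ≤ N₁ * (p - x) := Nat.floor_le hxN₀
  have hfu : N₁ * (p - x) < m₁ + 1 := Nat.lt_floor_add_one _
  have hxN : 0 ≤ N₁ * x := by positivity
  have hle₁ : m₁ ≤ M₁ := by
    have : (m₁ : ℝ) ≤ M₁ := by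
      rw [← hN₁d]
      have : N₁ * p ≤ N₁ * 1 := mul_le_mul_of_nonneg_left hp₁.le hN₁0.le
      linarith
    exact_mod_cast this
  have hpN₂ : p * n ≤ p * (2 * N₂) := mul_le_mul_of_nonneg_left hN₂n hp₀.le
  have hlem : m₁ ≤ m := by
    have : (m₁ : ℝ) ≤ m := by linarith
    exact_mod_cast this
  obtain ⟨m₂, rfl⟩ := Nat.exists_eq_add_of_le hlem
  push_cast at hCl hCu
  have hq : 0 < 1 - p - x := by
    by_contra h
    have := mul_nonneg (neg_nonneg.2 (not_lt.1 h)) hn0.le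
    linarith
  have hqN₂ : (1 - p - x) * n ≤ (1 - p - x) * (2 * N₂) := mul_le_mul_of_nonneg_left hN₂n hq.le
  have hxN₁₂ : N₁ * x ≤ N₂ * x := mul_le_mul_of_nonneg_right hN₁₂ hx₀
  have hle₂ : m₂ ≤ M₂ := by
    have : (m₂ : ℝ) ≤ M₂ := by
      rw [← hN₂d]
      linarith
    exact_mod_cast this
  set p₁ := (m₁ : ℝ) / N₁ with hp₁d
  set p₂ := (m₂ : ℝ) / N₂ with hp₂d
  have hm₁p : (m₁ : ℝ) = p₁ * N₁ := by rw [hp₁d, div_mul_cancel₀ _ hN₁0.ne']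
  have hm₂p : (m₂ : ℝ) = p₂ * N₂ := by rw [hp₂d, div_mul_cancel₀ _ hN₂0.ne']
  have hp₁0 : 0 ≤ p₁ := div_nonneg (Nat.cast_nonneg _) hN₁0.le
  have hp₂0 : 0 ≤ p₂ := div_nonneg (Nat.cast_nonneg _) hN₂0.le
  have hp₁x : p₁ ≤ p - x := by rw [hp₁d, div_le_iff₀ hN₁0]; linarith
  have hx₁ : x ≤ 1 := by linarith
  have hp₂x : p + x - 2 * ((1 + C) / n) ≤ p₂ := by
    rw [hp₂d, le_div_iff₀ hN₂0]
    have g₁ : N₂ * x - 2 * (1 / n) * N₂ ≤ N₁ * x := by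
      have g₂ : (1 - 2 / n) * N₂ ≤ N₁ := by
        rw [one_sub_div hn0.ne', div_mul_eq_mul_div, div_le_iff₀ hn0]
        linarith
      have g₃ := mul_le_mul_of_nonneg_right g₂ hx₀
      have g₄ : 2 / n * N₂ * x ≤ 2 / n * N₂ * 1 :=
        mul_le_mul_of_nonneg_left hx₁ (mul_nonneg (by positivity) hN₂0.le)
      have g₅ : 2 * (1 / (n : ℝ)) = 2 / n := by ring
      rw [g₅]
      linarith
    have g₆ : C ≤ 2 * (C / n) * N₂ := by
      calc C = C / n * n := by rw [div_mul_cancel₀ _ hn0.ne']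
        _ ≤ C / n * (2 * N₂) := mul_le_mul_of_nonneg_left hN₂n (by positivity)
        _ = _ := by ring
    have g₇ : (p + x - 2 * ((1 + C) / n)) * N₂ =
        p * N₂ + (N₂ * x - 2 * (1 / n) * N₂) - 2 * (C / n) * N₂ := by ring
    rw [g₇]
    linarith
  have hv : x - (1 + C) / n ≤ (p₂ - p₁) / 2 := by linarith
  have hv₀ : 0 ≤ (p₂ - p₁) / 2 := by
    have : (1 + C) / n ≤ x := by rwa [div_le_iff₀ hn0]
    linarith
  have hu : (p₁ + p₂) / 2 ≤ p + C / n := by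
    have g₁ : (p₁ + p₂) / 2 * (N₁ + N₂) ≤ m₁ + m₂ := by
      have : 0 ≤ (p₂ - p₁) / 2 * (N₂ - N₁) := mul_nonneg hv₀ (by linarith)
      rw [hm₁p, hm₂p]
      linarith
    have g₂ : C ≤ C / n * (N₁ + N₂) := by
      calc C = C / n * n := by rw [div_mul_cancel₀ _ hn0.ne']
        _ ≤ C / n * (N₁ + N₂) := mul_le_mul_of_nonneg_left (by
            rw [← hN, Nat.cast_choose_two]; nlinarith only [hn4]) (by positivity)
    have g₃ : (p₁ + p₂) / 2 * (N₁ + N₂) ≤ (p + C / n) * (N₁ + N₂) := by linarith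
    exact le_of_mul_le_mul_right g₃ (by linarith)
  refine ⟨m₁, m₂, (p₁ + p₂) / 2, (p₂ - p₁) / 2, rfl, hle₁, hle₂, by ring, by ring, hv₀,
    cube_sub_cube_le (by linarith) hC₀ hp₀.le hp₁.le hx₁ hxn (by linarith) hu hv, ?_⟩
  refine sq_div_add_sq_div_le (b := N₁ * x + (1 + C)) hN₁1 hN₁₂ hN₁n
    (mul_pos hp₀ (by linarith)) hx₁ (by linarith) rfl ?_ ?_ <;>
  rw [abs_le] <;> constructor <;> linarith

set_option maxHeartbeats 400000 in
theorem eventually_le_grProb {p C δ : ℝ} (hp₀ : 0 < p) (hp₁ : p < 1)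
    {m : ℕ → ℕ} (hm : ∀ n : ℕ, |(m n : ℝ) - p * (n.choose 2 : ℝ)| ≤ C) {t : ℕ → ℝ}
    (ht₁ : Tendsto (fun n : ℕ => (n : ℝ) ^ ((3 : ℝ) / 4) * t n) atTop atTop)
    (ht₂ : Tendsto t atTop (nhds 0)) (hδ : 0 < δ) :
    ∀ᶠ n : ℕ in atTop,
      Real.exp ((-(1 / (2 * p * (1 - p))) - δ) * (t n ^ ((2 : ℝ) / 3) * (n : ℝ) ^ 2)) ≤
        grProb n (m n) (fun A => triDensity A ≤ p ^ 3 - t n) := by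
  have hC₀ : 0 ≤ C := (abs_nonneg _).trans (hm 0)
  have hq : 0 < 1 - p := by linarith
  set k := p * (1 - p) with hk
  have hk₀ : 0 < k := mul_pos hp₀ hq
  set ε := δ * k with hε
  have hε₀ : 0 < ε := mul_pos hδ hk₀
  set c₁ := 3 * C + 3 * C ^ 2 + C ^ 3 + 3 * (1 + C) with hc₁
  have hc₁0 : 0 ≤ c₁ := by positivity
  set c₃ := 4 * (1 + C) + 2 * (1 + C) ^ 2 with hc₃
  have hc₃0 : 0 ≤ c₃ := by positivity
  set x₀ := min p ((1 - p) / 2) with hx₀d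
  have hx₀0 : 0 < x₀ := by positivity
  set K := 4 + (1 + C) + 2 * C / p + 4 * (C + 1) / (1 - p) + 2 * (c₁ + 3) / ε +
    2 / δ * (5 + c₃ / k) with hK
  have k₁ : 0 ≤ 2 * C / p := by positivity
  have k₂ : 0 ≤ 4 * (C + 1) / (1 - p) := by positivity
  have k₃ : 0 ≤ 2 * (c₁ + 3) / ε := by positivity
  have k₄ : 0 ≤ 2 / δ * (5 + c₃ / k) := by positivity
  have hsmall : 0 < min (min 1 (p ^ 3)) (x₀ ^ 3) / (1 + ε) := by positivity
  filter_upwards [eventually_scale ht₁ K, ht₂.eventually_le_const hsmall] with n hn htn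
  obtain ⟨ht₀, hnK, htK, hwK⟩ := hn
  rw [le_div_iff₀ (by positivity)] at htn
  have htn1 : t n * (1 + ε) ≤ 1 := htn.trans ((min_le_left _ _).trans (min_le_left _ _))
  have htnp : t n * (1 + ε) ≤ p ^ 3 := htn.trans ((min_le_left _ _).trans (min_le_right _ _))
  have htnx : t n * (1 + ε) ≤ x₀ ^ 3 := htn.trans (min_le_right _ _)
  have hn4 : (4 : ℝ) ≤ n := by linarith
  have hn0 : (0 : ℝ) < n := by linarith
  have hn4' : 4 ≤ n := by exact_mod_cast hn4
  have hεt : 0 < ε * t n := mul_pos hε₀ ht₀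
  set x := ((1 + ε) * t n) ^ ((1 : ℝ) / 3) * 1 with hxd
  obtain ⟨hx3, hx2⟩ := rpow_third_mul_pow (t := (1 + ε) * t n) (x := 1) (by positivity)
  rw [← hxd, one_pow, mul_one] at hx3 hx2
  have hxpos : 0 ≤ x := by positivity
  have hxx₀ : x ≤ x₀ := by
    refine le_of_pow_le_pow_left₀ (n := 3) (by norm_num) hx₀0.le ?_
    rw [hx3]
    linarith
  have hxp : x ≤ p := hxx₀.trans (min_le_left _ _)
  have hxq : x ≤ (1 - p) / 2 := hxx₀.trans (min_le_right _ _)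
  have ht1 : t n ≤ 1 := by linarith
  have htx : t n ≤ x := by
    refine le_of_pow_le_pow_left₀ (n := 3) (by norm_num) hxpos ?_
    rw [hx3]
    have : t n ^ 3 ≤ t n := pow_le_of_le_one ht₀.le ht1 (by norm_num)
    linarith
  have hxn : 1 + C ≤ x * n := by
    have : t n * n ≤ x * n := mul_le_mul_of_nonneg_right htx hn0.le
    linarith
  have hCp : 2 * C ≤ p * n := by
    have : 2 * C / p ≤ n := by linarith
    rwa [div_le_iff₀ hp₀, mul_comm (n : ℝ)] at this
  have hCq : 2 * (C + 1) ≤ (1 - p - x) * n := by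
    have h₁ : 4 * (C + 1) / (1 - p) ≤ n := by linarith
    rw [div_le_iff₀ hq] at h₁
    have h₂ : (1 - p) / 2 * n ≤ (1 - p - x) * n := mul_le_mul_of_nonneg_right (by linarith) hn0.le
    linarith
  obtain ⟨m₁, m₂, u, v, hsum, h₁, h₂, hu, hv, hv₀, huv, hE⟩ :=
    exists_planted_parameters hn4' hp₀ hp₁ hxpos hxp (hm n) hxn hCp hCq
  obtain ⟨r, hr₀, hr₁, hN₁, hN₂⟩ := exists_card_inBlock n
  have hN₁0 : (0 : ℝ) < (inBlock n).card := by rw [hN₁]; nlinarith only [hn4, hr₀]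
  have hN₂0 : (0 : ℝ) < (inBlock n)ᶜ.card := by rw [hN₂]; nlinarith only [hn4, hr₁]
  have hp3 : p ^ 3 ≤ 1 := pow_le_one₀ hp₀.le hp₁.le
  set y := p ^ 3 - t n with hy
  set κ := ε / 2 * t n with hκd
  have hκ₀ : 0 ≤ κ := by positivity
  have hκ : (u ^ 3 - v ^ 3) * (n : ℝ) ^ 3 ≤
      (y - κ) * (n * ((n : ℝ) - 1) * ((n : ℝ) - 2)) := by
    rw [hx3] at huv
    have g₁ : (u ^ 3 - v ^ 3) * (n : ℝ) ^ 3 ≤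
        (p ^ 3 - (1 + ε) * t n + c₁ / n) * (n : ℝ) ^ 3 :=
      mul_le_mul_of_nonneg_right huv (by positivity)
    have g₂ : c₁ / n * (n : ℝ) ^ 3 = c₁ * (n : ℝ) ^ 2 := by field_simp
    have g₃ : c₁ + 3 ≤ ε / 2 * (t n * n) := by
      have : 2 * (c₁ + 3) / ε ≤ t n * n := by linarith
      rw [div_le_iff₀ hε₀] at this
      linarith
    have g₄ : (c₁ + 3) * (n : ℝ) ^ 2 ≤ ε / 2 * (t n * n) * (n : ℝ) ^ 2 :=
      mul_le_mul_of_nonneg_right g₃ (by positivity)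
    have g₅ : 0 ≤ y - κ := by rw [hy, hκd]; linarith
    have g₆ : y - κ ≤ 1 := by rw [hy]; linarith
    have g₇ : (y - κ) * (3 * (n : ℝ) ^ 2) ≤ 1 * (3 * (n : ℝ) ^ 2) :=
      mul_le_mul_of_nonneg_right g₆ (by positivity)
    have g₈ : 0 ≤ (y - κ) * (2 * (n : ℝ)) := mul_nonneg g₅ (by positivity)
    have g₉ : (y - κ) * (n * ((n : ℝ) - 1) * ((n : ℝ) - 2)) = (y - κ) * (n : ℝ) ^ 3 -
        (y - κ) * (3 * (n : ℝ) ^ 2) + (y - κ) * (2 * (n : ℝ)) := by ring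
    have g₀ : (y - κ) * (n : ℝ) ^ 3 = (p ^ 3 - (1 + ε) * t n) * (n : ℝ) ^ 3 +
        ε / 2 * (t n * n) * (n : ℝ) ^ 2 := by
      rw [hy, hκd]
      ring
    rw [g₉, g₀]
    rw [add_mul, g₂] at g₁
    linarith
  have hmain := mul_exp_le_grProb hp₀ hp₁ (by omega) h₁ h₂ hu hv hv₀
    (y := y) (by rw [hy]; linarith) hκ₀ hκ (by exact_mod_cast hN₁0) (by exact_mod_cast hN₂0)
  rw [hsum] at hmain
  rw [← hk] at hE hmain
  set E := ((m₁ : ℝ) - p * (inBlock n).card) ^ 2 / ((inBlock n).card * k) +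
    ((m₂ : ℝ) - p * (inBlock n)ᶜ.card) ^ 2 / ((inBlock n)ᶜ.card * k) with hEd
  set G := grProb n (m n) (fun A => triDensity A ≤ y) with hG
  have hG₀ : 0 ≤ G := div_nonneg (Nat.cast_nonneg _) (Nat.cast_nonneg _)
  have hNN : (((inBlock n).card : ℝ) + 1) * (((inBlock n)ᶜ.card : ℝ) + 1) ≤ (n : ℝ) ^ 4 := by
    have a₁ : ((inBlock n).card : ℝ) + 1 ≤ (n : ℝ) ^ 2 := by rw [hN₁]; nlinarith only [hn4, hr₁]
    have a₂ : ((inBlock n)ᶜ.card : ℝ) + 1 ≤ (n : ℝ) ^ 2 := by rw [hN₂]; nlinarith only [hn4, hr₀]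
    calc _ ≤ (n : ℝ) ^ 2 * (n : ℝ) ^ 2 := mul_le_mul a₁ a₂ (by positivity) (by positivity)
      _ = _ := by ring
  have hκn : 1 ≤ κ * n := by
    have : 2 * (c₁ + 3) / ε ≤ t n * n := by linarith
    rw [div_le_iff₀ hε₀] at this
    rw [hκd]
    linarith
  have hexpn : (n : ℝ) ^ 5 ≤ Real.exp (5 * n) := by
    have : (n : ℝ) ≤ Real.exp n := by linarith [Real.add_one_le_exp (n : ℝ)]
    calc (n : ℝ) ^ 5 ≤ Real.exp n ^ 5 := pow_le_pow_left₀ hn0.le this 5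
      _ = _ := by rw [← Real.exp_nat_mul]; norm_num
  have hGE : Real.exp (-E - 5 * n) ≤ G := by
    have b₁ : Real.exp (-E) ≤ Real.exp (5 * n) * G := by
      calc Real.exp (-E) ≤ (κ * n) * Real.exp (-E) :=
            le_mul_of_one_le_left (Real.exp_pos _).le hκn
        _ = n * (κ * Real.exp (-E)) := by ring
        _ ≤ n * ((n : ℝ) ^ 4 * G) := mul_le_mul_of_nonneg_left
            (hmain.trans (mul_le_mul_of_nonneg_right hNN hG₀)) hn0.le
        _ = (n : ℝ) ^ 5 * G := by ring
        _ ≤ _ := mul_le_mul_of_nonneg_right hexpn hG₀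
    rw [Real.exp_sub, div_le_iff₀ (Real.exp_pos _)]
    linarith
  refine le_trans (Real.exp_le_exp.2 ?_) hGE
  set s := t n ^ ((2 : ℝ) / 3) * (n : ℝ) ^ 2 with hs
  have hsx : (n : ℝ) ^ 2 * x ^ 2 ≤ (1 + ε) * s := by
    rw [hx2, Real.mul_rpow (by positivity) ht₀.le, hs]
    have : (1 + ε) ^ ((2 : ℝ) / 3) ≤ 1 + ε :=
      Real.rpow_le_self_of_one_le (by linarith) (by norm_num)
    calc (n : ℝ) ^ 2 * ((1 + ε) ^ ((2 : ℝ) / 3) * t n ^ ((2 : ℝ) / 3))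
        = (1 + ε) ^ ((2 : ℝ) / 3) * (t n ^ ((2 : ℝ) / 3) * (n : ℝ) ^ 2) := by ring
      _ ≤ _ := mul_le_mul_of_nonneg_right this (by positivity)
  have hsn : 2 / δ * (5 + c₃ / k) * n ≤ s := by
    have c₁ : 2 / δ * (5 + c₃ / k) ≤ √n * t n ^ ((2 : ℝ) / 3) := by linarith
    have c₂ : √(n : ℝ) ≤ n := Real.sqrt_le_iff.2 ⟨hn0.le, le_self_pow₀ (by linarith) two_ne_zero⟩
    calc 2 / δ * (5 + c₃ / k) * n ≤ √n * t n ^ ((2 : ℝ) / 3) * n :=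
          mul_le_mul_of_nonneg_right c₁ hn0.le
      _ ≤ n * t n ^ ((2 : ℝ) / 3) * n :=
          mul_le_mul_of_nonneg_right (mul_le_mul_of_nonneg_right c₂ (by positivity)) hn0.le
      _ = s := by rw [hs]; ring
  have hfin₁ : 5 * n + c₃ / k ≤ δ / 2 * s := by
    have d₁ : (5 + c₃ / k) * n ≤ δ / 2 * s := by
      calc (5 + c₃ / k) * n = δ / 2 * (2 / δ * (5 + c₃ / k) * n) := by field_simp
        _ ≤ _ := mul_le_mul_of_nonneg_left hsn (by positivity)
    have d₂ : c₃ / k * 1 ≤ c₃ / k * n := mul_le_mul_of_nonneg_left (by linarith) (by positivity)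
    linarith
  have hfin₂ : ((n : ℝ) ^ 2 * x ^ 2 / 2 + c₃) / k ≤
      1 / (2 * p * (1 - p)) * s + δ / 2 * s + c₃ / k := by
    have d₁ : ((n : ℝ) ^ 2 * x ^ 2 / 2 + c₃) / k ≤ ((1 + ε) * s / 2 + c₃) / k := by gcongr
    refine d₁.trans (le_of_eq ?_)
    rw [show 2 * p * (1 - p) = 2 * k by rw [hk]; ring, hε]
    field_simp
  linarith

end LowerAsymptotics

section Assembly

theorem exists_tendsto_zero_le_exp {P x : ℕ → ℝ} {a : ℝ} (hx : ∀ᶠ n in atTop, 0 < x n)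
    (h : ∀ δ : ℝ, 0 < δ → ∀ᶠ n in atTop, P n ≤ Real.exp ((a + δ) * x n)) :
    ∃ f : ℕ → ℝ, Tendsto f atTop (nhds 0) ∧
      ∀ᶠ n in atTop, P n ≤ Real.exp ((a + f n) * x n) := by
  refine ⟨fun n => if P n ≤ 0 then 0 else max 0 (Real.log (P n) / x n - a), ?_, ?_⟩
  · rw [Metric.tendsto_nhds]
    intro δ hδ
    filter_upwards [hx, h (δ / 2) (by linarith)] with n hxn hn
    rw [Real.dist_eq, sub_zero]
    split_ifs with hP
    · simpa using hδ
    · have h1 : Real.log (P n) ≤ (a + δ / 2) * x n :=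
        (Real.log_le_iff_le_exp (not_le.1 hP)).2 hn
      rw [← div_le_iff₀ hxn] at h1
      rw [abs_of_nonneg (le_max_left _ _)]
      exact max_lt hδ (by linarith)
  · filter_upwards [hx] with n hxn
    split_ifs with hP
    · exact hP.trans (Real.exp_pos _).le
    · rw [← Real.log_le_iff_le_exp (not_le.1 hP), ← div_le_iff₀ hxn]
      linarith [le_max_right 0 (Real.log (P n) / x n - a)]

theorem exists_tendsto_zero_exp_le {P x : ℕ → ℝ} {a : ℝ} (hx : ∀ᶠ n in atTop, 0 < x n)
    (h : ∀ δ : ℝ, 0 < δ → ∀ᶠ n in atTop, Real.exp ((a - δ) * x n) ≤ P n) :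
    ∃ g : ℕ → ℝ, Tendsto g atTop (nhds 0) ∧
      ∀ᶠ n in atTop, Real.exp ((a + g n) * x n) ≤ P n := by
  obtain ⟨f, hf, hP⟩ := exists_tendsto_zero_le_exp (P := fun n => (P n)⁻¹) (a := -a) hx
    fun δ hδ => by
      filter_upwards [h δ hδ] with n hn
      rw [show (-a + δ) * x n = -((a - δ) * x n) by ring, Real.exp_neg]
      exact inv_anti₀ (Real.exp_pos _) hn
  refine ⟨fun n => -f n, by simpa using hf.neg, ?_⟩
  filter_upwards [hP, h 1 one_pos] with n hn hn'
  have hpos : 0 < P n := (Real.exp_pos _).trans_le hn'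
  rw [show (a + -f n) * x n = -((-a + f n) * x n) by ring, Real.exp_neg]
  exact inv_le_of_inv_le₀ hpos hn

end Assembly

end LowerTail
/-- Theorem `thm:small-p-triangle-count`, probability bounds:
for `0 < p ≤ 1/2`, `Pr(τ(A_n) ≤ p³ - t_n)` is at most
`exp(-(ln(p/(1-p))/(2(2p-1))) t_n^{2/3} n² + o(t_n^{2/3} n²))` (coefficient `1` at `p = 1/2`)
and at least `exp(-(1/(2p(1-p))) t_n^{2/3} n² + o(t_n^{2/3} n²))`. -/
theorem lower_tail_triangle_density_small_p
    (p : ℝ) (hp₀ : 0 < p) (hp₁ : p ≤ 1 / 2)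
    (m : ℕ → ℕ) (hm : ∃ C : ℝ, ∀ n : ℕ, |(m n : ℝ) - p * (n.choose 2 : ℝ)| ≤ C)
    (t : ℕ → ℝ)
    (ht₁ : Tendsto (fun n : ℕ => (n : ℝ) ^ ((3 : ℝ) / 4) * t n) atTop atTop)
    (ht₂ : Tendsto t atTop (nhds 0)) :
    ∃ f g : ℕ → ℝ,
      Tendsto f atTop (nhds 0) ∧ Tendsto g atTop (nhds 0) ∧
      ∀ᶠ n : ℕ in atTop,
        grProb n (m n) (fun A => triDensity A ≤ p ^ 3 - t n) ≤
          Real.exp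
            ((-(if p = 1 / 2 then 1 else Real.log (p / (1 - p)) / (2 * (2 * p - 1))) + f n) *
              (t n ^ ((2 : ℝ) / 3) * (n : ℝ) ^ 2)) ∧
        Real.exp
            ((-(1 / (2 * p * (1 - p))) + g n) * (t n ^ ((2 : ℝ) / 3) * (n : ℝ) ^ 2)) ≤
          grProb n (m n) (fun A => triDensity A ≤ p ^ 3 - t n) := by
  obtain ⟨C, hC⟩ := hm
  have hp : p < 1 := by linarith
  have hx : ∀ᶠ n : ℕ in atTop, 0 < t n ^ ((2 : ℝ) / 3) * (n : ℝ) ^ 2 := by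
    filter_upwards [LowerTail.eventually_scale ht₁ 1] with n hn
    have h₁ := hn.1
    have h₂ : (0 : ℝ) < n := by linarith [hn.2.1]
    positivity
  obtain ⟨f, hf, hf'⟩ := LowerTail.exists_tendsto_zero_le_exp hx fun δ hδ =>
    LowerTail.eventually_grProb_le hp₀ hp (LowerTail.varProxy_pos hp₀ hp₁)
      (LowerTail.bernoulli_mgf_le hp₀ hp₁) hC ht₁ ht₂ hδ
  obtain ⟨g, hg, hg'⟩ := LowerTail.exists_tendsto_zero_exp_le hx fun δ hδ =>
    LowerTail.eventually_le_grProb hp₀ hp hC ht₁ ht₂ hδ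
  refine ⟨f, g, hf, hg, ?_⟩
  rw [LowerTail.one_div_four_mul_varProxy hp₀ hp₁]
  filter_upwards [hf', hg'] with n h₁ h₂ using ⟨h₁, h₂⟩

end
end

section
/- Let A be the adjacency matrix of a simple graph with n vertices and m edges, let 𝟏 be the n×n all-ones matrix, I the identity matrix, and d_i the degree of vertex i. Then for any real p: tr[(A − p𝟏 + pI)^3] = tr[A^3] − p^3 n^3 + p^3 n + 6 m p (n p − 2p + 1) + 3 p^3 n(n−1) − 3p Σ_i d_i^2. Moreover, if p = m/binom(n,2), then tr[(A − p𝟏 + pI)^3] ≤ tr[A^3] − p^3 n^3 + p^3 n + 6 m p. -/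
open Matrix
open scoped BigOperators

namespace Matrix

variable {ι R : Type*} [Fintype ι] [CommRing R]

/-- The cube of a sum has the commutative binomial expansion under the trace. -/
theorem trace_add_pow_three [DecidableEq ι] (X Y : Matrix ι ι R) :
    ((X + Y) ^ 3).trace =
      (X ^ 3).trace + 3 * (X ^ 2 * Y).trace + 3 * (X * Y ^ 2).trace + (Y ^ 3).trace := by
  have hXYX : (X * (Y * X)).trace = (X * (X * Y)).trace := by
    rw [← Matrix.mul_assoc, trace_mul_comm]
  have hYXX : (Y * (X * X)).trace = (X * (X * Y)).trace := by
    rw [trace_mul_comm, Matrix.mul_assoc]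
  have hYXY : (Y * (X * Y)).trace = (X * (Y * Y)).trace := by
    rw [trace_mul_comm, Matrix.mul_assoc]
  have hYYX : (Y * (Y * X)).trace = (X * (Y * Y)).trace := by
    rw [← Matrix.mul_assoc, trace_mul_comm]
  simp only [pow_three, pow_two, Matrix.mul_add, Matrix.add_mul, Matrix.mul_assoc, trace_add,
    hXYX, hYXX, hYXY, hYYX]
  ring

theorem of_one_mul_of_one :
    (of fun _ _ : ι => (1 : R)) * of (fun _ _ : ι => (1 : R)) =
      (Fintype.card ι : R) • of fun _ _ : ι => (1 : R) := by
  ext i j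
  simp [mul_apply]

theorem trace_of_one : (of fun _ _ : ι => (1 : R)).trace = Fintype.card ι := by
  simp [trace]

theorem trace_mul_of_one (X : Matrix ι ι R) :
    (X * of fun _ _ : ι => (1 : R)).trace = ∑ i, ∑ j, X i j := by
  simp [trace, mul_apply]

theorem IsSymm.trace_mul_self_mul_of_one {X : Matrix ι ι R} (hX : X.IsSymm) :
    (X * X * of fun _ _ : ι => (1 : R)).trace = ∑ i, (∑ j, X i j) ^ 2 := by
  rw [trace_mul_of_one]
  simp only [mul_apply, sq, Finset.sum_mul_sum]
  calc ∑ i, ∑ j, ∑ k, X i k * X k j = ∑ i, ∑ k, ∑ j, X i k * X k j :=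
        Finset.sum_congr rfl fun _ _ => Finset.sum_comm
    _ = ∑ k, ∑ i, ∑ j, X i k * X k j := Finset.sum_comm
    _ = ∑ k, ∑ i, ∑ j, X k i * X k j := by simp only [hX.apply]

/-- The trace of the cube of a traceless symmetric matrix shifted by a multiple of the
off-diagonal all-ones matrix. -/
theorem IsSymm.trace_sub_smul_of_one_add_smul_one_pow_three [DecidableEq ι]
    {X : Matrix ι ι R} (hX : X.IsSymm) (htrace : X.trace = 0) (p : R) :
    ((X - p • of (fun _ _ : ι => (1 : R)) + p • (1 : Matrix ι ι R)) ^ 3).trace =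
      (X ^ 3).trace - 3 * p * (∑ i, (∑ j, X i j) ^ 2 - (X ^ 2).trace)
        + 3 * p ^ 2 * (Fintype.card ι - 2) * ∑ i, ∑ j, X i j
        - p ^ 3 * Fintype.card ι * (Fintype.card ι - 1) * (Fintype.card ι - 2) := by
  have hsq := hX.trace_mul_self_mul_of_one
  have hlin := trace_mul_of_one X
  have hone := trace_of_one (ι := ι) (R := R)
  have hmul := of_one_mul_of_one (ι := ι) (R := R)
  set J : Matrix ι ι R := of fun _ _ : ι => (1 : R)
  have hsplit : X - p • J + p • (1 : Matrix ι ι R) = X + p • (1 - J) := by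
    rw [smul_sub]; abel
  have hJsq : (1 - J) ^ 2 = 1 + ((Fintype.card ι : R) - 2) • J := by
    rw [sq, sub_smul, two_smul]
    simp only [Matrix.mul_sub, Matrix.sub_mul, hmul, Matrix.mul_one, Matrix.one_mul]
    abel
  have hJcube : ((1 - J) ^ 3).trace =
      -((Fintype.card ι : R) * (Fintype.card ι - 1) * (Fintype.card ι - 2)) := by
    rw [pow_succ, hJsq]
    simp only [Matrix.mul_sub, Matrix.add_mul, Matrix.mul_one, Matrix.one_mul,
      Matrix.smul_mul, hmul, trace_sub, trace_add, trace_smul, trace_one, hone, smul_eq_mul]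
    ring
  rw [hsplit, trace_add_pow_three, smul_pow, smul_pow, hJsq]
  simp only [Matrix.mul_smul, trace_smul, hJcube, smul_eq_mul, Matrix.mul_sub, Matrix.mul_add,
    Matrix.mul_one, trace_sub, trace_add, sq X, hsq, hlin, htrace]
  ring

end Matrix

/-- Lemma `lem:centered-triangle-count`: for the adjacency matrix `A` of a
simple graph on `n` vertices with `m` edges, degrees `d_i`, all-ones matrix `𝟏` and identity `I`,
`tr[(A - p𝟏 + pI)³] = tr[A³] - p³n³ + p³n + 6mp(np - 2p + 1) + 3p³n(n-1) - 3p Σ_i d_i²`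
for every real `p`, and if `p = m / C(n,2)` then
`tr[(A - p𝟏 + pI)³] ≤ tr[A³] - p³n³ + p³n + 6mp`. -/
theorem trace_cube_centered_adjacency
    (n m : ℕ) (A : Matrix (Fin n) (Fin n) ℝ)
    (hA01 : ∀ i j, A i j = 0 ∨ A i j = 1)
    (hAsymm : ∀ i j, A i j = A j i)
    (hAdiag : ∀ i, A i i = 0)
    (hAedges : ∑ i, ∑ j, A i j = 2 * (m : ℝ))
    (p : ℝ) :
    (((A - p • Matrix.of (fun _ _ : Fin n => (1 : ℝ)) + p • (1 : Matrix (Fin n) (Fin n) ℝ)) ^ 3).trace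
        = (A ^ 3).trace - p ^ 3 * (n : ℝ) ^ 3 + p ^ 3 * (n : ℝ)
          + 6 * (m : ℝ) * p * ((n : ℝ) * p - 2 * p + 1)
          + 3 * p ^ 3 * (n : ℝ) * ((n : ℝ) - 1)
          - 3 * p * ∑ i, (∑ j, A i j) ^ 2) ∧
      (p = (m : ℝ) / (n.choose 2 : ℝ) →
        ((A - p • Matrix.of (fun _ _ : Fin n => (1 : ℝ)) + p • (1 : Matrix (Fin n) (Fin n) ℝ)) ^ 3).trace
          ≤ (A ^ 3).trace - p ^ 3 * (n : ℝ) ^ 3 + p ^ 3 * (n : ℝ) + 6 * (m : ℝ) * p) := by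
  have hsymm : A.IsSymm := Matrix.IsSymm.ext fun i j => hAsymm j i
  have hsq : (A ^ 2).trace = 2 * (m : ℝ) := by
    have hentry : ∀ i j, A i j * A j i = A i j := fun i j => by
      rw [← hAsymm i j]
      rcases hA01 i j with h | h <;> simp [h]
    simpa only [sq, Matrix.trace, Matrix.diag_apply, Matrix.mul_apply, hentry] using hAedges
  have htr : A.trace = 0 := by simp [Matrix.trace, hAdiag]
  have hexp := hsymm.trace_sub_smul_of_one_add_smul_one_pow_three htr p
  rw [hsq, hAedges, Fintype.card_fin] at hexp
  refine ⟨by rw [hexp]; ring, fun hp => ?_⟩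
  rw [hexp]
  rcases lt_or_ge n 2 with hn | hn
  · have hp0 : p = 0 := by rw [hp, Nat.choose_eq_zero_of_lt hn]; simp
    simp [hp0]
  have hn' : (2 : ℝ) ≤ n := by exact_mod_cast hn
  have hp0 : 0 ≤ p := by rw [hp]; positivity
  have hpm : p * (n * (n - 1)) = 2 * (m : ℝ) := by
    have hn1 : (n : ℝ) - 1 ≠ 0 := (show (0 : ℝ) < n - 1 by linarith).ne'
    rw [hp, Nat.cast_choose_two]
    field_simp
  have hcs : (2 * (m : ℝ)) ^ 2 ≤ n * ∑ i, (∑ j, A i j) ^ 2 := by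
    have h := sq_sum_le_card_mul_sum_sq (s := Finset.univ) (f := fun i => ∑ j, A i j)
    simpa [hAedges] using h
  have hdeg : p * (n - 1) * (2 * (m : ℝ)) ≤ ∑ i, (∑ j, A i j) ^ 2 := by
    refine le_of_mul_le_mul_left (le_trans (le_of_eq ?_) hcs) (by linarith : (0 : ℝ) < n)
    linear_combination (2 * (m : ℝ)) * hpm
  have hcubic : 3 * p ^ 3 * n * (n - 1) = 3 * p ^ 2 * (2 * (m : ℝ)) := by
    linear_combination 3 * p ^ 2 * hpm
  linarith [mul_le_mul_of_nonneg_left hdeg (by positivity : 0 ≤ 3 * p)]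
end
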